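/- arXiv:2012.06355 — 5 statements merged into one kernel-verified Lean document; each statement's English description precedes it below -/
import Mathlib

section
/- Boolean central limit theorem (analytic form): let ν be a compactly supported Borel probability measure on ℝ with mean 0 and variance 1, and for each integer n ≥ 1 let μ_n be a Borel probability measure on ℝ satisfying B_{μ_n}(z) = √n · B_ν(√n · z) for all z ∈ ℍ. Then μ_n converges weakly to (1/2)δ₁ + (1/2)δ₋₁ as n → ∞. -/
open MeasureTheory Filter Topology Set
open scoped ENNReal

/-- The Cauchy transform of a measure on ℝ, `G_μ(z) = ∫ 1/(z-x) dμ(x)`. -/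
noncomputable def cauchyTransform (μ : Measure ℝ) (z : ℂ) : ℂ :=
  ∫ x, (z - (x : ℂ))⁻¹ ∂μ

/-- The F-transform of a measure on ℝ, `F_μ(z) = 1/G_μ(z)`. -/
noncomputable def Ftransform (μ : Measure ℝ) (z : ℂ) : ℂ :=
  (cauchyTransform μ z)⁻¹

/-- The B-transform of a measure on ℝ, `B_μ(z) = z - F_μ(z)`. -/
noncomputable def Btransform (μ : Measure ℝ) (z : ℂ) : ℂ :=
  z - Ftransform μ z

lemma norm_inv_sub_ofReal_le {z : ℂ} (hz : 0 < z.im) (x : ℝ) :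
    ‖(z - (x : ℂ))⁻¹‖ ≤ z.im⁻¹ := by
  rw [norm_inv]
  refine inv_anti₀ hz ?_
  simpa using (le_abs_self _).trans (Complex.abs_im_le_norm (z - (x : ℂ)))

lemma sub_ofReal_ne_zero {z : ℂ} (hz : 0 < z.im) (x : ℝ) : z - (x : ℂ) ≠ 0 := by
  intro h
  have := congrArg Complex.im h
  simp at this
  exact hz.ne' this

lemma integrable_inv_sub_ofReal (μ : Measure ℝ) [IsFiniteMeasure μ] {z : ℂ} (hz : 0 < z.im) :
    Integrable (fun x : ℝ => (z - (x : ℂ))⁻¹) μ :=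
  Integrable.of_bound (by fun_prop) z.im⁻¹ (.of_forall (norm_inv_sub_ofReal_le hz))

/-- Dilating by `c → ∞` in a fixed direction `z ∈ ℍ`, `∫ g(x) · cz / (cz - x) → ∫ g`. -/
lemma tendsto_integral_mul_div_sub_ofReal {ν : Measure ℝ} {g : ℝ → ℂ} (hg : Integrable g ν)
    {z : ℂ} (hz : 0 < z.im) {c : ℕ → ℝ} (hc : Tendsto c atTop atTop) :
    Tendsto (fun n => ∫ x : ℝ, g x * ((c n * z) * (c n * z - (x : ℂ))⁻¹) ∂ν) atTop
      (𝓝 (∫ x, g x ∂ν)) := by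
  have hz0 : z ≠ 0 := by rintro rfl; simp at hz
  have hpos : ∀ᶠ n in atTop, 0 < c n := hc.eventually_gt_atTop 0
  refine tendsto_integral_filter_of_dominated_convergence (fun x => ‖g x‖ * (‖z‖ * z.im⁻¹))
    (.of_forall fun n => hg.aestronglyMeasurable.mul (by fun_prop)) ?_ (hg.norm.mul_const _)
    (.of_forall fun x => ?_)
  · filter_upwards [hpos] with n hn
    refine .of_forall fun x => ?_
    rw [norm_mul]
    gcongr
    have h := norm_inv_sub_ofReal_le (z := c n * z) (by simpa using mul_pos hn hz) x
    have him : ((c n : ℂ) * z).im = c n * z.im := by simp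
    rw [norm_mul, norm_mul, Complex.norm_real, Real.norm_of_nonneg hn.le]
    rw [him, mul_inv] at h
    calc c n * ‖z‖ * ‖(c n * z - (x : ℂ))⁻¹‖ ≤ c n * ‖z‖ * ((c n)⁻¹ * z.im⁻¹) := by gcongr
      _ = ‖z‖ * z.im⁻¹ := by field_simp
  · have hinv : Tendsto (fun n => (((c n)⁻¹ : ℝ) : ℂ)) atTop (𝓝 0) := by
      have h := (Complex.continuous_ofReal.tendsto 0).comp (tendsto_inv_atTop_zero.comp hc)
      rwa [Complex.ofReal_zero] at h
    have hlim : Tendsto (fun n => g x * (z * (z - (((c n)⁻¹ : ℝ) : ℂ) * x)⁻¹)) atTop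
        (𝓝 (g x * (z * (z - 0 * (x : ℂ))⁻¹))) :=
      (((tendsto_const_nhds.sub (hinv.mul_const _)).inv₀ (by simpa using hz0)).const_mul
        _).const_mul _
    simp only [zero_mul, sub_zero, mul_inv_cancel₀ hz0, mul_one] at hlim
    refine hlim.congr' ?_
    filter_upwards [hpos] with n hn
    have hn0 : (c n : ℂ) ≠ 0 := by exact_mod_cast hn.ne'
    have : (c n : ℂ) * z - x = c n * (z - (((c n)⁻¹ : ℝ) : ℂ) * x) := by
      push_cast
      field_simp
    rw [this, mul_inv]
    field_simp

/-- For a centered measure of unit variance, `w * B_ν(w) → 1` as `w = cz`, `c → ∞`. -/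
lemma tendsto_mul_Btransform {ν : Measure ℝ} [IsProbabilityMeasure ν]
    (hint : Integrable (fun x : ℝ => x) ν) (hint2 : Integrable (fun x : ℝ => x ^ 2) ν)
    (hmean : ∫ x, x ∂ν = 0) (hsq : ∫ x, x ^ 2 ∂ν = 1)
    {z : ℂ} (hz : 0 < z.im) {c : ℕ → ℝ} (hc : Tendsto c atTop atTop) :
    Tendsto (fun n => (c n * z) * Btransform ν (c n * z)) atTop (𝓝 1) := by
  have hone := tendsto_integral_mul_div_sub_ofReal (ν := ν) (g := fun _ => 1)
    (integrable_const _) hz hc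
  have hsqr := tendsto_integral_mul_div_sub_ofReal (ν := ν) (g := fun x => ((x ^ 2 : ℝ) : ℂ))
    hint2.ofReal hz hc
  have hsqC : ∫ x, ((x ^ 2 : ℝ) : ℂ) ∂ν = 1 := by rw [integral_complex_ofReal, hsq, Complex.ofReal_one]
  have hmeanC : ∫ x, (x : ℂ) ∂ν = 0 := by rw [integral_complex_ofReal, hmean, Complex.ofReal_zero]
  rw [hsqC] at hsqr
  simp only [integral_const, probReal_univ, one_smul, one_mul] at hone
  have hquot := hsqr.div hone one_ne_zero
  rw [div_one] at hquot
  refine hquot.congr' ?_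
  filter_upwards [hc.eventually_gt_atTop 0, hone.eventually_ne one_ne_zero] with n hn hne
  have hw : 0 < ((c n : ℂ) * z).im := by simpa using mul_pos hn hz
  rw [Pi.div_apply]
  generalize (c n : ℂ) * z = w at hw hne ⊢
  have hG : ∫ x : ℝ, w * (w - (x : ℂ))⁻¹ ∂ν = w * cauchyTransform ν w :=
    integral_const_mul _ _
  have hS : ∫ x : ℝ, ((x ^ 2 : ℝ) : ℂ) * (w * (w - (x : ℂ))⁻¹) ∂ν
      = w ^ 2 * (w * cauchyTransform ν w - 1) := by
    have hpt : ∀ x : ℝ, ((x ^ 2 : ℝ) : ℂ) * (w * (w - (x : ℂ))⁻¹)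
        = w ^ 3 * (w - (x : ℂ))⁻¹ - (w ^ 2 + w * x) := by
      intro x
      have := sub_ofReal_ne_zero hw x
      push_cast
      field_simp
      ring
    have hx : Integrable (fun x : ℝ => w * (x : ℂ)) ν := hint.ofReal.const_mul w
    have hadd : Integrable (fun x : ℝ => w ^ 2 + w * (x : ℂ)) ν := (integrable_const _).add hx
    simp only [hpt]
    rw [integral_sub ((integrable_inv_sub_ofReal ν hw).const_mul _) hadd,
      integral_add (integrable_const _) hx,
      integral_const_mul, integral_const_mul, hmeanC]
    simp only [integral_const, probReal_univ, one_smul, cauchyTransform]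
    ring
  rw [hG] at hne ⊢
  rw [hS, Btransform, Ftransform]
  have hw0 := left_ne_zero_of_mul hne
  have hG0 := right_ne_zero_of_mul hne
  field_simp

/-- If the Cauchy transforms converge pointwise on `ℍ` to `z / (z² - 1)`, the Cauchy transform of
the symmetric Bernoulli measure, then integrals of bounded continuous functions vanishing at
`±1` tend to zero. -/
lemma tendsto_integral_zero_of_tendsto_cauchyTransform {μ : ℕ → Measure ℝ}
    [hμ : ∀ n, IsProbabilityMeasure (μ n)]
    (hG : ∀ z : ℂ, 0 < z.im →
      Tendsto (fun n => cauchyTransform (μ n) z) atTop (𝓝 (z - z⁻¹)⁻¹))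
    {g : ℝ → ℝ} (hg : Continuous g) {C : ℝ} (hC : ∀ x, |g x| ≤ C) (hg1 : g 1 = 0)
    (hgneg : g (-1) = 0) :
    Tendsto (fun n => ∫ x, g x ∂(μ n)) atTop (𝓝 0) := by
  set p : ℝ → ℝ := fun x =>
    1 - 4 / 3 * ((Complex.I - (x : ℂ))⁻¹).im + 25 / 6 * ((2 * Complex.I - (x : ℂ))⁻¹).im with hp
  have him1 : 0 < Complex.I.im := by simp
  have him2 : 0 < (2 * Complex.I).im := by simp
  have hp_eq : ∀ x, p x = (x ^ 2 - 1) ^ 2 / ((x ^ 2 + 1) * (x ^ 2 + 4)) := by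
    intro x
    have h1 : x ^ 2 + 1 ≠ 0 := by positivity
    have h2 : x ^ 2 + 4 ≠ 0 := by positivity
    have e1 : ((Complex.I - (x : ℂ))⁻¹).im = -1 / (x ^ 2 + 1) := by
      simp [Complex.inv_im, Complex.normSq_apply]; ring
    have e2 : ((2 * Complex.I - (x : ℂ))⁻¹).im = -2 / (x ^ 2 + 4) := by
      simp [Complex.inv_im, Complex.normSq_apply]; ring
    rw [hp]
    simp only [e1, e2]
    field_simp
    ring
  have hi1 : ∀ n, Integrable (fun x : ℝ => ((Complex.I - (x : ℂ))⁻¹).im) (μ n) := fun n =>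
    (integrable_inv_sub_ofReal (μ n) him1).im
  have hi2 : ∀ n, Integrable (fun x : ℝ => ((2 * Complex.I - (x : ℂ))⁻¹).im) (μ n) := fun n =>
    (integrable_inv_sub_ofReal (μ n) him2).im
  have hi3 : ∀ n, Integrable
      (fun x : ℝ => 1 - 4 / 3 * ((Complex.I - (x : ℂ))⁻¹).im) (μ n) := fun n =>
    (integrable_const _).sub ((hi1 n).const_mul _)
  have hp_int : ∀ n, Integrable p (μ n) := fun n =>
    (hi3 n).add ((hi2 n).const_mul _)
  have hp_lim : Tendsto (fun n => ∫ x, p x ∂(μ n)) atTop (𝓝 0) := by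
    have l1 := (Complex.continuous_im.tendsto _).comp (hG _ him1)
    have l2 := (Complex.continuous_im.tendsto _).comp (hG _ him2)
    have l := (tendsto_const_nhds (x := (1 : ℝ))).sub (l1.const_mul (4 / 3))
      |>.add (l2.const_mul (25 / 6))
    convert l using 2 with n
    · rw [hp, integral_add (hi3 n) ((hi2 n).const_mul _),
        integral_sub (integrable_const _) ((hi1 n).const_mul _),
        integral_const_mul, integral_const_mul]
      have j1 := integral_im (integrable_inv_sub_ofReal (μ n) him1)
      have j2 := integral_im (integrable_inv_sub_ofReal (μ n) him2)
      simp only [RCLike.im_eq_complex_im] at j1 j2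
      rw [j1, j2]
      simp [cauchyTransform]
    · simp [Complex.inv_im, Complex.normSq_apply]
      norm_num
  have hC0 : 0 ≤ C := (abs_nonneg _).trans (hC 0)
  have hp0 : ∀ x, 0 ≤ p x := fun x => by rw [hp_eq]; positivity
  have hg_int : ∀ n, Integrable g (μ n) := fun n =>
    Integrable.of_bound hg.aestronglyMeasurable C (.of_forall hC)
  have key : ∀ ε > 0, ∃ D : ℝ, 0 ≤ D ∧ ∀ x, |g x| ≤ ε + D * p x := by
    intro ε hε
    obtain ⟨δ₁, hδ₁, h1⟩ := Metric.continuous_iff.1 hg 1 ε hε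
    obtain ⟨δ₂, hδ₂, h2⟩ := Metric.continuous_iff.1 hg (-1) ε hε
    simp only [Real.dist_eq, hg1, hgneg, sub_zero, sub_neg_eq_add] at h1 h2
    obtain ⟨s, hs⟩ : ∃ s, s = δ₁ * δ₂ := ⟨_, rfl⟩
    have hs0 : 0 < s := hs ▸ mul_pos hδ₁ hδ₂
    refine ⟨C * ((s + 5) / s) ^ 2, by positivity, fun x => ?_⟩
    by_cases hx1 : |x - 1| < δ₁
    · have := mul_nonneg (by positivity : 0 ≤ C * ((s + 5) / s) ^ 2) (hp0 x)
      linarith [h1 x hx1]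
    by_cases hx2 : |x + 1| < δ₂
    · have := mul_nonneg (by positivity : 0 ≤ C * ((s + 5) / s) ^ 2) (hp0 x)
      linarith [h2 x hx2]
    push Not at hx1 hx2
    have hsx : s ≤ |x ^ 2 - 1| := by
      rw [show x ^ 2 - 1 = (x - 1) * (x + 1) by ring, abs_mul, hs]
      gcongr
    have hlin : s * (x ^ 2 + 4) ≤ (s + 5) * |x ^ 2 - 1| := by
      nlinarith [le_abs_self (x ^ 2 - 1)]
    have hone : 1 ≤ ((s + 5) / s) ^ 2 * p x := by
      rw [hp_eq, div_pow, div_mul_div_comm, one_le_div (by positivity)]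
      calc s ^ 2 * ((x ^ 2 + 1) * (x ^ 2 + 4)) ≤ (s * (x ^ 2 + 4)) ^ 2 := by
            rw [mul_pow, sq (x ^ 2 + 4)]
            gcongr
            norm_num
        _ ≤ ((s + 5) * |x ^ 2 - 1|) ^ 2 := by gcongr
        _ = (s + 5) ^ 2 * (x ^ 2 - 1) ^ 2 := by rw [mul_pow, sq_abs]
    calc |g x| ≤ C * 1 := by simpa using hC x
      _ ≤ C * (((s + 5) / s) ^ 2 * p x) := by gcongr
      _ ≤ ε + C * ((s + 5) / s) ^ 2 * p x := by rw [← mul_assoc]; linarith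
  rw [Metric.tendsto_atTop']
  intro ε hε
  obtain ⟨D, hD, hgD⟩ := key (ε / 2) (half_pos hε)
  have hlim : Tendsto (fun n => ε / 2 + D * ∫ x, p x ∂(μ n)) atTop (𝓝 (ε / 2)) := by
    simpa using (hp_lim.const_mul D).const_add (ε / 2)
  obtain ⟨N, hN⟩ := eventually_atTop.1 (hlim.eventually_lt_const (half_lt_self hε))
  refine ⟨N, fun n hn => ?_⟩
  rw [Real.dist_eq, sub_zero]
  refine lt_of_le_of_lt ?_ (hN n hn.le)
  calc |∫ x, g x ∂(μ n)| ≤ ∫ x, |g x| ∂(μ n) := abs_integral_le_integral_abs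
    _ ≤ ∫ x, (ε / 2 + D * p x) ∂(μ n) := integral_mono (hg_int n).abs
        ((integrable_const _).add ((hp_int n).const_mul D)) hgD
    _ = ε / 2 + D * ∫ x, p x ∂(μ n) := by
        rw [integral_add (integrable_const _) ((hp_int n).const_mul D), integral_const_mul]
        simp

/-- If the Cauchy transforms converge pointwise on `ℍ` to `z / (z² - 1)`, the measures converge
weakly to the symmetric Bernoulli measure. -/
lemma tendsto_integral_of_tendsto_cauchyTransform {μ : ℕ → Measure ℝ}
    [hμ : ∀ n, IsProbabilityMeasure (μ n)]
    (hG : ∀ z : ℂ, 0 < z.im →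
      Tendsto (fun n => cauchyTransform (μ n) z) atTop (𝓝 (z - z⁻¹)⁻¹))
    (f : BoundedContinuousFunction ℝ ℝ) :
    Tendsto (fun n => ∫ x, f x ∂(μ n)) atTop (𝓝 ((f 1 + f (-1)) / 2)) := by
  set k : ℝ → ℝ := fun x => ((1 + Complex.I - (x : ℂ))⁻¹).re with hk
  have him : 0 < (1 + Complex.I).im := by simp
  have hk_cont : Continuous k := Complex.continuous_re.comp
    (Continuous.inv₀ (by fun_prop) (sub_ofReal_ne_zero him))
  have hk_le : ∀ x, |k x| ≤ 1 := fun x =>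
    (Complex.abs_re_le_norm _).trans (by simpa using norm_inv_sub_ofReal_le him x)
  have hk1 : k 1 = 0 := by simp [hk]
  have hkneg : k (-1) = 2 / 5 := by
    simp [hk, Complex.inv_re, Complex.normSq_apply]
    norm_num
  have hk_int : ∀ n, Integrable k (μ n) := fun n => (integrable_inv_sub_ofReal (μ n) him).re
  have hk_lim : Tendsto (fun n => ∫ x, k x ∂(μ n)) atTop (𝓝 (1 / 5)) := by
    have l := (Complex.continuous_re.tendsto _).comp (hG _ him)
    convert l using 2 with n
    · have j := integral_re (integrable_inv_sub_ofReal (μ n) him)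
      simp only [RCLike.re_eq_complex_re] at j
      rw [hk, j]
      simp [cauchyTransform]
    · simp [Complex.inv_re, Complex.inv_im, Complex.normSq_apply]
      norm_num
  set a := 5 / 2 * (f (-1) - f 1) with ha
  have hzero := tendsto_integral_zero_of_tendsto_cauchyTransform hG
    (g := fun x => f x - (f 1 + a * k x)) (C := ‖f‖ + (|f 1| + |a| * 1))
    (f.continuous.sub (continuous_const.add (hk_cont.const_mul a)))
    (fun x => (abs_sub _ _).trans (add_le_add (f.norm_coe_le_norm x)
      ((abs_add_le _ _).trans (by rw [abs_mul]; gcongr; exact hk_le x))))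
    (by simp [hk1]) (by rw [hkneg, ha]; ring)
  have hsum := hzero.add ((hk_lim.const_mul a).const_add (f 1))
  convert hsum using 2 with n
  · have hadd : Integrable (fun x => f 1 + a * k x) (μ n) :=
      (integrable_const _).add ((hk_int n).const_mul a)
    rw [integral_sub (f.integrable _) hadd,
      integral_add (integrable_const _) ((hk_int n).const_mul a), integral_const_mul]
    simp
  · rw [ha]; ring

/-- Boolean central limit theorem (analytic form): if ν is a compactly supported
probability measure with mean 0 and variance 1, and `B_{μ_n}(z) = √n·B_ν(√n·z)` on ℍ,
then μ_n → (1/2)δ₁ + (1/2)δ₋₁ weakly. -/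
theorem boolean_central_limit_theorem
    (ν : Measure ℝ) [IsProbabilityMeasure ν]
    (hsupp : ∃ K : Set ℝ, IsCompact K ∧ ν Kᶜ = 0)
    (hmean : (∫ x, x ∂ν) = 0)
    (hvar : (∫ x, x ^ 2 ∂ν) - (∫ x, x ∂ν) ^ 2 = 1)
    (μ : ℕ → Measure ℝ) (hμ : ∀ n, IsProbabilityMeasure (μ n))
    (hB : ∀ n : ℕ, 1 ≤ n → ∀ z : ℂ, 0 < z.im →
      Btransform (μ n) z
        = ((Real.sqrt n : ℝ) : ℂ) * Btransform ν (((Real.sqrt n : ℝ) : ℂ) * z)) :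
    ∀ f : BoundedContinuousFunction ℝ ℝ,
      Tendsto (fun n => ∫ x, f x ∂(μ n)) atTop
        (nhds (∫ x, f x ∂(((1 : ℝ≥0∞) / 2) • Measure.dirac (1 : ℝ)
          + ((1 : ℝ≥0∞) / 2) • Measure.dirac (-1 : ℝ)))) := by
  have hsq : ∫ x, x ^ 2 ∂ν = 1 := by simpa [hmean] using hvar
  have hint2 : Integrable (fun x : ℝ => x ^ 2) ν :=
    .of_integral_ne_zero (by rw [hsq]; exact one_ne_zero)
  have hint : Integrable (fun x : ℝ => x) ν :=
    ((memLp_two_iff_integrable_sq (by fun_prop)).2 hint2).integrable (by norm_num)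
  have hc : Tendsto (fun n : ℕ => Real.sqrt n) atTop atTop :=
    Real.tendsto_sqrt_atTop.comp tendsto_natCast_atTop_atTop
  have hG : ∀ z : ℂ, 0 < z.im →
      Tendsto (fun n => cauchyTransform (μ n) z) atTop (𝓝 (z - z⁻¹)⁻¹) := by
    intro z hz
    have hz0 : z ≠ 0 := by rintro rfl; simp at hz
    have hF0 : z - z⁻¹ ≠ 0 := by
      intro h
      have him := congrArg Complex.im h
      have : 0 ≤ z.im / Complex.normSq z := div_nonneg hz.le (Complex.normSq_nonneg z)
      simp only [Complex.sub_im, Complex.inv_im, Complex.zero_im, neg_div] at him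
      linarith
    have hlim := (tendsto_const_nhds (x := z)).sub
      ((tendsto_mul_Btransform hint hint2 hmean hsq hz hc).const_mul z⁻¹)
    rw [mul_one] at hlim
    refine (hlim.inv₀ hF0).congr' ?_
    filter_upwards [eventually_ge_atTop 1] with n hn
    have h := hB n hn z hz
    have hscale : z⁻¹ * (((Real.sqrt n : ℝ) : ℂ) * z
        * Btransform ν (((Real.sqrt n : ℝ) : ℂ) * z)) = Btransform (μ n) z := by
      rw [h]
      field_simp
    rw [hscale, Btransform, Ftransform, sub_sub_cancel, inv_inv]
  intro f
  have hlim := tendsto_integral_of_tendsto_cauchyTransform hG f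
  convert hlim using 2
  rw [integral_add_measure ((f.integrable _).smul_measure (by simp))
    ((f.integrable _).smul_measure (by simp))]
  simp
  ring
end

section
/- Monotone central limit theorem (analytic form): let ν be a compactly supported Borel probability measure on ℝ with mean 0 and variance 1. For each integer n ≥ 1 set F_n(z) = n^{−1/2}·F_ν(n^{1/2}·z) for z ∈ ℍ, and let μ_n be a Borel probability measure on ℝ with F_{μ_n} equal to the n-fold composition F_n ∘ F_n ∘ ⋯ ∘ F_n. Then μ_n converges weakly, as n → ∞, to the arcsine distribution A(0,1), i.e., the absolutely continuous probability measure with density x ↦ 1/(π√(2−x²)) on the interval (−√2, √2). -/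
open MeasureTheory Filter Topology Set

/-- The arcsine distribution `A(0,1)`, with density `1/(π√(2-x²))` on `(-√2, √2)`. -/
noncomputable def arcsineDistribution : Measure ℝ :=
  volume.withDensity
    (Set.indicator (Set.Ioo (-(Real.sqrt 2)) (Real.sqrt 2))
      (fun x => ENNReal.ofReal (1 / (Real.pi * Real.sqrt (2 - x ^ 2)))))

section

open Complex BoundedContinuousFunction

lemma ofReal_mul_I_sub_ofReal_ne_zero {c : ℝ} (hc : c ≠ 0) (x : ℝ) : (c : ℂ) * I - x ≠ 0 := by
  intro h
  apply hc
  simpa using congrArg Complex.im h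

lemma norm_inv_ofReal_mul_I_sub_ofReal_le {c : ℝ} (hc : c ≠ 0) (x : ℝ) :
    ‖((c : ℂ) * I - x)⁻¹‖ ≤ |c|⁻¹ := by
  rw [norm_inv]
  refine inv_anti₀ (abs_pos.2 hc) ?_
  simpa using Complex.abs_im_le_norm ((c : ℂ) * I - x)

/-- The function `x ↦ 1 / (i c - x)` on the real line, for real `c ≠ 0`. -/
noncomputable def imaginaryResolvent (c : ℝ) (hc : c ≠ 0) : ℝ →ᵇ ℂ :=
  BoundedContinuousFunction.ofNormedAddCommGroup (fun x : ℝ => ((c : ℂ) * I - x)⁻¹)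
    (Continuous.inv₀ (by fun_prop) (ofReal_mul_I_sub_ofReal_ne_zero hc)) |c|⁻¹
    (norm_inv_ofReal_mul_I_sub_ofReal_le hc)

lemma imaginaryResolvent_apply {c : ℝ} (hc : c ≠ 0) (x : ℝ) :
    imaginaryResolvent c hc x = ((c : ℂ) * I - x)⁻¹ := rfl

lemma norm_imaginaryResolvent_le {c : ℝ} (hc : c ≠ 0) : ‖imaginaryResolvent c hc‖ ≤ |c|⁻¹ :=
  (BoundedContinuousFunction.norm_le (by positivity)).2 (norm_inv_ofReal_mul_I_sub_ofReal_le hc)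

lemma star_imaginaryResolvent {c : ℝ} (hc : c ≠ 0) :
    star (imaginaryResolvent c hc) = imaginaryResolvent (-c) (neg_ne_zero.2 hc) := by
  ext x
  simp [imaginaryResolvent_apply]

lemma imaginaryResolvent_sub {c d : ℝ} (hc : c ≠ 0) (hd : d ≠ 0) :
    imaginaryResolvent c hc - imaginaryResolvent d hd
      = (((d : ℂ) - c) * I) • (imaginaryResolvent c hc * imaginaryResolvent d hd) := by
  ext x
  have h₁ := ofReal_mul_I_sub_ofReal_ne_zero hc x
  have h₂ := ofReal_mul_I_sub_ofReal_ne_zero hd x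
  simp only [BoundedContinuousFunction.sub_apply, BoundedContinuousFunction.smul_apply,
    BoundedContinuousFunction.mul_apply, imaginaryResolvent_apply, smul_eq_mul]
  rw [inv_sub_inv h₁ h₂, div_eq_mul_inv, mul_inv]
  ring

/-- The linear span of the constants and the resolvents `x ↦ 1 / (i c - x)` with `y₀ ≤ |c|`. -/
noncomputable def resolventSpan (y₀ : ℝ) : Submodule ℂ (ℝ →ᵇ ℂ) :=
  Submodule.span ℂ ({1} ∪ {f | ∃ (c : ℝ) (hc : c ≠ 0), y₀ ≤ |c| ∧ f = imaginaryResolvent c hc})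

lemma imaginaryResolvent_mem_resolventSpan {y₀ c : ℝ} (hc : c ≠ 0) (hy : y₀ ≤ |c|) :
    imaginaryResolvent c hc ∈ resolventSpan y₀ :=
  Submodule.subset_span (Or.inr ⟨c, hc, hy, rfl⟩)

lemma imaginaryResolvent_mul_mem_resolventSpan {y₀ c d : ℝ} (hc : c ≠ 0) (hd : d ≠ 0)
    (hcd : c ≠ d) (hyc : y₀ ≤ |c|) (hyd : y₀ ≤ |d|) :
    imaginaryResolvent c hc * imaginaryResolvent d hd ∈ resolventSpan y₀ := by
  have hne : ((d : ℂ) - c) * I ≠ 0 :=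
    mul_ne_zero (sub_ne_zero.2 (by exact_mod_cast hcd.symm)) I_ne_zero
  rw [← inv_smul_smul₀ hne (imaginaryResolvent c hc * imaginaryResolvent d hd),
    ← imaginaryResolvent_sub]
  exact Submodule.smul_mem _ _ (Submodule.sub_mem _
    (imaginaryResolvent_mem_resolventSpan hc hyc) (imaginaryResolvent_mem_resolventSpan hd hyd))

lemma imaginaryResolvent_mul_self_mem_closure {y₀ c : ℝ} (hc : c ≠ 0) (hyc : y₀ ≤ |c|) :
    imaginaryResolvent c hc * imaginaryResolvent c hc
      ∈ (resolventSpan y₀).topologicalClosure := by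
  have hpos (k : ℕ) : 0 < (1 : ℝ) / (k + 1) := by positivity
  have hd (k : ℕ) : c * (1 + 1 / ((k : ℝ) + 1)) ≠ 0 :=
    mul_ne_zero hc (by linarith [hpos k])
  have hcd (k : ℕ) : |c| ≤ |c * (1 + 1 / ((k : ℝ) + 1))| := by
    rw [abs_mul, abs_of_pos (by linarith [hpos k] : 0 < 1 + 1 / ((k : ℝ) + 1))]
    nlinarith [hpos k, abs_nonneg c]
  have hlim : Tendsto (fun k : ℕ => imaginaryResolvent (c * (1 + 1 / ((k : ℝ) + 1))) (hd k))
      atTop (𝓝 (imaginaryResolvent c hc)) := by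
    rw [tendsto_iff_norm_sub_tendsto_zero]
    refine squeeze_zero (fun _ => norm_nonneg _) (fun k => ?_)
      (by simpa only [mul_zero] using tendsto_one_div_add_atTop_nhds_zero_nat.const_mul |c|⁻¹)
    rw [imaginaryResolvent_sub, norm_smul]
    have h₁ : ‖((c : ℂ) - ((c * (1 + 1 / ((k : ℝ) + 1)) : ℝ) : ℂ)) * I‖
        = |c| * (1 / ((k : ℝ) + 1)) := by
      rw [norm_mul, norm_I, mul_one, ← ofReal_sub, norm_real, Real.norm_eq_abs,
        show c - c * (1 + 1 / ((k : ℝ) + 1)) = -(c * (1 / ((k : ℝ) + 1))) by ring, abs_neg,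
        abs_mul, abs_of_pos (hpos k)]
    have h₂ : ‖imaginaryResolvent (c * (1 + 1 / ((k : ℝ) + 1))) (hd k)
        * imaginaryResolvent c hc‖ ≤ |c|⁻¹ * |c|⁻¹ :=
      (norm_mul_le _ _).trans (mul_le_mul
        ((norm_imaginaryResolvent_le _).trans (inv_anti₀ (abs_pos.2 hc) (hcd k)))
        (norm_imaginaryResolvent_le hc) (norm_nonneg _) (by positivity))
    rw [h₁]
    have hc' : |c| ≠ 0 := abs_ne_zero.2 hc
    calc |c| * (1 / ((k : ℝ) + 1)) * _ ≤ |c| * (1 / ((k : ℝ) + 1)) * (|c|⁻¹ * |c|⁻¹) := by gcongr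
      _ = |c|⁻¹ * (1 / ((k : ℝ) + 1)) := by field_simp
  refine mem_closure_of_tendsto (hlim.mul_const _) (Eventually.of_forall fun k => ?_)
  refine imaginaryResolvent_mul_mem_resolventSpan (hd k) hc ?_ (hyc.trans (hcd k)) hyc
  intro h
  have : c * (1 / ((k : ℝ) + 1)) = 0 := by linarith
  exact mul_ne_zero hc (hpos k).ne' this

lemma imaginaryResolvent_mul_mem_closure {y₀ c : ℝ} (hc : c ≠ 0) (hyc : y₀ ≤ |c|) {f : ℝ →ᵇ ℂ}
    (hf : f ∈ (resolventSpan y₀).topologicalClosure) :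
    imaginaryResolvent c hc * f ∈ (resolventSpan y₀).topologicalClosure := by
  have hle : resolventSpan y₀ ≤ ((resolventSpan y₀).topologicalClosure).comap
      (LinearMap.mulLeft ℂ (imaginaryResolvent c hc)) := by
    refine Submodule.span_le.2 ?_
    rintro g (rfl | ⟨d, hd, hyd, rfl⟩)
    · change imaginaryResolvent c hc * 1 ∈ (resolventSpan y₀).topologicalClosure
      rw [mul_one]
      exact (resolventSpan y₀).le_topologicalClosure (imaginaryResolvent_mem_resolventSpan hc hyc)
    · rcases eq_or_ne c d with rfl | hcd
      · exact imaginaryResolvent_mul_self_mem_closure hc hyc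
      · exact (resolventSpan y₀).le_topologicalClosure
          (imaginaryResolvent_mul_mem_resolventSpan hc hd hcd hyc hyd)
  have hclosed : IsClosed {g : ℝ →ᵇ ℂ |
      imaginaryResolvent c hc * g ∈ (resolventSpan y₀).topologicalClosure} :=
    (resolventSpan y₀).isClosed_topologicalClosure.preimage (continuous_const_mul _)
  exact closure_minimal hle hclosed hf

/-- The star algebra generated by the resolvents `x ↦ 1 / (i c - x)` with `y₀ ≤ |c|`. -/
noncomputable def resolventAlgebra (y₀ : ℝ) : StarSubalgebra ℂ (ℝ →ᵇ ℂ) :=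
  StarAlgebra.adjoin ℂ {f | ∃ (c : ℝ) (hc : c ≠ 0), y₀ ≤ |c| ∧ f = imaginaryResolvent c hc}

lemma resolventAlgebra_le_closure (y₀ : ℝ) {f : ℝ →ᵇ ℂ} (hf : f ∈ resolventAlgebra y₀) :
    f ∈ (resolventSpan y₀).topologicalClosure := by
  have hf' : f ∈ (resolventAlgebra y₀).toSubalgebra.toSubmodule := hf
  rw [resolventAlgebra, StarAlgebra.adjoin_eq_span] at hf'
  refine (Submodule.span_le (p := (resolventSpan y₀).topologicalClosure)).2 ?_ hf'
  intro g hg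
  induction hg using Submonoid.closure_induction_left with
  | one => exact (resolventSpan y₀).le_topologicalClosure (Submodule.subset_span (Or.inl rfl))
  | mul_left x hx y _ ih =>
    obtain ⟨c, hc, hyc, rfl⟩ | ⟨c, hc, hyc, h⟩ := hx
    · exact imaginaryResolvent_mul_mem_closure hc hyc ih
    · rw [← star_star x, h, star_imaginaryResolvent]
      exact imaginaryResolvent_mul_mem_closure _ (by rwa [abs_neg]) ih

lemma separatesPoints_resolventAlgebra (y₀ : ℝ) :
    ((resolventAlgebra y₀).map (toContinuousMapStarₐ ℂ)).SeparatesPoints := by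
  intro x y hxy
  have hc : |y₀| + 1 ≠ 0 := by positivity
  refine ⟨_, ⟨_, ⟨imaginaryResolvent (|y₀| + 1) hc, StarAlgebra.subset_adjoin ℂ _
    ⟨_, hc, ?_, rfl⟩, rfl⟩, rfl⟩, ?_⟩
  · rw [abs_of_pos (by positivity)]
    linarith [le_abs_self y₀]
  · intro h
    have h' : imaginaryResolvent (|y₀| + 1) hc x = imaginaryResolvent (|y₀| + 1) hc y := h
    rw [imaginaryResolvent_apply, imaginaryResolvent_apply, inv_inj] at h'
    exact hxy (by simpa using h')

/-- Convergence of Cauchy transforms along the imaginary axis gives convergence of the integrals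
of every element of the resolvent algebra. -/
lemma tendsto_integral_of_mem_resolventAlgebra {μ : ℕ → Measure ℝ} {μ₀ : Measure ℝ}
    [∀ n, IsProbabilityMeasure (μ n)] [IsProbabilityMeasure μ₀] {y₀ : ℝ}
    (h : ∀ y : ℝ, y₀ ≤ y → 0 < y → Tendsto (fun n => cauchyTransform (μ n) ((y : ℂ) * I)) atTop
      (𝓝 (cauchyTransform μ₀ ((y : ℂ) * I))))
    {f : ℝ →ᵇ ℂ} (hf : f ∈ resolventAlgebra y₀) :
    Tendsto (fun n => ∫ x, f x ∂(μ n)) atTop (𝓝 (∫ x, f x ∂μ₀)) := by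
  have hlip (m : Measure ℝ) [IsProbabilityMeasure m] :
      LipschitzWith 1 fun g : ℝ →ᵇ ℂ => ∫ x, g x ∂m := by
    refine LipschitzWith.of_dist_le_mul fun g₁ g₂ => ?_
    rw [dist_eq_norm, ← integral_sub (g₁.integrable m) (g₂.integrable m), dist_eq_norm]
    simpa using (g₁ - g₂).norm_integral_le_norm m
  have hclosed : IsClosed {g : ℝ →ᵇ ℂ |
      Tendsto (fun n => ∫ x, g x ∂(μ n)) atTop (𝓝 (∫ x, g x ∂μ₀))} :=
    (LipschitzWith.uniformEquicontinuous _ 1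
      fun n => hlip (μ n)).equicontinuous.isClosed_setOfPred_tendsto (hlip μ₀).continuous
  refine closure_minimal (fun g hg => ?_) hclosed (resolventAlgebra_le_closure y₀ hf)
  induction hg using Submodule.span_induction with
  | mem g hg =>
    obtain rfl | ⟨c, hc, hyc, rfl⟩ := hg
    · simp
    · rcases hc.lt_or_gt with hneg | hpos
      · have key (m : Measure ℝ) : ∫ x, imaginaryResolvent c hc x ∂m
            = (starRingEnd ℂ) (cauchyTransform m (((-c : ℝ) : ℂ) * I)) := by
          rw [cauchyTransform, ← integral_conj]
          simp [imaginaryResolvent_apply]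
        simp only [mem_ofPred_eq, key]
        exact (continuous_conj.tendsto _).comp
          (h (-c) (by rwa [abs_of_neg hneg] at hyc) (by linarith))
      · exact h c (by rwa [abs_of_pos hpos] at hyc) hpos
  | zero => simp
  | add g₁ g₂ _ _ h₁ h₂ =>
    simp only [mem_ofPred_eq, BoundedContinuousFunction.add_apply] at *
    simp_rw [fun m : ℕ => integral_add (g₁.integrable (μ m)) (g₂.integrable (μ m)),
      integral_add (g₁.integrable μ₀) (g₂.integrable μ₀)]
    exact h₁.add h₂
  | smul a g _ hg =>
    simp only [mem_ofPred_eq, BoundedContinuousFunction.smul_apply, integral_smul] at *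
    exact hg.const_smul a

lemma inv_ofReal_mul_I_sub_ofReal_im {y : ℝ} (x : ℝ) :
    (((y : ℂ) * I - x)⁻¹).im = -(y / (x ^ 2 + y ^ 2)) := by
  simp [Complex.inv_im, Complex.normSq_apply]
  ring

lemma integrable_inv_ofReal_mul_I_sub_ofReal (m : Measure ℝ) [IsFiniteMeasure m] {y : ℝ}
    (hy : y ≠ 0) : Integrable (fun x : ℝ => ((y : ℂ) * I - x)⁻¹) m :=
  (imaginaryResolvent y hy).integrable m

lemma cauchyTransform_im (m : Measure ℝ) [IsFiniteMeasure m] {y : ℝ} (hy : y ≠ 0) :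
    (cauchyTransform m ((y : ℂ) * I)).im = -∫ x, y / (x ^ 2 + y ^ 2) ∂m := by
  have h := integral_im (integrable_inv_ofReal_mul_I_sub_ofReal m hy)
  simp only [RCLike.im_eq_complex_im, inv_ofReal_mul_I_sub_ofReal_im, integral_neg] at h
  exact h.symm

lemma integrable_div_sq_add_sq (m : Measure ℝ) [IsFiniteMeasure m] {y : ℝ} (hy : y ≠ 0) :
    Integrable (fun x : ℝ => y / (x ^ 2 + y ^ 2)) m := by
  have h := (integrable_inv_ofReal_mul_I_sub_ofReal m hy).im.neg
  refine h.congr (Eventually.of_forall fun x => ?_)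
  simp only [Pi.neg_apply, RCLike.im_eq_complex_im, inv_ofReal_mul_I_sub_ofReal_im, neg_neg]

lemma measure_abs_gt_le (m : Measure ℝ) [IsProbabilityMeasure m] {y : ℝ} (hy : 0 < y) :
    m {x | y < ‖x‖}
      ≤ ENNReal.ofReal (2 * (1 + y * (cauchyTransform m ((y : ℂ) * I)).im)) := by
  have hint := integrable_div_sq_add_sq m hy.ne'
  have heq : 2 * (1 + y * (cauchyTransform m ((y : ℂ) * I)).im)
      = ∫ x, 2 * (1 - y * (y / (x ^ 2 + y ^ 2))) ∂m := by
    rw [integral_const_mul, integral_sub (integrable_const _) (hint.const_mul y),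
      integral_const_mul, cauchyTransform_im m hy.ne']
    simp
    ring
  have hmeas : MeasurableSet {x : ℝ | y < ‖x‖} := measurableSet_lt measurable_const measurable_norm
  rw [heq, ← ofReal_measureReal]
  refine ENNReal.ofReal_le_ofReal ?_
  rw [← integral_indicator_one hmeas]
  refine integral_mono ((integrable_const _).indicator hmeas)
    (((integrable_const _).sub (hint.const_mul y)).const_mul 2) fun x => ?_
  have hpos : 0 < x ^ 2 + y ^ 2 := by positivity
  have hval : 2 * (1 - y * (y / (x ^ 2 + y ^ 2))) = 2 * x ^ 2 / (x ^ 2 + y ^ 2) := by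
    field_simp
    ring
  simp only [hval]
  by_cases hx : y < ‖x‖
  · rw [indicator_of_mem (by exact hx), Pi.one_apply, le_div_iff₀ hpos]
    have : y ^ 2 < x ^ 2 := by
      rw [← sq_abs x]
      exact pow_lt_pow_left₀ hx hy.le two_ne_zero
    linarith
  · rw [indicator_of_notMem (by exact hx)]
    positivity

lemma tendsto_mul_cauchyTransform_im (m : Measure ℝ) [IsProbabilityMeasure m] :
    Tendsto (fun y : ℝ => y * (cauchyTransform m ((y : ℂ) * I)).im) atTop (𝓝 (-1)) := by
  have hlim : Tendsto (fun y : ℝ => ∫ x, y * (y / (x ^ 2 + y ^ 2)) ∂m) atTop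
      (𝓝 (∫ _, (1 : ℝ) ∂m)) := by
    refine tendsto_integral_filter_of_dominated_convergence (fun _ => 1)
      (Eventually.of_forall fun y => by
        apply Measurable.aestronglyMeasurable
        fun_prop) ?_ (integrable_const _) ?_
    · filter_upwards [eventually_gt_atTop 0] with y hy
      refine Eventually.of_forall fun x => ?_
      rw [Real.norm_of_nonneg (by positivity), ← mul_div_assoc,
        div_le_one (by positivity)]
      nlinarith [sq_nonneg x]
    · refine Eventually.of_forall fun x => ?_
      have h₁ : Tendsto (fun y : ℝ => 1 - x ^ 2 / (x ^ 2 + y ^ 2)) atTop (𝓝 (1 - 0)) := by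
        refine tendsto_const_nhds.sub (tendsto_const_nhds.div_atTop ?_)
        exact tendsto_atTop_add_const_left _ _ (tendsto_pow_atTop two_ne_zero)
      rw [sub_zero] at h₁
      refine h₁.congr' ?_
      filter_upwards [eventually_gt_atTop 0] with y hy
      field_simp
      ring
  have h := hlim.neg
  simp only [integral_const, probReal_univ, one_smul] at h
  refine h.congr' ?_
  filter_upwards [eventually_gt_atTop 0] with y hy
  rw [cauchyTransform_im m hy.ne', integral_const_mul]
  ring

lemma isTightMeasureSet_of_tendsto_cauchyTransform {μ : ℕ → Measure ℝ} {μ₀ : Measure ℝ}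
    [∀ n, IsProbabilityMeasure (μ n)] [IsProbabilityMeasure μ₀] {y₀ : ℝ}
    (h : ∀ y : ℝ, y₀ ≤ y → 0 < y → Tendsto (fun n => cauchyTransform (μ n) ((y : ℂ) * I)) atTop
      (𝓝 (cauchyTransform μ₀ ((y : ℂ) * I)))) :
    IsTightMeasureSet (range μ) := by
  refine isTightMeasureSet_range_of_tendsto_limsup_measure_norm_gt ?_
  have hlim : Tendsto (fun y : ℝ =>
      ENNReal.ofReal (2 * (1 + y * (cauchyTransform μ₀ ((y : ℂ) * I)).im))) atTop (𝓝 0) := by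
    have := ENNReal.tendsto_ofReal (((tendsto_mul_cauchyTransform_im μ₀).const_add 1).const_mul 2)
    simpa using this
  refine tendsto_of_tendsto_of_tendsto_of_le_of_le' tendsto_const_nhds hlim
    (Eventually.of_forall fun _ => zero_le) ?_
  filter_upwards [eventually_gt_atTop 0, eventually_ge_atTop y₀] with y hy hy₀
  have hconv : Tendsto (fun n =>
      ENNReal.ofReal (2 * (1 + y * (cauchyTransform (μ n) ((y : ℂ) * I)).im))) atTop
      (𝓝 (ENNReal.ofReal (2 * (1 + y * (cauchyTransform μ₀ ((y : ℂ) * I)).im)))) :=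
    ENNReal.tendsto_ofReal (((((continuous_im.tendsto _).comp (h y hy₀ hy)).const_mul y).const_add
      1).const_mul 2)
  rw [← hconv.limsup_eq]
  exact limsup_le_limsup (Eventually.of_forall fun n => measure_abs_gt_le (μ n) hy)

/-- Convergence of Cauchy transforms along the imaginary axis, near infinity, to the Cauchy
transform of a probability measure implies weak convergence. -/
lemma tendsto_integral_of_tendsto_cauchyTransform_s9 {μ : ℕ → Measure ℝ} {μ₀ : Measure ℝ}
    [hμ : ∀ n, IsProbabilityMeasure (μ n)] [hμ₀ : IsProbabilityMeasure μ₀] {y₀ : ℝ}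
    (h : ∀ y : ℝ, y₀ ≤ y → 0 < y → Tendsto (fun n => cauchyTransform (μ n) ((y : ℂ) * I)) atTop
      (𝓝 (cauchyTransform μ₀ ((y : ℂ) * I))))
    (f : ℝ →ᵇ ℝ) :
    Tendsto (fun n => ∫ x, f x ∂(μ n)) atTop (𝓝 (∫ x, f x ∂μ₀)) := by
  let P (n : ℕ) : ProbabilityMeasure ℝ := ⟨μ n, hμ n⟩
  let P₀ : ProbabilityMeasure ℝ := ⟨μ₀, hμ₀⟩
  have hweak : Tendsto P atTop (𝓝 P₀) :=
    ProbabilityMeasure.tendsto_of_tight_of_separatesPoints ℂ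
      (isTightMeasureSet_of_tendsto_cauchyTransform h) (separatesPoints_resolventAlgebra y₀)
      fun g hg => tendsto_integral_of_mem_resolventAlgebra h hg
  exact ProbabilityMeasure.tendsto_iff_forall_integral_tendsto.1 hweak f

/-- Second-order expansion of `z G(z)` at infinity for a centred, normalized measure with bounded
support. -/
lemma norm_mul_cauchyTransform_sub_le {ν : Measure ℝ} [IsProbabilityMeasure ν] {R : ℝ}
    (hR : 0 < R) (hbd : ∀ᵐ x ∂ν, |x| ≤ R) (hmean : ∫ x, x ∂ν = 0) (hsecond : ∫ x, x ^ 2 ∂ν = 1)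
    {z : ℂ} (hz : 2 * R ≤ ‖z‖) :
    ‖z * cauchyTransform ν z - 1 - z⁻¹ ^ 2‖ ≤ 2 * R ^ 3 * ‖z⁻¹‖ ^ 3 := by
  have hzpos : 0 < ‖z‖ := by linarith
  have hz0 : z ≠ 0 := norm_pos_iff.1 hzpos
  have hdist {x : ℝ} (hx : |x| ≤ R) : ‖z‖ / 2 ≤ ‖z - x‖ := by
    have h₁ := norm_sub_norm_le z (x : ℂ)
    rw [norm_real, Real.norm_eq_abs] at h₁
    linarith
  have hi₀ : Integrable (fun x : ℝ => (z - (x : ℂ))⁻¹) ν := by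
    refine Integrable.of_bound (Measurable.aestronglyMeasurable (by fun_prop)) (‖z‖ / 2)⁻¹ ?_
    filter_upwards [hbd] with x hx
    rw [norm_inv]
    exact inv_anti₀ (by positivity) (hdist hx)
  have hi₁ : Integrable (fun x : ℝ => (x : ℂ)) ν := by
    refine Integrable.of_bound (Measurable.aestronglyMeasurable (by fun_prop)) R ?_
    filter_upwards [hbd] with x hx
    simpa using hx
  have hi₂ : Integrable (fun x : ℝ => (x : ℂ) ^ 2) ν := by
    refine Integrable.of_bound (Measurable.aestronglyMeasurable (by fun_prop)) (R ^ 2) ?_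
    filter_upwards [hbd] with x hx
    rw [norm_pow, norm_real, Real.norm_eq_abs]
    gcongr
  have hm₁ : ∫ x, (x : ℂ) ∂ν = 0 := by rw [integral_complex_ofReal, hmean, ofReal_zero]
  have hm₂ : ∫ x, (x : ℂ) ^ 2 ∂ν = 1 := by
    simp_rw [← ofReal_pow]
    rw [integral_complex_ofReal, hsecond, ofReal_one]
  have heq : z * cauchyTransform ν z - 1 - z⁻¹ ^ 2
      = ∫ x, (z * (z - (x : ℂ))⁻¹ - 1 - z⁻¹ * x - z⁻¹ ^ 2 * (x : ℂ) ^ 2) ∂ν := by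
    have h₁ : Integrable (fun x : ℝ => z * (z - (x : ℂ))⁻¹ - 1) ν :=
      (hi₀.const_mul z).sub (integrable_const 1)
    have h₂ : Integrable (fun x : ℝ => z * (z - (x : ℂ))⁻¹ - 1 - z⁻¹ * x) ν :=
      h₁.sub (hi₁.const_mul _)
    rw [integral_sub h₂ (hi₂.const_mul _), integral_sub h₁ (hi₁.const_mul _),
      integral_sub (hi₀.const_mul z) (integrable_const 1), integral_const_mul, integral_const_mul,
      integral_const_mul, hm₁, hm₂, cauchyTransform]
    simp
  have hbound : ∀ᵐ x : ℝ ∂ν, ‖z * (z - (x : ℂ))⁻¹ - 1 - z⁻¹ * x - z⁻¹ ^ 2 * (x : ℂ) ^ 2‖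
      ≤ 2 * R ^ 3 * ‖z⁻¹‖ ^ 3 := by
    filter_upwards [hbd] with x hx
    have hd := hdist hx
    have hne : z - (x : ℂ) ≠ 0 := norm_pos_iff.1 (by linarith)
    have hrem : z * (z - (x : ℂ))⁻¹ - 1 - z⁻¹ * x - z⁻¹ ^ 2 * (x : ℂ) ^ 2
        = (x : ℂ) ^ 3 * z⁻¹ ^ 2 * (z - (x : ℂ))⁻¹ := by
      field_simp
      ring
    rw [hrem, norm_mul, norm_mul, norm_pow, norm_pow, norm_real, Real.norm_eq_abs, norm_inv,
      norm_inv]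
    calc |x| ^ 3 * ‖z‖⁻¹ ^ 2 * ‖z - (x : ℂ)‖⁻¹ ≤ R ^ 3 * ‖z‖⁻¹ ^ 2 * (‖z‖ / 2)⁻¹ := by
          gcongr
      _ = 2 * R ^ 3 * ‖z‖⁻¹ ^ 3 := by
          field_simp
  rw [heq]
  simpa using norm_integral_le_of_norm_le_const hbound

lemma norm_inv_sq_sub_le {q u : ℂ} {A : ℝ} (hA : 0 ≤ A) (hu : ‖u‖ ≤ 1)
    (hAu : (1 + A) * ‖u‖ ^ 2 ≤ 1 / 2) (hq : ‖q - 1 - u ^ 2‖ ≤ A * ‖u‖ ^ 3) :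
    ‖q⁻¹ ^ 2 - 1 + 2 * u ^ 2‖ ≤ 4 * (2 * A + 4 * (1 + A) + 3 * (1 + A) ^ 2) * ‖u‖ ^ 3 := by
  set t := ‖u‖ with ht
  have ht0 : 0 ≤ t := norm_nonneg u
  have h32 : t ^ 3 ≤ t ^ 2 := pow_le_pow_of_le_one ht0 hu (by norm_num)
  have h43 : t ^ 4 ≤ t ^ 3 := pow_le_pow_of_le_one ht0 hu (by norm_num)
  have h63 : t ^ 6 ≤ t ^ 3 := pow_le_pow_of_le_one ht0 hu (by norm_num)
  have hp : ‖q - 1‖ ≤ (1 + A) * t ^ 2 := by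
    calc ‖q - 1‖ = ‖(q - 1 - u ^ 2) + u ^ 2‖ := by ring_nf
      _ ≤ A * t ^ 3 + t ^ 2 := (norm_add_le _ _).trans (by rw [norm_pow]; gcongr)
      _ ≤ (1 + A) * t ^ 2 := by nlinarith
  have hqn : 1 / 2 ≤ ‖q‖ := by
    have h₁ := norm_sub_norm_le 1 (1 - q)
    rw [norm_one, sub_sub_cancel, norm_sub_rev] at h₁
    linarith
  have hq0 : q ≠ 0 := norm_pos_iff.1 (by linarith)
  have heq : q⁻¹ ^ 2 - 1 + 2 * u ^ 2
      = q⁻¹ ^ 2 * (-(2 * (q - 1 - u ^ 2)) + 4 * (q - 1) * u ^ 2 - (q - 1) ^ 2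
        + 2 * (q - 1) ^ 2 * u ^ 2) := by
    field_simp
    ring
  have hinv : ‖q⁻¹ ^ 2‖ ≤ 4 := by
    rw [norm_pow, norm_inv]
    have : ‖q‖⁻¹ ≤ 2 := by
      rw [inv_le_comm₀ (by linarith) (by norm_num)]
      linarith
    nlinarith [inv_nonneg.2 (norm_nonneg q)]
  have h₁ : ‖-(2 * (q - 1 - u ^ 2))‖ ≤ 2 * A * t ^ 3 := by
    rw [norm_neg, norm_mul, Complex.norm_ofNat]
    linarith
  have h₂ : ‖4 * (q - 1) * u ^ 2‖ ≤ 4 * (1 + A) * t ^ 3 := by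
    rw [norm_mul, norm_mul, norm_pow, Complex.norm_ofNat]
    calc 4 * ‖q - 1‖ * t ^ 2 ≤ 4 * ((1 + A) * t ^ 2) * t ^ 2 := by gcongr
      _ = 4 * (1 + A) * t ^ 4 := by ring
      _ ≤ 4 * (1 + A) * t ^ 3 := by gcongr
  have h₃ : ‖(q - 1) ^ 2‖ ≤ (1 + A) ^ 2 * t ^ 3 := by
    rw [norm_pow]
    calc ‖q - 1‖ ^ 2 ≤ ((1 + A) * t ^ 2) ^ 2 := by gcongr
      _ = (1 + A) ^ 2 * t ^ 4 := by ring
      _ ≤ (1 + A) ^ 2 * t ^ 3 := by gcongr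
  have h₄ : ‖2 * (q - 1) ^ 2 * u ^ 2‖ ≤ 2 * (1 + A) ^ 2 * t ^ 3 := by
    rw [norm_mul, norm_mul, norm_pow, norm_pow, Complex.norm_ofNat]
    calc 2 * ‖q - 1‖ ^ 2 * t ^ 2 ≤ 2 * ((1 + A) * t ^ 2) ^ 2 * t ^ 2 := by gcongr
      _ = 2 * (1 + A) ^ 2 * t ^ 6 := by ring
      _ ≤ 2 * (1 + A) ^ 2 * t ^ 3 := by gcongr
  rw [heq, norm_mul]
  have hsum := (norm_add_le (-(2 * (q - 1 - u ^ 2)) + 4 * (q - 1) * u ^ 2 - (q - 1) ^ 2)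
    (2 * (q - 1) ^ 2 * u ^ 2)).trans (add_le_add_left ((norm_sub_le _ _).trans
      (add_le_add_left (norm_add_le _ _) _)) _)
  calc _ ≤ 4 * ((2 * A + 4 * (1 + A) + 3 * (1 + A) ^ 2) * t ^ 3) := by
        refine mul_le_mul hinv ?_ (norm_nonneg _) (by norm_num)
        linarith
    _ = _ := by ring

/-- `F(z)² = z² - 2 + O(1/|z|)` for a centred, normalized measure with bounded support. -/
lemma exists_norm_Ftransform_sq_sub_le {ν : Measure ℝ} [IsProbabilityMeasure ν] {R : ℝ}
    (hR : 0 < R) (hbd : ∀ᵐ x ∂ν, |x| ≤ R) (hmean : ∫ x, x ∂ν = 0)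
    (hsecond : ∫ x, x ^ 2 ∂ν = 1) :
    ∃ C r : ℝ, 0 < C ∧ 0 < r ∧
      ∀ z : ℂ, r ≤ ‖z‖ → ‖Ftransform ν z ^ 2 - z ^ 2 + 2‖ ≤ C / ‖z‖ := by
  set A := 2 * R ^ 3 with hA
  have hA0 : 0 < A := by positivity
  refine ⟨4 * (2 * A + 4 * (1 + A) + 3 * (1 + A) ^ 2), 2 * R + 2 * (1 + A), by positivity,
    by positivity, fun z hz => ?_⟩
  have hzpos : 0 < ‖z‖ := by linarith
  have hz0 : z ≠ 0 := norm_pos_iff.1 hzpos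
  have hAz : ‖z⁻¹‖ * (2 * (1 + A)) ≤ 1 := by
    rw [norm_inv, inv_mul_le_one₀ hzpos]
    linarith
  have hu : ‖z⁻¹‖ ≤ 1 := by nlinarith [norm_nonneg z⁻¹]
  have key := norm_inv_sq_sub_le hA0.le hu (by nlinarith [norm_nonneg z⁻¹])
    (norm_mul_cauchyTransform_sub_le hR hbd hmean hsecond (z := z) (by linarith))
  have heq : Ftransform ν z ^ 2 - z ^ 2 + 2
      = z ^ 2 * ((z * cauchyTransform ν z)⁻¹ ^ 2 - 1 + 2 * z⁻¹ ^ 2) := by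
    rw [Ftransform, mul_inv]
    field_simp
  rw [heq, norm_mul, norm_pow]
  calc _ ≤ ‖z‖ ^ 2 * (4 * (2 * A + 4 * (1 + A) + 3 * (1 + A) ^ 2) * ‖z⁻¹‖ ^ 3) := by gcongr
    _ = _ := by
      rw [norm_inv]
      field_simp

/-- If `f` decreases squares by `2 / n` up to an error `δ`, then its iterates decrease squares
by `2 k / n` up to an error `k δ`. -/
lemma norm_iterate_sq_sub_le {f : ℂ → ℂ} {n : ℕ} {δ : ℝ} (hn : 0 < n) (hδ : n * δ ≤ 1)
    (hf : ∀ w : ℂ, 1 ≤ ‖w‖ → ‖f w ^ 2 - w ^ 2 + 2 / n‖ ≤ δ) {z : ℂ} (hz : 2 ≤ ‖z‖)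
    {k : ℕ} (hk : k ≤ n) : ‖f^[k] z ^ 2 - z ^ 2 + 2 * k / n‖ ≤ k * δ := by
  have hδ0 : 0 ≤ δ := (norm_nonneg _).trans (hf z (by linarith))
  have hn' : (0 : ℝ) < n := by exact_mod_cast hn
  induction k with
  | zero => simp
  | succ k ih =>
    have ih := ih (by omega)
    have hkn : (k : ℝ) ≤ n := by exact_mod_cast (by omega : k ≤ n)
    have hone : 1 ≤ ‖f^[k] z‖ := by
      have h₁ : ‖z‖ ^ 2 ≤ ‖f^[k] z‖ ^ 2 + 2 + 1 := by
        have hdec : z ^ 2 = f^[k] z ^ 2 + 2 * k / n - (f^[k] z ^ 2 - z ^ 2 + 2 * k / n) := by ring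
        have hfrac : ‖(2 * k / n : ℂ)‖ ≤ 2 := by
          rw [norm_div, norm_mul, Complex.norm_ofNat, norm_natCast, norm_natCast,
            div_le_iff₀ hn']
          linarith
        rw [← norm_pow, hdec]
        refine (norm_sub_le _ _).trans (add_le_add ((norm_add_le _ _).trans ?_) ?_)
        · rw [norm_pow]
          linarith
        · exact ih.trans ((mul_le_mul_of_nonneg_right hkn hδ0).trans hδ)
      nlinarith [norm_nonneg (f^[k] z)]
    have hstep := hf _ hone
    rw [Function.iterate_succ_apply']
    have heq : f (f^[k] z) ^ 2 - z ^ 2 + 2 * ((k + 1 : ℕ) : ℂ) / n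
        = (f (f^[k] z) ^ 2 - f^[k] z ^ 2 + 2 / n) + (f^[k] z ^ 2 - z ^ 2 + 2 * k / n) := by
      push_cast
      ring
    rw [heq]
    refine (norm_add_le _ _).trans ?_
    push_cast
    linarith

/-- The squares of the `n`-fold iterates of `w ↦ n^{-1/2} F(n^{1/2} w)` converge to `z² - 2`. -/
lemma tendsto_iterate_sq {F : ℂ → ℂ} {C r : ℝ} (hC : 0 < C)
    (hF : ∀ z : ℂ, r ≤ ‖z‖ → ‖F z ^ 2 - z ^ 2 + 2‖ ≤ C / ‖z‖) {z : ℂ} (hz : 2 ≤ ‖z‖) :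
    Tendsto (fun n : ℕ => (fun w : ℂ => (((Real.sqrt n : ℝ) : ℂ))⁻¹
      * F (((Real.sqrt n : ℝ) : ℂ) * w))^[n] z ^ 2) atTop (𝓝 (z ^ 2 - 2)) := by
  have hsqrt : Tendsto (fun n : ℕ => Real.sqrt n) atTop atTop :=
    Real.tendsto_sqrt_atTop.comp tendsto_natCast_atTop_atTop
  rw [tendsto_iff_norm_sub_tendsto_zero]
  refine squeeze_zero' (Eventually.of_forall fun _ => norm_nonneg _) ?_
    (tendsto_const_nhds.div_atTop hsqrt : Tendsto (fun n : ℕ => C / Real.sqrt n) atTop (𝓝 0))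
  filter_upwards [eventually_gt_atTop 0, hsqrt.eventually_ge_atTop r,
    hsqrt.eventually_ge_atTop C] with n hn hr hCn
  have hn' : (0 : ℝ) < n := by exact_mod_cast hn
  set s := Real.sqrt n with hs
  have hspos : 0 < s := Real.sqrt_pos.2 hn'
  have hs2 : s ^ 2 = n := Real.sq_sqrt hn'.le
  have hs2' : (s : ℂ) ^ 2 = n := by exact_mod_cast congrArg ((↑) : ℝ → ℂ) hs2
  have hs0 : (s : ℂ) ≠ 0 := by exact_mod_cast hspos.ne'
  have hnδ : n * (C / (n * s)) = C / s := by field_simp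
  have h := norm_iterate_sq_sub_le (f := fun w : ℂ => (s : ℂ)⁻¹ * F ((s : ℂ) * w)) (n := n)
    (δ := C / (n * s)) hn (by rw [hnδ, div_le_one hspos]; exact hCn) ?_ hz le_rfl
  · rw [hnδ] at h
    rw [mul_div_cancel_right₀ _ (by exact_mod_cast hn.ne' : (n : ℂ) ≠ 0)] at h
    rwa [← sub_add]
  · intro w hw
    have hnorm : ‖(s : ℂ) * w‖ = s * ‖w‖ := by rw [norm_mul, norm_real, Real.norm_of_nonneg hspos.le]
    have hsw : s ≤ s * ‖w‖ := le_mul_of_one_le_right hspos.le hw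
    have hFw := hF ((s : ℂ) * w) (by rw [hnorm]; linarith)
    rw [hnorm] at hFw
    have heq : ((s : ℂ)⁻¹ * F ((s : ℂ) * w)) ^ 2 - w ^ 2 + 2 / n
        = (n : ℂ)⁻¹ * (F ((s : ℂ) * w) ^ 2 - ((s : ℂ) * w) ^ 2 + 2) := by
      rw [← hs2']
      field_simp
    rw [heq, norm_mul, norm_inv, Complex.norm_natCast]
    calc (n : ℝ)⁻¹ * _ ≤ (n : ℝ)⁻¹ * (C / s) := by
          gcongr
          exact hFw.trans (by gcongr)
      _ = C / (n * s) := by field_simp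

/-- Points of the closed upper half-plane whose squares tend to `-s²` tend to `i s`. -/
lemma tendsto_of_tendsto_sq {w : ℕ → ℂ} {s : ℝ} (hs : 0 < s) (him : ∀ᶠ n in atTop, 0 ≤ (w n).im)
    (hsq : Tendsto (fun n => w n ^ 2) atTop (𝓝 (((s : ℂ) * I) ^ 2))) :
    Tendsto w atTop (𝓝 ((s : ℂ) * I)) := by
  rw [tendsto_iff_norm_sub_tendsto_zero] at hsq ⊢
  have hdiv := hsq.div_const s
  rw [zero_div] at hdiv
  refine squeeze_zero' (Eventually.of_forall fun _ => norm_nonneg _) ?_ hdiv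
  filter_upwards [him] with n hn
  have hsum : s ≤ ‖w n + (s : ℂ) * I‖ := by
    have h₁ := Complex.im_le_norm (w n + (s : ℂ) * I)
    simp only [add_im, mul_im, ofReal_re, I_im, mul_one, ofReal_im, I_re, mul_zero,
      add_zero] at h₁
    linarith
  rw [le_div_iff₀ hs, sq_sub_sq, norm_mul, mul_comm]
  gcongr

lemma Ftransform_im_nonneg (m : Measure ℝ) [IsFiniteMeasure m] {y : ℝ} (hy : 0 < y) :
    0 ≤ (Ftransform m ((y : ℂ) * I)).im := by
  rw [Ftransform, inv_im, cauchyTransform_im m hy.ne', neg_neg]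
  exact div_nonneg (integral_nonneg fun x => by positivity) (normSq_nonneg _)

lemma neg_sqrt_two_lt_sqrt_two : -√2 < √2 := by
  have : 0 < √2 := by positivity
  linarith

lemma two_sub_sq_pos {x : ℝ} (hx : x ∈ Ioo (-√2) √2) : 0 < 2 - x ^ 2 := by
  have h := sq_lt_sq' hx.1 hx.2
  rw [Real.sq_sqrt (by norm_num)] at h
  linarith

lemma intervalIntegrable_and_integral_arcsineDensity :
    IntervalIntegrable (fun x : ℝ => 1 / (Real.pi * √(2 - x ^ 2))) volume (-√2) √2 ∧
      ∫ x in (-√2)..√2, 1 / (Real.pi * √(2 - x ^ 2)) = 1 := by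
  have h2 : 0 < √2 := by positivity
  have hle := neg_sqrt_two_lt_sqrt_two.le
  have hcont : Continuous fun x : ℝ => Real.pi⁻¹ * Real.arcsin (x / √2) := by fun_prop
  have hderiv : ∀ x ∈ Ioo (-√2) √2,
      HasDerivAt (fun x : ℝ => Real.pi⁻¹ * Real.arcsin (x / √2))
        (1 / (Real.pi * √(2 - x ^ 2))) x := by
    intro x hx
    have hlt : x / √2 < 1 := (div_lt_one h2).2 hx.2
    have hgt : -1 < x / √2 := by rw [lt_div_iff₀ h2]; linarith [hx.1]
    have h := ((Real.hasDerivAt_arcsin hgt.ne' hlt.ne).comp x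
      ((hasDerivAt_id x).div_const √2)).const_mul Real.pi⁻¹
    refine h.congr_deriv ?_
    have hpos := two_sub_sq_pos hx
    have hval : 1 - (x / √2) ^ 2 = (2 - x ^ 2) / 2 := by
      rw [div_pow, Real.sq_sqrt (by norm_num)]
      ring
    rw [hval, Real.sqrt_div hpos.le]
    field_simp
  have hint : IntervalIntegrable (fun x : ℝ => 1 / (Real.pi * √(2 - x ^ 2))) volume (-√2) √2 := by
    rw [intervalIntegrable_iff_integrableOn_Ioc_of_le hle]
    exact intervalIntegral.integrableOn_deriv_of_nonneg hcont.continuousOn hderiv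
      fun x _ => by positivity
  refine ⟨hint, ?_⟩
  rw [intervalIntegral.integral_eq_sub_of_hasDerivAt_of_le hle hcont.continuousOn hderiv hint,
    neg_div, div_self h2.ne', Real.arcsin_neg, Real.arcsin_one]
  field_simp
  norm_num

lemma arcsineDistribution_eq : arcsineDistribution
    = (volume.restrict (Ioo (-√2) √2)).withDensity
      fun x => ENNReal.ofReal (1 / (Real.pi * √(2 - x ^ 2))) :=
  withDensity_indicator measurableSet_Ioo _

lemma isProbabilityMeasure_arcsineDistribution : IsProbabilityMeasure arcsineDistribution := by
  obtain ⟨hint, hval⟩ := intervalIntegrable_and_integral_arcsineDensity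
  have hle := neg_sqrt_two_lt_sqrt_two.le
  rw [intervalIntegrable_iff_integrableOn_Ioo_of_le hle] at hint
  rw [intervalIntegral.integral_of_le hle, integral_Ioc_eq_integral_Ioo] at hval
  refine ⟨?_⟩
  rw [arcsineDistribution_eq, withDensity_apply _ MeasurableSet.univ, Measure.restrict_univ,
    ← ofReal_integral_eq_lintegral_ofReal hint (Eventually.of_forall fun x => by positivity), hval,
    ENNReal.ofReal_one]

lemma integral_arcsineDistribution (g : ℝ → ℝ) :
    ∫ x, g x ∂arcsineDistribution = ∫ x in (-√2)..√2, 1 / (Real.pi * √(2 - x ^ 2)) * g x := by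
  rw [arcsineDistribution_eq, intervalIntegral.integral_of_le neg_sqrt_two_lt_sqrt_two.le,
    integral_Ioc_eq_integral_Ioo, integral_withDensity_eq_integral_toReal_smul (by fun_prop)
      (Eventually.of_forall fun x => ENNReal.ofReal_lt_top)]
  refine integral_congr_ae (Eventually.of_forall fun x => ?_)
  simp only [smul_eq_mul]
  rw [ENNReal.toReal_ofReal (by positivity)]

lemma hasDerivAt_arctan_arcsine {x y : ℝ} (hy : 0 < y) (hx : x ∈ Ioo (-√2) √2) :
    HasDerivAt (fun x : ℝ => (Real.pi * √(y ^ 2 + 2))⁻¹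
        * Real.arctan (√(y ^ 2 + 2) / y * (x * (√(2 - x ^ 2))⁻¹)))
      (1 / (Real.pi * √(2 - x ^ 2)) * (y / (x ^ 2 + y ^ 2))) x := by
  have hpos := two_sub_sq_pos hx
  have hr : 0 < √(2 - x ^ 2) := Real.sqrt_pos.2 hpos
  have hr2 : √(2 - x ^ 2) ^ 2 = 2 - x ^ 2 := Real.sq_sqrt hpos.le
  have hs : 0 < √(y ^ 2 + 2) := Real.sqrt_pos.2 (by positivity)
  have hs2 : √(y ^ 2 + 2) ^ 2 = y ^ 2 + 2 := Real.sq_sqrt (by positivity)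
  have hsqrt : HasDerivAt (fun x : ℝ => √(2 - x ^ 2)) (-x / √(2 - x ^ 2)) x := by
    have h := ((hasDerivAt_pow 2 x).const_sub 2).sqrt hpos.ne'
    refine h.congr_deriv ?_
    field_simp
    norm_num
  have h := ((((hasDerivAt_id x).mul (hsqrt.inv hr.ne')).const_mul (√(y ^ 2 + 2) / y)).arctan
    ).const_mul (Real.pi * √(y ^ 2 + 2))⁻¹
  refine h.congr_deriv ?_
  simp only [id, Pi.inv_apply, Pi.mul_apply]
  set r := √(2 - x ^ 2)
  set s := √(y ^ 2 + 2)
  have hx2 : x ^ 2 = 2 - r ^ 2 := by linarith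
  have hnum : 1 * r⁻¹ + x * (-(-x / r) / r ^ 2) = 2 / r ^ 3 := by
    field_simp
    linarith
  have hden : 1 + (s / y * (x * r⁻¹)) ^ 2 = 2 * (x ^ 2 + y ^ 2) / (y ^ 2 * r ^ 2) := by
    have : (s / y * (x * r⁻¹)) ^ 2 = s ^ 2 * x ^ 2 / (y ^ 2 * r ^ 2) := by field_simp
    rw [this, hs2, hr2]
    have := hpos.ne'
    field_simp
    ring
  rw [hnum, hden]
  have hxy : 0 < x ^ 2 + y ^ 2 := by positivity
  field_simp

/-- The Poisson integral of the arcsine distribution on the imaginary axis. -/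
lemma integral_arcsineDistribution_div_sq_add_sq {y : ℝ} (hy : 0 < y) :
    ∫ x, y / (x ^ 2 + y ^ 2) ∂arcsineDistribution = (√(y ^ 2 + 2))⁻¹ := by
  have hlt := neg_sqrt_two_lt_sqrt_two
  have hs : 0 < √(y ^ 2 + 2) := Real.sqrt_pos.2 (by positivity)
  have hint : IntervalIntegrable
      (fun x : ℝ => 1 / (Real.pi * √(2 - x ^ 2)) * (y / (x ^ 2 + y ^ 2))) volume (-√2) √2 := by
    refine intervalIntegrable_and_integral_arcsineDensity.1.mul_continuousOn
      (Continuous.continuousOn ?_)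
    exact continuous_const.div (by fun_prop) fun x => by positivity
  have hzero (a : ℝ) (ha : a ^ 2 = 2) (l : Filter ℝ) (hl : l ≤ 𝓝 a)
      (hmem : Ioo (-√2) √2 ∈ l) : Tendsto (fun x : ℝ => (√(2 - x ^ 2))⁻¹) l atTop := by
    refine tendsto_inv_nhdsGT_zero.comp (tendsto_nhdsWithin_iff.2 ⟨?_, ?_⟩)
    · have hc : Continuous fun x : ℝ => √(2 - x ^ 2) := by fun_prop
      simpa [ha] using (hc.tendsto a).mono_left hl
    · filter_upwards [hmem] with x hx
      exact Real.sqrt_pos.2 (two_sub_sq_pos hx)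
  have hb : Tendsto (fun x : ℝ => (Real.pi * √(y ^ 2 + 2))⁻¹
        * Real.arctan (√(y ^ 2 + 2) / y * (x * (√(2 - x ^ 2))⁻¹))) (𝓝[<] √2)
      (𝓝 ((Real.pi * √(y ^ 2 + 2))⁻¹ * (Real.pi / 2))) := by
    refine Tendsto.const_mul _ ((Real.tendsto_arctan_atTop.mono_right nhdsWithin_le_nhds).comp ?_)
    refine Tendsto.const_mul_atTop (by positivity) (Tendsto.pos_mul_atTop (C := √2) (by positivity)
      (tendsto_id.mono_left nhdsWithin_le_nhds) ?_)
    exact hzero _ (by simp) _ nhdsWithin_le_nhds (Ioo_mem_nhdsLT hlt)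
  have ha : Tendsto (fun x : ℝ => (Real.pi * √(y ^ 2 + 2))⁻¹
        * Real.arctan (√(y ^ 2 + 2) / y * (x * (√(2 - x ^ 2))⁻¹))) (𝓝[>] (-√2))
      (𝓝 ((Real.pi * √(y ^ 2 + 2))⁻¹ * (-(Real.pi / 2)))) := by
    refine Tendsto.const_mul _ ((Real.tendsto_arctan_atBot.mono_right nhdsWithin_le_nhds).comp ?_)
    refine Tendsto.const_mul_atBot (by positivity) (Tendsto.neg_mul_atTop (C := -√2) (by simp)
      (tendsto_id.mono_left nhdsWithin_le_nhds) ?_)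
    exact hzero _ (by simp) _ nhdsWithin_le_nhds (Ioo_mem_nhdsGT hlt)
  rw [integral_arcsineDistribution, intervalIntegral.integral_eq_sub_of_hasDerivAt_of_tendsto hlt
    (fun x hx => hasDerivAt_arctan_arcsine hy hx) hint ha hb]
  field_simp
  norm_num

lemma integral_arcsineDistribution_of_odd {g : ℝ → ℝ} (hg : ∀ x, g (-x) = -g x) :
    ∫ x, g x ∂arcsineDistribution = 0 := by
  rw [integral_arcsineDistribution]
  have h := intervalIntegral.integral_comp_neg (a := -√2) (b := √2)
    fun x : ℝ => 1 / (Real.pi * √(2 - x ^ 2)) * g x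
  simp only [neg_sq, hg, mul_neg, neg_neg, intervalIntegral.integral_neg] at h
  linarith

lemma cauchyTransform_arcsineDistribution {y : ℝ} (hy : 0 < y) :
    cauchyTransform arcsineDistribution ((y : ℂ) * I) = (((√(y ^ 2 + 2) : ℝ) : ℂ) * I)⁻¹ := by
  have := isProbabilityMeasure_arcsineDistribution
  have hre := integral_re
    (integrable_inv_ofReal_mul_I_sub_ofReal arcsineDistribution hy.ne')
  rw [integral_arcsineDistribution_of_odd] at hre
  · apply Complex.ext
    · refine Eq.trans hre.symm ?_
      simp
    · rw [cauchyTransform_im _ hy.ne', integral_arcsineDistribution_div_sq_add_sq hy]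
      simp
  · intro x
    simp [Complex.normSq_apply, neg_div]

lemma exists_ae_abs_le {ν : Measure ℝ} (hsupp : ∃ K : Set ℝ, IsCompact K ∧ ν Kᶜ = 0) :
    ∃ R : ℝ, 0 < R ∧ ∀ᵐ x ∂ν, |x| ≤ R := by
  obtain ⟨K, hK, hν⟩ := hsupp
  obtain ⟨R, hRpos, hR⟩ := hK.isBounded.exists_pos_norm_le
  refine ⟨R, hRpos, ?_⟩
  filter_upwards [compl_mem_ae_iff.2 hν] with x hx
  exact hR x (by simpa using hx)

end

/-- Monotone central limit theorem (analytic form): if ν is a compactly supported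
probability measure with mean 0 and variance 1, `F_n(z) = n^{-1/2}·F_ν(n^{1/2}·z)` and
`F_{μ_n}` is the n-fold composition of `F_n`, then μ_n converges weakly to the arcsine
distribution A(0,1). -/
theorem monotone_central_limit_theorem
    (ν : Measure ℝ) [IsProbabilityMeasure ν]
    (hsupp : ∃ K : Set ℝ, IsCompact K ∧ ν Kᶜ = 0)
    (hmean : (∫ x, x ∂ν) = 0)
    (hvar : (∫ x, x ^ 2 ∂ν) - (∫ x, x ∂ν) ^ 2 = 1)
    (μ : ℕ → Measure ℝ) (hμ : ∀ n, IsProbabilityMeasure (μ n))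
    (hF : ∀ n : ℕ, 1 ≤ n → ∀ z : ℂ, 0 < z.im →
      Ftransform (μ n) z
        = (fun w : ℂ => (((Real.sqrt n : ℝ) : ℂ))⁻¹
            * Ftransform ν (((Real.sqrt n : ℝ) : ℂ) * w))^[n] z) :
    ∀ f : BoundedContinuousFunction ℝ ℝ,
      Tendsto (fun n => ∫ x, f x ∂(μ n)) atTop
        (nhds (∫ x, f x ∂arcsineDistribution)) := by
  have hprob := isProbabilityMeasure_arcsineDistribution
  obtain ⟨R, hR, hbd⟩ := exists_ae_abs_le hsupp
  obtain ⟨C, r, hC, -, hexp⟩ :=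
    exists_norm_Ftransform_sq_sub_le hR hbd hmean (by simpa [hmean] using hvar)
  refine tendsto_integral_of_tendsto_cauchyTransform_s9 (y₀ := 2) fun y hy hypos => ?_
  have hs : 0 < √(y ^ 2 + 2) := Real.sqrt_pos.2 (by positivity)
  have hs0 : ((√(y ^ 2 + 2) : ℝ) : ℂ) * Complex.I ≠ 0 :=
    mul_ne_zero (by exact_mod_cast hs.ne') Complex.I_ne_zero
  have hsq := tendsto_iterate_sq hC hexp (z := (y : ℂ) * Complex.I)
    (by simpa [abs_of_pos hypos] using hy)
  have hval : ((y : ℂ) * Complex.I) ^ 2 - 2 = (((√(y ^ 2 + 2) : ℝ) : ℂ) * Complex.I) ^ 2 := by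
    rw [mul_pow, mul_pow, Complex.I_sq, ← Complex.ofReal_pow √(y ^ 2 + 2),
      Real.sq_sqrt (by positivity)]
    push_cast
    ring
  rw [hval] at hsq
  have hlim := tendsto_of_tendsto_sq (w := fun n => Ftransform (μ n) ((y : ℂ) * Complex.I)) hs
    (Eventually.of_forall fun n => Ftransform_im_nonneg (μ n) hypos) (hsq.congr' (by
      filter_upwards [eventually_ge_atTop 1] with n hn
      rw [hF n hn _ (by simpa using hypos)]))
  rw [cauchyTransform_arcsineDistribution hypos]
  simpa [Ftransform] using hlim.inv₀ hs0
end

section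
/- Existence and uniqueness of the stationary distribution: every irreducible column-stochastic N×N matrix P has exactly one stationary distribution π (a vector π ∈ ℝ^N with nonnegative entries summing to 1 and Pπ = π), and moreover every entry of π is strictly positive. -/
open Filter Topology

section FixedVectors

variable {n : Type*} [Fintype n]

/-- The entrywise absolute value of a fixed vector of a column-stochastic matrix is fixed. -/
theorem mulVec_abs_eq_of_mulVec_eq {P : Matrix n n ℝ} (hnonneg : ∀ i j, 0 ≤ P i j)
    (hcol : ∀ j, ∑ i, P i j = 1) {v : n → ℝ} (hv : P.mulVec v = v) :
    P.mulVec |v| = |v| := by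
  have hle : ∀ i ∈ Finset.univ, |v| i ≤ P.mulVec |v| i := fun i _ => by
    calc |v| i = |∑ j, P i j * v j| := congrArg abs (congrFun hv i).symm
      _ ≤ ∑ j, |P i j * v j| := Finset.abs_sum_le_sum_abs _ _
      _ = P.mulVec |v| i := Finset.sum_congr rfl fun j _ => by
        rw [abs_mul, abs_of_nonneg (hnonneg i j), Pi.abs_apply]
  have hsum : ∑ i, |v| i = ∑ i, P.mulVec |v| i := by
    simp only [Matrix.mulVec, dotProduct]
    rw [Finset.sum_comm]
    simp only [← Finset.sum_mul, hcol, one_mul]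
  funext i
  exact ((Finset.sum_eq_sum_iff_of_le hle).1 hsum i (Finset.mem_univ i)).symm

variable [DecidableEq n]

theorem pow_mulVec_eq_of_mulVec_eq {P : Matrix n n ℝ} {v : n → ℝ} (hv : P.mulVec v = v)
    (m : ℕ) : (P ^ m).mulVec v = v := by
  induction m with
  | zero => simp
  | succ m ih => rw [pow_succ, ← Matrix.mulVec_mulVec, hv, ih]

theorem pow_apply_nonneg {P : Matrix n n ℝ} (hnonneg : ∀ i j, 0 ≤ P i j) (m : ℕ) (i j : n) :
    0 ≤ (P ^ m) i j := by
  induction m generalizing i j with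
  | zero =>
    rw [pow_zero, Matrix.one_apply]
    split_ifs <;> norm_num
  | succ m ih =>
    rw [pow_succ, Matrix.mul_apply]
    exact Finset.sum_nonneg fun k _ => mul_nonneg (ih i k) (hnonneg k j)

/-- A nonnegative fixed vector of an irreducible nonnegative matrix with one positive entry
has only positive entries. -/
theorem pos_of_mulVec_eq_of_irreducible {P : Matrix n n ℝ} (hnonneg : ∀ i j, 0 ≤ P i j)
    (hirr : ∀ j k, ∃ m : ℕ, 1 ≤ m ∧ 0 < (P ^ m) j k) {v : n → ℝ} (hv : P.mulVec v = v)
    (hv0 : ∀ i, 0 ≤ v i) {k : n} (hk : 0 < v k) (i : n) : 0 < v i := by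
  obtain ⟨m, -, hm⟩ := hirr i k
  rw [← congrFun (pow_mulVec_eq_of_mulVec_eq hv m) i]
  exact Finset.sum_pos' (fun j _ => mul_nonneg (pow_apply_nonneg hnonneg m i j) (hv0 j))
    ⟨k, Finset.mem_univ k, mul_pos hm hk⟩

/-- A fixed vector of an irreducible column-stochastic matrix whose entries sum to zero
vanishes. -/
theorem eq_zero_of_mulVec_eq_of_sum_eq_zero {P : Matrix n n ℝ} (hnonneg : ∀ i j, 0 ≤ P i j)
    (hcol : ∀ j, ∑ i, P i j = 1) (hirr : ∀ j k, ∃ m : ℕ, 1 ≤ m ∧ 0 < (P ^ m) j k)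
    {v : n → ℝ} (hv : P.mulVec v = v) (hsum : ∑ i, v i = 0) : v = 0 := by
  by_contra hne
  obtain ⟨i, hi⟩ := Function.ne_iff.1 hne
  obtain ⟨k, -, hk⟩ := Finset.exists_pos_of_sum_zero_of_exists_nonzero v hsum
    ⟨i, Finset.mem_univ i, hi⟩
  have hfix : P.mulVec (v + |v|) = v + |v| := by
    rw [Matrix.mulVec_add, hv, mulVec_abs_eq_of_mulVec_eq hnonneg hcol hv]
  have hpos : ∀ j, 0 < v j := fun j => by
    have hj : 0 < v j + |v j| := pos_of_mulVec_eq_of_irreducible hnonneg hirr hfix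
      (fun i => by
        change 0 ≤ v i + |v i|
        linarith [neg_abs_le (v i)])
      (show 0 < v k + |v k| by positivity) j
    by_contra hneg
    rw [abs_of_nonpos (not_lt.1 hneg)] at hj
    linarith
  exact (Finset.sum_pos (fun j _ => hpos j) ⟨k, Finset.mem_univ k⟩).ne' hsum

/-- A column-stochastic matrix on a nonempty index type has a stationary distribution. -/
theorem exists_stationary_distribution [Nonempty n] {P : Matrix n n ℝ}
    (hnonneg : ∀ i j, 0 ≤ P i j) (hcol : ∀ j, ∑ i, P i j = 1) :
    ∃ p : n → ℝ, (∀ i, 0 ≤ p i) ∧ ∑ i, p i = 1 ∧ P.mulVec p = p := by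
  have hdet : (P - 1).det = 0 := Matrix.exists_vecMul_eq_zero_iff.1
    ⟨1, one_ne_zero, by
      rw [Matrix.vecMul_sub, Matrix.vecMul_one, sub_eq_zero]
      funext j
      simp [Matrix.vecMul, dotProduct, hcol]⟩
  obtain ⟨v, hv0, hv⟩ := Matrix.exists_mulVec_eq_zero_iff.2 hdet
  rw [Matrix.sub_mulVec, Matrix.one_mulVec, sub_eq_zero] at hv
  obtain ⟨k, hk⟩ := Function.ne_iff.1 hv0
  have hpos : 0 < ∑ i, |v| i := Finset.sum_pos' (fun i _ => abs_nonneg (v i))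
    ⟨k, Finset.mem_univ k, abs_pos.2 hk⟩
  refine ⟨(∑ i, |v| i)⁻¹ • |v|, fun i => mul_nonneg (inv_nonneg.2 hpos.le) (abs_nonneg (v i)),
    ?_, ?_⟩
  · simp only [Pi.smul_apply, smul_eq_mul, ← Finset.mul_sum]
    exact inv_mul_cancel₀ hpos.ne'
  · rw [Matrix.mulVec_smul, mulVec_abs_eq_of_mulVec_eq hnonneg hcol hv]

end FixedVectors

/-- Existence and uniqueness of the stationary distribution of an irreducible
column-stochastic matrix, together with strict positivity of its entries. -/
theorem irreducible_unique_stationary_distribution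
    (N : ℕ) (hN : 1 ≤ N) (P : Matrix (Fin N) (Fin N) ℝ)
    (hnonneg : ∀ i j, 0 ≤ P i j)
    (hcol : ∀ j, ∑ i, P i j = 1)
    (hirr : ∀ j k, ∃ m : ℕ, 1 ≤ m ∧ 0 < (P ^ m) j k) :
    (∃! π : Fin N → ℝ,
      (∀ i, 0 ≤ π i) ∧ (∑ i, π i = 1) ∧ P.mulVec π = π) ∧
    (∀ π : Fin N → ℝ,
      (∀ i, 0 ≤ π i) → (∑ i, π i = 1) → P.mulVec π = π → ∀ i, 0 < π i) := by
  have : Nonempty (Fin N) := ⟨⟨0, hN⟩⟩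
  constructor
  · obtain ⟨p, hp0, hp1, hp⟩ := exists_stationary_distribution hnonneg hcol
    refine ⟨p, ⟨hp0, hp1, hp⟩, ?_⟩
    rintro q ⟨-, hq1, hq⟩
    refine sub_eq_zero.1 (eq_zero_of_mulVec_eq_of_sum_eq_zero hnonneg hcol hirr ?_ ?_)
    · rw [Matrix.mulVec_sub, hq, hp]
    · simp [Finset.sum_sub_distrib, hq1, hp1]
  · intro p hp0 hp1 hp
    obtain ⟨k, -, hk⟩ := Finset.exists_ne_zero_of_sum_ne_zero (hp1.trans_ne one_ne_zero)
    exact pos_of_mulVec_eq_of_irreducible hnonneg hirr hp hp0 ((hp0 k).lt_of_ne' hk)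
end

section
/- Convergence theorem for finite Markov chains: let P be an N×N column-stochastic matrix that is irreducible and aperiodic, and let π be its stationary distribution. Then for every vector v ∈ ℝ^N with nonnegative entries summing to 1, P^n v converges to π as n → ∞. -/
open Filter Topology

namespace Matrix

variable {n : Type*} [Fintype n]

lemma mul_apply_pos_of_nonneg {A B : Matrix n n ℝ} (hA : ∀ i j, 0 ≤ A i j)
    (hB : ∀ i j, 0 ≤ B i j) {i j k : n} (hij : 0 < A i j) (hjk : 0 < B j k) :
    0 < (A * B) i k := by
  rw [mul_apply]
  exact Finset.sum_pos' (fun l _ => mul_nonneg (hA i l) (hB l k))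
    ⟨j, Finset.mem_univ j, mul_pos hij hjk⟩

variable [DecidableEq n] {P : Matrix n n ℝ}

lemma eventually_pow_apply_self_pos (hP : P ∈ colStochastic ℝ n) {i : n}
    (haper : ∀ d : ℕ, (∀ m : ℕ, 1 ≤ m → 0 < (P ^ m) i i → d ∣ m) → d = 1) :
    ∀ᶠ m in atTop, 0 < (P ^ m) i i := by
  let s : Set ℕ := {m | 1 ≤ m ∧ 0 < (P ^ m) i i}
  have hgcd : Nat.setGcd s = 1 :=
    haper _ fun m hm hpos => Nat.setGcd_dvd_of_mem ⟨hm, hpos⟩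
  obtain ⟨b, hb⟩ := Nat.exists_mem_closure_of_ge s
  filter_upwards [eventually_ge_atTop b] with m hm
  refine AddSubmonoid.closure_induction (motive := fun m _ => 0 < (P ^ m) i i)
    (fun m hm => hm.2) (by simp) (fun a c _ _ ha hc => ?_)
    (hb m hm (hgcd ▸ one_dvd m))
  rw [pow_add]
  exact mul_apply_pos_of_nonneg (pow_mem hP a).1 (pow_mem hP c).1 ha hc

lemma eventually_pow_apply_pos (hP : P ∈ colStochastic ℝ n) {i j : n}
    (hirr : ∃ m : ℕ, 0 < (P ^ m) i j)
    (haper : ∀ d : ℕ, (∀ m : ℕ, 1 ≤ m → 0 < (P ^ m) i i → d ∣ m) → d = 1) :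
    ∀ᶠ m in atTop, 0 < (P ^ m) i j := by
  obtain ⟨k, hk⟩ := hirr
  rw [← map_add_atTop_eq_nat k, eventually_map]
  filter_upwards [eventually_pow_apply_self_pos hP haper] with m hm
  rw [pow_add]
  exact mul_apply_pos_of_nonneg (pow_mem hP m).1 (pow_mem hP k).1 hm hk

/-- Doeblin's contraction estimate: a column-stochastic matrix with a row bounded below by `ε`
contracts the `ℓ¹` norm by `1 - ε` on vectors with zero sum. -/
lemma sum_abs_mulVec_le_of_le_row (hP : P ∈ colStochastic ℝ n) {i : n} {ε : ℝ}
    (hε : ∀ j, ε ≤ P i j) {w : n → ℝ} (hw : ∑ j, w j = 0) :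
    ∑ k, |(P *ᵥ w) k| ≤ (1 - ε) * ∑ j, |w j| := by
  set c : n → ℝ := fun k => if k = i then ε else 0 with hc
  have hle : ∀ k j, c k ≤ P k j := fun k j => by
    by_cases h : k = i
    · simpa [hc, h] using hε j
    · simpa [hc, h] using hP.1 k j
  calc ∑ k, |(P *ᵥ w) k|
      = ∑ k, |∑ j, (P k j - c k) * w j| := by
        simp [mulVec, dotProduct, sub_mul, Finset.sum_sub_distrib, ← Finset.mul_sum, hw]
    _ ≤ ∑ k, ∑ j, (P k j - c k) * |w j| := by
        gcongr with k
        refine (Finset.abs_sum_le_sum_abs _ _).trans_eq (Finset.sum_congr rfl fun j _ => ?_)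
        rw [abs_mul, abs_of_nonneg (sub_nonneg.2 (hle k j))]
    _ = (1 - ε) * ∑ j, |w j| := by
        rw [Finset.sum_comm, Finset.mul_sum]
        refine Finset.sum_congr rfl fun j _ => ?_
        rw [← Finset.sum_mul, Finset.sum_sub_distrib, sum_col_of_mem_colStochastic hP]
        simp [hc]

lemma tendsto_pow_mulVec_zero (hP : P ∈ colStochastic ℝ n) {i : n} {m : ℕ}
    (hpos : ∀ j, 0 < (P ^ m) i j) {w : n → ℝ} (hw : ∑ j, w j = 0) :
    Tendsto (fun k : ℕ => (P ^ k) *ᵥ w) atTop (𝓝 0) := by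
  obtain ⟨j₀, hj₀⟩ := (haveI : Nonempty n := ⟨i⟩; Finite.exists_min ((P ^ m) i))
  set a : ℕ → ℝ := fun k => ∑ j, |((P ^ k) *ᵥ w) j| with ha
  have hsum : ∀ k, ∑ j, ((P ^ k) *ᵥ w) j = 0 := fun k => by
    rw [sum_mulVec_of_mem_colStochastic (pow_mem hP k), hw]
  have hanti : Antitone a := antitone_nat_of_succ_le fun k => by
    have := sum_abs_mulVec_le_of_le_row hP (i := i) (hP.1 i) (hsum k)
    simpa [ha, pow_succ', mulVec_mulVec] using this
  have hcontr : ∀ k, a (k + m) ≤ (1 - (P ^ m) i j₀) * a k := fun k => by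
    have := sum_abs_mulVec_le_of_le_row (pow_mem hP m) hj₀ (hsum k)
    simpa [ha, add_comm k, pow_add, mulVec_mulVec] using this
  have hnonneg : ∀ k, 0 ≤ a k := fun k => Finset.sum_nonneg fun j _ => abs_nonneg _
  have hlim := tendsto_atTop_ciInf hanti ⟨0, by rintro _ ⟨k, rfl⟩; exact hnonneg k⟩
  have hle := le_of_tendsto_of_tendsto' (hlim.comp (tendsto_add_atTop_nat m))
    (hlim.const_mul (1 - (P ^ m) i j₀)) hcontr
  have hzero : ⨅ k, a k = 0 :=
    le_antisymm (by nlinarith [hpos j₀]) (le_ciInf hnonneg)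
  rw [hzero] at hlim
  refine tendsto_pi_nhds.2 fun j => squeeze_zero_norm (fun k => ?_) hlim
  exact Finset.single_le_sum (f := fun j => |((P ^ k) *ᵥ w) j|)
    (fun j _ => abs_nonneg _) (Finset.mem_univ j)

end Matrix

/-- Convergence theorem for finite Markov chains: for an irreducible aperiodic
column-stochastic matrix P with stationary distribution π, `P^n v → π` for every
probability vector v. -/
theorem markov_chain_convergence
    (N : ℕ) (hN : 1 ≤ N) (P : Matrix (Fin N) (Fin N) ℝ)
    (hnonneg : ∀ i j, 0 ≤ P i j)
    (hcol : ∀ j, ∑ i, P i j = 1)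
    (hirr : ∀ j k, ∃ m : ℕ, 1 ≤ m ∧ 0 < (P ^ m) j k)
    (haper : ∀ j, ∀ d : ℕ, (∀ n : ℕ, 1 ≤ n → 0 < (P ^ n) j j → d ∣ n) → d = 1)
    (π : Fin N → ℝ)
    (hπ : (∀ i, 0 ≤ π i) ∧ (∑ i, π i = 1) ∧ P.mulVec π = π) :
    ∀ v : Fin N → ℝ, (∀ i, 0 ≤ v i) → (∑ i, v i = 1) →
      Tendsto (fun n : ℕ => (P ^ n).mulVec v) atTop (nhds π) := by
  intro v _ hv
  obtain ⟨-, hsum, hfix⟩ := hπ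
  have hP : P ∈ Matrix.colStochastic ℝ (Fin N) :=
    Matrix.mem_colStochastic_iff_sum.2 ⟨hnonneg, hcol⟩
  let i : Fin N := ⟨0, hN⟩
  obtain ⟨m, hm⟩ := (eventually_all.2 fun j => Matrix.eventually_pow_apply_pos hP
    ((hirr i j).imp fun _ h => h.2) (haper i)).exists
  have hpow : ∀ k : ℕ, (P ^ k).mulVec π = π := fun k => by
    induction k with
    | zero => simp
    | succ k ih => rw [pow_succ, ← Matrix.mulVec_mulVec, hfix, ih]
  have hlim := Matrix.tendsto_pow_mulVec_zero hP hm (w := v - π)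
    (by simp [Finset.sum_sub_distrib, hv, hsum])
  simpa [Matrix.mulVec_sub, hpow] using hlim.add_const π
end

section
/- Univalent F-transforms onto half-plane complements of bounded hulls: let Ω ⊆ ℍ be a simply connected domain such that ℍ ∖ Ω is a bounded set. Then there exists a unique compactly supported Borel probability measure μ on ℝ with mean 0 such that F_μ is injective on ℍ and F_μ(ℍ) = Ω. -/
open MeasureTheory Filter Topology Set

/-- The open upper half-plane as a set of complex numbers. -/
abbrev upperHalf : Set ℂ := {z : ℂ | 0 < z.im}

lemma isOpen_upperHalf : IsOpen upperHalf := isOpen_lt continuous_const Complex.continuous_im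

lemma abs_im_le_norm_sub_ofReal (z : ℂ) (x : ℝ) : |z.im| ≤ ‖z - x‖ := by
  simpa using Complex.abs_im_le_norm (z - x)

lemma ae_im_le_norm {μ : Measure ℝ} (z : ℂ) : ∀ᵐ x : ℝ ∂μ, z.im ≤ ‖z - x‖ :=
  Eventually.of_forall fun x => (le_abs_self _).trans (abs_im_le_norm_sub_ofReal z x)

section CauchyTransform

variable {μ : Measure ℝ} [IsProbabilityMeasure μ] {z : ℂ} {r : ℝ}

lemma measurable_resolvent (z : ℂ) : Measurable fun x : ℝ => (z - (x : ℂ))⁻¹ := by fun_prop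

lemma integrable_resolvent (hr : 0 < r) (h : ∀ᵐ x : ℝ ∂μ, r ≤ ‖z - x‖) :
    Integrable (fun x : ℝ => (z - (x : ℂ))⁻¹) μ := by
  refine Integrable.of_bound (C := r⁻¹) (measurable_resolvent z).aestronglyMeasurable ?_
  filter_upwards [h] with x hx
  rw [norm_inv]
  gcongr

lemma differentiableAt_cauchyTransform (hr : 0 < r) (h : ∀ᵐ x : ℝ ∂μ, r ≤ ‖z - x‖) :
    DifferentiableAt ℂ (cauchyTransform μ) z := by
  have hb : ∀ᵐ x : ℝ ∂μ, ∀ w ∈ Metric.ball z (r / 2), r / 2 ≤ ‖w - x‖ := by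
    filter_upwards [h] with x hx w hw
    have h1 : ‖w - z‖ < r / 2 := by simpa [dist_eq_norm] using hw
    have h2 : ‖z - x‖ ≤ ‖w - x‖ + ‖w - z‖ := by
      have := norm_sub_le (w - x) (w - z)
      simpa using this
    linarith
  refine (hasDerivAt_integral_of_dominated_loc_of_deriv_le (F := fun (w : ℂ) (x : ℝ) => (w - (x : ℂ))⁻¹)
    (F' := fun (w : ℂ) (x : ℝ) => -1 / (w - (x : ℂ)) ^ 2) (bound := fun _ => ((r / 2) ^ 2)⁻¹)
    (Metric.ball_mem_nhds z (half_pos hr)) ?_ (integrable_resolvent hr h) ?_ ?_ ?_ ?_).2.differentiableAt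
  · exact Eventually.of_forall fun w => (measurable_resolvent w).aestronglyMeasurable
  · exact Measurable.aestronglyMeasurable (by fun_prop)
  · filter_upwards [hb] with x hx w hw
    have := hx w hw
    rw [norm_div, norm_pow, norm_neg, norm_one, one_div]
    gcongr
  · exact integrable_const _
  · filter_upwards [hb] with x hx w hw
    have h0 : w - x ≠ 0 := norm_pos_iff.1 (by linarith [hx w hw])
    exact ((hasDerivAt_id w).sub_const (x : ℂ)).inv h0

lemma im_cauchyTransform (hr : 0 < r) (h : ∀ᵐ x : ℝ ∂μ, r ≤ ‖z - x‖) :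
    (cauchyTransform μ z).im = ∫ x : ℝ, -z.im / ‖z - x‖ ^ 2 ∂μ := by
  have := integral_im (𝕜 := ℂ) (integrable_resolvent hr h)
  simp only [RCLike.im_to_complex] at this
  rw [cauchyTransform, ← this]
  congr 1 with x
  rw [Complex.inv_im, Complex.normSq_eq_norm_sq]
  simp

lemma integrable_inv_norm_sq (hz : 0 < z.im) :
    Integrable (fun x : ℝ => (‖z - x‖ ^ 2)⁻¹) μ := by
  refine Integrable.of_bound (C := (z.im ^ 2)⁻¹)
    (Measurable.aestronglyMeasurable (by fun_prop)) ?_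
  filter_upwards [ae_im_le_norm z] with x hx
  rw [norm_inv, norm_pow, norm_norm]
  gcongr

lemma neg_im_cauchyTransform (hz : 0 < z.im) :
    -(cauchyTransform μ z).im = z.im * ∫ x : ℝ, (‖z - x‖ ^ 2)⁻¹ ∂μ := by
  rw [im_cauchyTransform hz (ae_im_le_norm z), ← integral_const_mul, ← integral_neg]
  congr 1 with x
  ring

lemma norm_cauchyTransform_sq_le (hz : 0 < z.im) :
    ‖cauchyTransform μ z‖ ^ 2 ≤ ∫ x : ℝ, (‖z - x‖ ^ 2)⁻¹ ∂μ := by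
  have hint := integrable_resolvent hz (ae_im_le_norm (μ := μ) z)
  set A := ∫ x : ℝ, ‖(z - (x : ℂ))⁻¹‖ ∂μ with hA
  have h1 : ‖cauchyTransform μ z‖ ≤ A := norm_integral_le_integral_norm _
  have h2 : 0 ≤ ∫ x : ℝ, (‖(z - (x : ℂ))⁻¹‖ - A) ^ 2 ∂μ := integral_nonneg fun x => sq_nonneg _
  have h3 : ∫ x : ℝ, (‖(z - (x : ℂ))⁻¹‖ - A) ^ 2 ∂μ = (∫ x : ℝ, (‖z - x‖ ^ 2)⁻¹ ∂μ) - A ^ 2 := by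
    have : ∀ x : ℝ, (‖(z - (x : ℂ))⁻¹‖ - A) ^ 2
        = (‖z - x‖ ^ 2)⁻¹ - 2 * A * ‖(z - (x : ℂ))⁻¹‖ + A ^ 2 := by
      intro x; rw [norm_inv]; ring
    simp_rw [this]
    have i1 := integrable_inv_norm_sq (μ := μ) hz
    have i2 := hint.norm.const_mul (2 * A)
    have i3 : Integrable (fun x : ℝ => (‖z - x‖ ^ 2)⁻¹ - 2 * A * ‖(z - (x : ℂ))⁻¹‖) μ := i1.sub i2
    rw [integral_add i3 (integrable_const _), integral_sub i1 i2, integral_const_mul, ← hA]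
    simp
    ring
  nlinarith [norm_nonneg (cauchyTransform μ z)]

lemma im_cauchyTransform_neg (hz : 0 < z.im) : (cauchyTransform μ z).im < 0 := by
  have h := neg_im_cauchyTransform (μ := μ) hz
  have hpos : 0 < ∫ x : ℝ, (‖z - x‖ ^ 2)⁻¹ ∂μ := by
    rw [integral_pos_iff_support_of_nonneg (fun x => by positivity) (integrable_inv_norm_sq hz)]
    have : Function.support (fun x : ℝ => (‖z - x‖ ^ 2)⁻¹) = univ := by
      ext x
      have : 0 < ‖z - x‖ := hz.trans_le ((le_abs_self _).trans (abs_im_le_norm_sub_ofReal z x))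
      simp only [Function.mem_support, mem_univ, iff_true]
      positivity
    simp [this]
  nlinarith [mul_pos hz hpos]

lemma cauchyTransform_ne_zero (hz : 0 < z.im) : cauchyTransform μ z ≠ 0 := by
  intro h
  simpa [h] using im_cauchyTransform_neg (μ := μ) hz

lemma im_le_im_Ftransform (hz : 0 < z.im) : z.im ≤ (Ftransform μ z).im := by
  have h0 := cauchyTransform_ne_zero (μ := μ) hz
  rw [Ftransform, Complex.inv_im, Complex.normSq_eq_norm_sq, neg_im_cauchyTransform hz,
    le_div_iff₀ (by positivity)]
  gcongr
  exact norm_cauchyTransform_sq_le hz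

lemma differentiableAt_Ftransform (hz : 0 < z.im) : DifferentiableAt ℂ (Ftransform μ) z :=
  (differentiableAt_cauchyTransform hz (ae_im_le_norm z)).inv (cauchyTransform_ne_zero hz)

lemma im_Ftransform_nonpos (hr : 0 < r) (h : ∀ᵐ x : ℝ ∂μ, r ≤ ‖z - x‖) (hz : z.im ≤ 0) :
    (Ftransform μ z).im ≤ 0 := by
  rw [Ftransform, Complex.inv_im, im_cauchyTransform hr h]
  have : 0 ≤ ∫ x : ℝ, -z.im / ‖z - x‖ ^ 2 ∂μ :=
    integral_nonneg fun x => div_nonneg (by linarith) (by positivity)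
  exact div_nonpos_of_nonpos_of_nonneg (by linarith) (Complex.normSq_nonneg _)

lemma measureReal_ball_le (x : ℝ) {ε : ℝ} (hε : 0 < ε) :
    μ.real (Metric.ball x ε) ≤ 2 * ε * -(cauchyTransform μ (x + ε * Complex.I)).im := by
  have hz : 0 < ((x : ℂ) + ε * Complex.I).im := by simpa using hε
  rw [neg_im_cauchyTransform hz]
  have h1 : (2 * ε ^ 2)⁻¹ * μ.real (Metric.ball x ε)
      ≤ ∫ t : ℝ, (‖(x : ℂ) + ε * Complex.I - t‖ ^ 2)⁻¹ ∂μ := by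
    calc (2 * ε ^ 2)⁻¹ * μ.real (Metric.ball x ε)
        = ∫ t : ℝ, (Metric.ball x ε).indicator (fun _ => (2 * ε ^ 2)⁻¹) t ∂μ := by
          rw [integral_indicator_const _ Metric.isOpen_ball.measurableSet, smul_eq_mul, mul_comm]
      _ ≤ _ := by
          refine integral_mono ((integrable_const _).indicator Metric.isOpen_ball.measurableSet)
            (integrable_inv_norm_sq hz) fun t => ?_
          by_cases ht : t ∈ Metric.ball x ε
          swap
          · rw [indicator_of_notMem ht]
            positivity
          rw [indicator_of_mem ht]
          have hn : ‖(x : ℂ) + ε * Complex.I - t‖ ^ 2 = (x - t) ^ 2 + ε ^ 2 := by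
            rw [← Complex.normSq_eq_norm_sq, Complex.normSq_apply]
            simp
            ring
          have ht' : |x - t| < ε := by simpa [Real.dist_eq, abs_sub_comm] using ht
          rw [hn]
          gcongr
          have := sq_lt_sq' (neg_lt_of_abs_lt ht') (lt_of_abs_lt ht')
          linarith
  have h2 : ((x : ℂ) + ε * Complex.I).im = ε := by simp
  rw [h2]
  calc μ.real (Metric.ball x ε) = 2 * ε ^ 2 * ((2 * ε ^ 2)⁻¹ * μ.real (Metric.ball x ε)) := by
        field_simp
    _ ≤ 2 * ε ^ 2 * ∫ t : ℝ, (‖(x : ℂ) + ε * Complex.I - t‖ ^ 2)⁻¹ ∂μ := by gcongr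
    _ = _ := by ring

end CauchyTransform

lemma ae_sub_le_norm_sub {μ : Measure ℝ} {C : ℝ} (hμ : ∀ᵐ x : ℝ ∂μ, |x| ≤ C) (z : ℂ) :
    ∀ᵐ x : ℝ ∂μ, ‖z‖ - C ≤ ‖z - x‖ := by
  filter_upwards [hμ] with x hx
  have := norm_sub_norm_le z (x : ℂ)
  rw [Complex.norm_real, Real.norm_eq_abs] at this
  linarith

section CompactSupport

variable {μ : Measure ℝ} [IsProbabilityMeasure μ] {C : ℝ}

lemma tendsto_mul_cauchyTransform_sub_one (hμ : ∀ᵐ x : ℝ ∂μ, |x| ≤ C) :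
    Tendsto (fun z => z * (z * cauchyTransform μ z - 1)) (Bornology.cobounded ℂ)
      (𝓝 ((∫ x, x ∂μ : ℝ) : ℂ)) := by
  have hx : Integrable (fun x : ℝ => (x : ℂ)) μ :=
    Integrable.of_bound (C := C) (Measurable.aestronglyMeasurable (by fun_prop))
      (by filter_upwards [hμ] with x hx; simpa using hx)
  rw [tendsto_iff_norm_sub_tendsto_zero]
  have hlim : Tendsto (fun z : ℂ => C ^ 2 / (‖z‖ - C)) (Bornology.cobounded ℂ) (𝓝 0) :=
    (tendsto_atTop_add_const_right _ (-C) tendsto_norm_cobounded_atTop).const_div_atTop _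
  refine squeeze_zero' (Eventually.of_forall fun _ => norm_nonneg _) ?_ hlim
  filter_upwards [tendsto_norm_cobounded_atTop.eventually_gt_atTop C] with z hz
  have hb := ae_sub_le_norm_sub hμ z
  have hr : 0 < ‖z‖ - C := by linarith
  have hres := integrable_resolvent hr hb
  have key : z * (z * cauchyTransform μ z - 1) - ((∫ x, x ∂μ : ℝ) : ℂ)
      = ∫ x : ℝ, (x : ℂ) ^ 2 * (z - x)⁻¹ ∂μ := by
    have e1 : ∀ᵐ x : ℝ ∂μ, (x : ℂ) ^ 2 * (z - x)⁻¹ = z * (z * (z - x)⁻¹ - 1) - x := by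
      filter_upwards [hb] with x hx
      have h0 : z - x ≠ 0 := norm_pos_iff.1 (by linarith)
      field_simp
      ring
    have i1 : Integrable (fun x : ℝ => z * (z - (x : ℂ))⁻¹ - 1) μ :=
      (hres.const_mul z).sub (integrable_const _)
    rw [integral_congr_ae e1, integral_sub (i1.const_mul z) hx,
      integral_const_mul, integral_sub (hres.const_mul z) (integrable_const _), integral_const_mul,
      integral_complex_ofReal]
    simp [cauchyTransform]
  rw [key]
  have := norm_integral_le_of_norm_le_const (μ := μ) (f := fun x : ℝ => (x : ℂ) ^ 2 * (z - x)⁻¹)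
    (C := C ^ 2 / (‖z‖ - C)) (by
      filter_upwards [hb, hμ] with x hx hxC
      rw [norm_mul, norm_inv, norm_pow, Complex.norm_real, Real.norm_eq_abs, div_eq_mul_inv]
      gcongr)
  simpa using this

lemma tendsto_mul_cauchyTransform (hμ : ∀ᵐ x : ℝ ∂μ, |x| ≤ C) :
    Tendsto (fun z => z * cauchyTransform μ z) (Bornology.cobounded ℂ) (𝓝 1) := by
  have h := (tendsto_inv₀_cobounded (α := ℂ)).mul (tendsto_mul_cauchyTransform_sub_one hμ)
  rw [zero_mul] at h
  have h2 := h.add_const 1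
  rw [zero_add] at h2
  refine h2.congr' ?_
  filter_upwards [Bornology.eventually_ne_cobounded (0 : ℂ)] with z hz
  field_simp
  ring

lemma eventually_cauchyTransform_ne_zero (hμ : ∀ᵐ x : ℝ ∂μ, |x| ≤ C) :
    ∀ᶠ z in Bornology.cobounded ℂ, cauchyTransform μ z ≠ 0 := by
  filter_upwards [(tendsto_mul_cauchyTransform hμ).eventually_ne one_ne_zero] with z hz
  exact right_ne_zero_of_mul hz

lemma tendsto_Ftransform_sub_self (hμ : ∀ᵐ x : ℝ ∂μ, |x| ≤ C) :
    Tendsto (fun z => Ftransform μ z - z) (Bornology.cobounded ℂ)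
      (𝓝 (-((∫ x, x ∂μ : ℝ) : ℂ))) := by
  have h := ((tendsto_mul_cauchyTransform_sub_one hμ).div
    (tendsto_mul_cauchyTransform hμ) one_ne_zero).neg
  rw [div_one] at h
  refine h.congr' ?_
  filter_upwards [Bornology.eventually_ne_cobounded (0 : ℂ),
    eventually_cauchyTransform_ne_zero hμ] with z hz hG
  simp only [Pi.div_apply, Ftransform]
  field_simp
  ring

lemma eventually_differentiableAt_Ftransform (hμ : ∀ᵐ x : ℝ ∂μ, |x| ≤ C) :
    ∀ᶠ z in Bornology.cobounded ℂ, DifferentiableAt ℂ (Ftransform μ) z := by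
  filter_upwards [eventually_cauchyTransform_ne_zero hμ,
    tendsto_norm_cobounded_atTop.eventually_gt_atTop C] with z h0 hz
  exact (differentiableAt_cauchyTransform (sub_pos.2 hz) (ae_sub_le_norm_sub hμ z)).inv h0

end CompactSupport

/-- The part of the upper half-plane outside the closed disc of radius `C`. -/
abbrev halfExterior (C : ℝ) : Set ℂ := {z : ℂ | 0 < z.im ∧ C < ‖z‖}

lemma isOpen_halfExterior (C : ℝ) : IsOpen (halfExterior C) :=
  isOpen_upperHalf.inter (isOpen_lt continuous_const continuous_norm)

lemma isPreconnected_halfExterior {C : ℝ} (hC : 0 < C) : IsPreconnected (halfExterior C) := by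
  have hconv : Convex ℝ ({s : ℂ | Real.log C < s.re} ∩ ({s : ℂ | 0 < s.im} ∩ {s | s.im < Real.pi})) :=
    (convex_halfSpace_re_gt _).inter ((convex_halfSpace_im_gt _).inter (convex_halfSpace_im_lt _))
  convert hconv.isPreconnected.image Complex.exp Complex.continuous_exp.continuousOn
  ext z
  constructor
  · rintro ⟨h1, h2⟩
    have h0 : z ≠ 0 := norm_pos_iff.1 (hC.trans h2)
    refine ⟨Complex.log z, ⟨?_, ?_, ?_⟩, Complex.exp_log h0⟩
    · simpa [Complex.log_re] using Real.log_lt_log hC h2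
    · rw [mem_ofPred_eq, Complex.log_im]
      refine lt_of_le_of_ne (Complex.arg_nonneg_iff.2 h1.le) fun h => ?_
      exact h1.ne' (Complex.arg_eq_zero_iff.1 h.symm).2
    · rw [mem_ofPred_eq, Complex.log_im]
      refine lt_of_le_of_ne (Complex.arg_le_pi z) fun h => ?_
      exact h1.ne' (Complex.arg_eq_pi_iff.1 h).2
  · rintro ⟨s, ⟨h1, h2, h3⟩, rfl⟩
    refine ⟨?_, ?_⟩
    · rw [Complex.exp_im]
      exact mul_pos (Real.exp_pos _) (Real.sin_pos_of_pos_of_lt_pi h2 h3)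
    · rw [Complex.norm_exp]
      exact (Real.log_lt_iff_lt_exp hC).1 h1

section MaximumPrinciple

variable {U : Set ℂ} {f : ℂ → ℂ}

/-- Maximum principle for imaginary parts of holomorphic functions whose positive superlevel sets
are compact. -/
lemma im_nonpos_of_isCompact_superlevel (hU : IsPreconnected U) (ho : IsOpen U)
    (hf : DifferentiableOn ℂ f U) (hc : ∀ ε > 0, IsCompact {z ∈ U | ε ≤ (f z).im}) :
    ∀ z ∈ U, (f z).im ≤ 0 := by
  by_contra! ⟨z₀, hz₀, hpos⟩
  have hK := hc _ hpos
  have hcont : ContinuousOn (fun z => (f z).im) U :=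
    Complex.continuous_im.comp_continuousOn hf.continuousOn
  obtain ⟨c, hcK, hmax⟩ := hK.exists_isMaxOn ⟨z₀, hz₀, le_rfl⟩ (hcont.mono fun z hz => hz.1)
  have hnorm : ∀ z, ‖Complex.exp (-Complex.I * f z)‖ = Real.exp (f z).im := by
    intro z; rw [Complex.norm_exp]; simp
  have hle : ∀ z ∈ U, (f z).im ≤ (f c).im := by
    intro z hz
    by_cases h : (f z₀).im ≤ (f z).im
    · exact hmax ⟨hz, h⟩
    · exact (not_le.1 h).le.trans hcK.2
  have heq := Complex.norm_eqOn_of_isPreconnected_of_isMaxOn hU ho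
    (f := fun z => Complex.exp (-Complex.I * f z)) (c := c) (hf.const_mul _).cexp hcK.1
    (fun z hz => by
      change ‖Complex.exp (-Complex.I * f z)‖ ≤ ‖Complex.exp (-Complex.I * f c)‖
      rw [hnorm, hnorm]
      exact Real.exp_le_exp.2 (hle z hz))
  have hKU : {z ∈ U | (f z₀).im ≤ (f z).im} = U := by
    refine Subset.antisymm (fun z hz => hz.1) fun z hz => ⟨hz, ?_⟩
    have := heq hz
    simp only [Function.comp, Function.const, hnorm, Real.exp_eq_exp] at this
    rw [this]; exact hcK.2
  rw [hKU] at hK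
  have : U = univ := IsClopen.eq_univ ⟨hK.isClosed, ho⟩ ⟨z₀, hz₀⟩
  exact noncompact_univ ℂ (this ▸ hK)

lemma im_pos_of_im_nonneg (hU : IsPreconnected U) (ho : IsOpen U)
    (hf : DifferentiableOn ℂ f U) (h0 : ∀ z ∈ U, 0 ≤ (f z).im) {a : ℂ} (ha : a ∈ U)
    (hpos : 0 < (f a).im) : ∀ z ∈ U, 0 < (f z).im := by
  intro c hcU
  by_contra! h
  have hc : (f c).im = 0 := le_antisymm h (h0 c hcU)
  have hnorm : ∀ z, ‖Complex.exp (Complex.I * f z)‖ = Real.exp (-(f z).im) := by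
    intro z; rw [Complex.norm_exp]; simp
  have heq := Complex.norm_eqOn_of_isPreconnected_of_isMaxOn hU ho
    (f := fun z => Complex.exp (Complex.I * f z)) (c := c) (hf.const_mul _).cexp hcU
    (fun z hz => by simpa [hnorm, hc] using h0 z hz)
  have := heq ha
  simp only [Function.comp, Function.const, hnorm, Real.exp_eq_exp, hc] at this
  linarith

lemma norm_deriv_le_of_im_mem_Icc {c : ℂ} {r M : ℝ} (hr : 0 < r) (hM : 0 < M)
    (hf : DifferentiableOn ℂ f (Metric.ball c r))
    (h : ∀ z ∈ Metric.ball c r, (f z).im ∈ Icc 0 M) : ‖deriv f c‖ ≤ 4 * M / r := by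
  have hmaps : MapsTo (fun z => c + z) (Metric.ball 0 r) (Metric.ball c r) := by
    intro z hz; simpa using hz
  have hd : DifferentiableOn ℂ (fun z => -Complex.I * (f (c + z) - f c)) (Metric.ball 0 r) :=
    ((hf.comp (by fun_prop) hmaps).sub_const _).const_mul _
  have hb : ∀ z ∈ Metric.closedBall c (r / 2), ‖f z - f c‖ ≤ 2 * M := by
    intro z hz
    have hz' : ‖z - c‖ ≤ r / 2 := by simpa [dist_eq_norm] using hz
    have := Complex.borelCaratheodory_zero hM hd (z := z - c) ?_ hr (by simpa using by linarith)
      (by simp)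
    · simp only [add_sub_cancel, norm_mul, norm_neg, Complex.norm_I, one_mul] at this
      refine this.trans ?_
      rw [div_le_iff₀ (by linarith)]
      nlinarith
    · intro w hw
      have h1 := (h _ (hmaps hw)).2
      have h2 := (h c (Metric.mem_ball_self hr)).1
      simp
      linarith
  have hcl : DiffContOnCl ℂ (fun z => f z - f c) (Metric.ball c (r / 2)) :=
    ((hf.mono (Metric.closedBall_subset_ball (by linarith))).sub_const _).diffContOnCl_ball
      (Subset.refl _)
  have := Complex.norm_deriv_le_of_forall_mem_sphere_norm_le (half_pos hr) hcl
    (fun z hz => hb z (Metric.sphere_subset_closedBall hz))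
  rw [deriv_sub_const] at this
  refine this.trans (le_of_eq ?_)
  field_simp
  ring

end MaximumPrinciple

section ExteriorEstimate

variable {g : ℂ → ℂ} {R : ℝ}

lemma im_sub_im_le (hR : 0 < R)
    (hd : ∀ w : ℂ, 0 < w.im → R ≤ ‖w‖ → DifferentiableAt ℂ g w)
    (h0 : ∀ w : ℂ, 0 < w.im → R ≤ ‖w‖ → 0 ≤ (g w).im)
    (hlim : Tendsto (fun w => g w - w) (Bornology.cobounded ℂ ⊓ 𝓟 upperHalf) (𝓝 0)) :
    ∀ w : ℂ, 0 < w.im → R ≤ ‖w‖ → w.im - (g w).im ≤ R ^ 2 * w.im / ‖w‖ ^ 2 := by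
  set f : ℂ → ℂ := fun w => w - g w + R ^ 2 * w⁻¹ with hf
  have him : ∀ w, (f w).im = w.im - (g w).im - R ^ 2 * w.im / ‖w‖ ^ 2 := by
    intro w
    have : ((R : ℂ) ^ 2 * w⁻¹).im = R ^ 2 * w⁻¹.im := by
      rw [← Complex.ofReal_pow, Complex.im_ofReal_mul]
    rw [hf]
    simp only [Complex.add_im, Complex.sub_im, this, Complex.inv_im, Complex.normSq_eq_norm_sq]
    ring
  have hfd : ∀ w : ℂ, 0 < w.im → R ≤ ‖w‖ → DifferentiableAt ℂ f w := by
    intro w h1 h2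
    have : w ≠ 0 := norm_pos_iff.1 (hR.trans_le h2)
    exact (differentiableAt_id.sub (hd w h1 h2)).add ((differentiableAt_inv this).const_mul _)
  have hbdry : ∀ w : ℂ, 0 < w.im → R = ‖w‖ → (f w).im ≤ 0 := by
    intro w h1 h2
    have := h0 w h1 h2.le
    rw [him, ← h2]
    field_simp
    linarith
  have hflim : Tendsto f (Bornology.cobounded ℂ ⊓ 𝓟 upperHalf) (𝓝 0) := by
    have h1 := ((tendsto_inv₀_cobounded (α := ℂ)).const_mul ((R : ℂ) ^ 2)).mono_left
      (inf_le_left (b := 𝓟 upperHalf))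
    have := hlim.neg.add h1
    simpa [hf] using this
  have hmp : ∀ w ∈ halfExterior R, (f w).im ≤ 0 := by
    refine im_nonpos_of_isCompact_superlevel (isPreconnected_halfExterior hR) (isOpen_halfExterior R)
      (fun w hw => (hfd w hw.1 hw.2.le).differentiableWithinAt) fun ε hε => ?_
    have hev : ∀ᶠ w in Bornology.cobounded ℂ, 0 < w.im → ‖f w‖ < ε := by
      have := hflim.eventually (Metric.ball_mem_nhds 0 hε)
      rw [eventually_inf_principal] at this
      simpa using this
    obtain ⟨M, -, hM⟩ := (Metric.hasBasis_cobounded_compl_closedBall (0 : ℂ)).eventually_iff.1 hev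
    set K : Set ℂ := Metric.closedBall 0 M ∩ {w | ε ≤ w.im} ∩ {w | R ≤ ‖w‖}
    have hK : IsCompact K :=
      ((isCompact_closedBall _ _).inter_right (isClosed_le continuous_const Complex.continuous_im)).inter_right
        (isClosed_le continuous_const continuous_norm)
    have hcK : ContinuousOn (fun w => (f w).im) K := fun w hw =>
      (Complex.continuous_im.continuousAt.comp
        (hfd w (hε.trans_le hw.1.2) hw.2).continuousAt).continuousWithinAt
    have hK' : IsCompact (K ∩ (fun w => (f w).im) ⁻¹' Ici ε) :=
      hK.of_isClosed_subset (hcK.preimage_isClosed_of_isClosed hK.isClosed isClosed_Ici) inter_subset_left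
    convert hK' using 1
    ext w
    constructor
    · rintro ⟨⟨h1, h2⟩, h3⟩
      refine ⟨⟨⟨?_, ?_⟩, h2.le⟩, h3⟩
      · by_contra hw
        have := hM hw h1
        linarith [Complex.im_le_norm (f w)]
      · have := h0 w h1 h2.le
        have h4 : 0 ≤ R ^ 2 * w.im / ‖w‖ ^ 2 := by positivity
        rw [him] at h3
        simp only [mem_ofPred_eq]
        linarith
    · rintro ⟨⟨⟨-, h1⟩, h2⟩, h3⟩
      have h1' : 0 < w.im := hε.trans_le h1
      refine ⟨⟨h1', lt_of_le_of_ne h2 fun h => ?_⟩, h3⟩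
      have := hbdry w h1' h
      simp only [mem_preimage, mem_Ici] at h3
      linarith
  intro w h1 h2
  have : (f w).im ≤ 0 := by
    rcases h2.eq_or_lt with h | h
    · exact hbdry w h1 h
    · exact hmp w ⟨h1, h⟩
  rw [him] at this
  linarith

lemma norm_sub_self_le (hR : 0 < R)
    (hd : ∀ w : ℂ, 0 < w.im → R ≤ ‖w‖ → DifferentiableAt ℂ g w)
    (h0 : ∀ w : ℂ, 0 < w.im → R ≤ ‖w‖ → 0 ≤ (g w).im)
    (h1 : ∀ w : ℂ, 0 < w.im → R ≤ ‖w‖ → (g w).im ≤ w.im)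
    (hlim : Tendsto (fun w => g w - w) (Bornology.cobounded ℂ ⊓ 𝓟 upperHalf) (𝓝 0)) :
    ∀ w : ℂ, 0 < w.im → 2 * R ≤ ‖w‖ → ‖g w - w‖ ≤ 48 * R ^ 2 / ‖w‖ := by
  have hv := im_sub_im_le hR hd h0 hlim
  have hderiv : ∀ w : ℂ, 0 < w.im → 2 * R ≤ ‖w‖ →
      ‖deriv (fun w => g w - w) w‖ ≤ 48 * R ^ 2 / ‖w‖ ^ 2 := by
    intro w hw hwR
    have hw0 : 0 < ‖w‖ := by linarith
    have hin : ∀ z ∈ Metric.ball w (w.im / 2),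
        0 < z.im ∧ z.im ≤ 3 / 2 * w.im ∧ ‖w‖ / 2 ≤ ‖z‖ := by
      intro z hz
      have hz' : ‖z - w‖ < w.im / 2 := by simpa [dist_eq_norm] using hz
      have e1 := (Complex.abs_im_le_norm (z - w)).trans_lt hz'
      rw [Complex.sub_im, abs_lt] at e1
      have e2 : ‖w‖ ≤ ‖z‖ + ‖z - w‖ := by
        have := norm_sub_le z (z - w)
        simpa using this
      have e3 := Complex.im_le_norm w
      exact ⟨by linarith, by linarith, by linarith⟩
    have hdiff : DifferentiableOn ℂ (fun z => z - g z) (Metric.ball w (w.im / 2)) := fun z hz =>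
      (differentiableAt_id.sub (hd z (hin z hz).1 (by linarith [(hin z hz).2.2]))).differentiableWithinAt
    have := norm_deriv_le_of_im_mem_Icc (f := fun z => z - g z) (half_pos hw)
      (M := 6 * R ^ 2 * w.im / ‖w‖ ^ 2) (by positivity) hdiff (fun z hz => by
        obtain ⟨a1, a2, a3⟩ := hin z hz
        have hRz : R ≤ ‖z‖ := by linarith
        refine ⟨by simpa using h1 z a1 hRz, ?_⟩
        rw [Complex.sub_im]
        refine (hv z a1 hRz).trans ?_
        calc R ^ 2 * z.im / ‖z‖ ^ 2 ≤ R ^ 2 * (3 / 2 * w.im) / (‖w‖ / 2) ^ 2 := by gcongr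
          _ = 6 * R ^ 2 * w.im / ‖w‖ ^ 2 := by field_simp; ring)
    have hneg : deriv (fun w => g w - w) w = -deriv (fun z => z - g z) w := by
      rw [← deriv.fun_neg]
      congr 1
      ext z
      ring
    rw [hneg, norm_neg]
    refine this.trans (le_of_eq ?_)
    field_simp
    ring
  intro w hw hwR
  have hw0 : 0 < ‖w‖ := by linarith
  set A := 48 * R ^ 2 / ‖w‖ with hA
  have hray : ∀ t : ℝ, 1 ≤ t → 0 < ((t : ℂ) * w).im ∧ 2 * R ≤ ‖(t : ℂ) * w‖ ∧ ‖(t : ℂ) * w‖ = t * ‖w‖ := by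
    intro t ht
    have hn : ‖(t : ℂ) * w‖ = t * ‖w‖ := by
      rw [norm_mul, Complex.norm_real, Real.norm_of_nonneg (by linarith)]
    refine ⟨by rw [Complex.im_ofReal_mul]; positivity, ?_, hn⟩
    rw [hn]; nlinarith
  have hcurve : ∀ t : ℝ, 1 ≤ t → HasDerivAt (fun t : ℝ => (g (t * w) - t * w) - (g w - w))
      (deriv (fun w => g w - w) (t * w) * w) t := by
    intro t ht
    obtain ⟨a1, a2, -⟩ := hray t ht
    have e1 : HasDerivAt (fun w => g w - w) (deriv (fun w => g w - w) (t * w)) ((t : ℂ) * w) :=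
      ((hd _ a1 (by linarith)).sub differentiableAt_id).hasDerivAt
    have e2 : HasDerivAt (fun s : ℂ => s * w) w (t : ℂ) := by
      simpa using (hasDerivAt_id (t : ℂ)).mul_const w
    have e3 := (e1.comp (t : ℂ) e2).comp_ofReal
    exact e3.sub_const _
  have hbound : ∀ T : ℝ, 1 ≤ T → ‖(g (T * w) - T * w) - (g w - w)‖ ≤ A := by
    intro T hT
    have := image_norm_le_of_norm_deriv_right_le_deriv_boundary'
      (f := fun t : ℝ => (g (t * w) - t * w) - (g w - w)) (a := 1) (b := T)
      (f' := fun t : ℝ => deriv (fun w => g w - w) (t * w) * w)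
      (fun t ht => (hcurve t ht.1).continuousAt.continuousWithinAt)
      (fun t ht => (hcurve t ht.1).hasDerivWithinAt)
      (B := fun t => A * (1 - t⁻¹)) (B' := fun t => A * (t ^ 2)⁻¹) (by simp)
      (fun t ht => by
        have : t ≠ 0 := by linarith [ht.1]
        have h : ContinuousAt (fun t => A * (1 - t⁻¹)) t :=
          (continuousAt_const.sub (continuousAt_inv₀ this)).const_mul A
        exact h.continuousWithinAt)
      (fun t ht => by
        have : t ≠ 0 := by linarith [ht.1]
        have h := ((hasDerivAt_inv this).const_sub 1).const_mul A
        rw [neg_neg] at h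
        exact h.hasDerivWithinAt)
      (fun t ht => by
        obtain ⟨a1, a2, a3⟩ := hray t ht.1
        have ht0 : 0 < t := by linarith [ht.1]
        rw [norm_mul]
        calc _ ≤ 48 * R ^ 2 / ‖(t : ℂ) * w‖ ^ 2 * ‖w‖ := by gcongr; exact hderiv _ a1 a2
          _ = _ := by rw [a3, hA]; field_simp)
      (right_mem_Icc.2 hT)
    refine this.trans ?_
    have hT0 : 0 < T⁻¹ := by positivity
    have hA0 : 0 ≤ A := by positivity
    nlinarith
  have htend : Tendsto (fun T : ℝ => (T : ℂ) * w) atTop (Bornology.cobounded ℂ ⊓ 𝓟 upperHalf) := by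
    rw [tendsto_inf]
    constructor
    · rw [← tendsto_norm_atTop_iff_cobounded]
      refine (tendsto_id.atTop_mul_const hw0).congr' ?_
      filter_upwards [eventually_ge_atTop 1] with T hT
      exact (hray T hT).2.2.symm
    · rw [tendsto_principal]
      filter_upwards [eventually_ge_atTop 1] with T hT
      exact (hray T hT).1
  have hl := ((hlim.comp htend).sub_const (g w - w)).norm
  rw [zero_sub, norm_neg] at hl
  refine le_of_tendsto hl ?_
  filter_upwards [eventually_ge_atTop 1] with T hT
  exact hbound T hT

end ExteriorEstimate

section Support

variable {μ : Measure ℝ} [IsProbabilityMeasure μ]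

lemma measure_eq_zero_of_tendsto_im_cauchyTransform {U : Set ℝ} (hU : IsOpen U)
    (h : ∀ x ∈ U, Tendsto (fun ε : ℝ => (cauchyTransform μ (x + ε * Complex.I)).im)
      (𝓝[>] 0) (𝓝 0)) : μ U = 0 := by
  have hderiv : ∀ x ∈ U, HasDerivAt (fun y => μ.real (Iic y)) 0 x := by
    intro x hx
    rw [hasDerivAt_iff_isLittleO, Asymptotics.isLittleO_iff]
    intro c hc
    have h1 : ∀ᶠ ε : ℝ in 𝓝[>] 0, -(cauchyTransform μ (x + ε * Complex.I)).im < c / 4 := by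
      have := (h x hx).neg
      rw [neg_zero] at this
      exact this.eventually (gt_mem_nhds (by positivity))
    obtain ⟨δ, hδ, hδ'⟩ := mem_nhdsGT_iff_exists_Ioo_subset.1 h1
    filter_upwards [Metric.ball_mem_nhds x (half_pos hδ)] with y hy
    rcases eq_or_ne y x with rfl | hyx
    · simp
    rw [Metric.mem_ball, Real.dist_eq] at hy
    have hpos : 0 < |y - x| := abs_pos.2 (sub_ne_zero.2 hyx)
    have h2 : -(cauchyTransform μ (x + (2 * |y - x| : ℝ) * Complex.I)).im < c / 4 :=
      hδ' ⟨by positivity, by linarith⟩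
    have h3 := measureReal_ball_le (μ := μ) x (ε := 2 * |y - x|) (by positivity)
    have h4 : μ.real (Metric.ball x (2 * |y - x|)) ≤ c * |y - x| := by
      refine h3.trans ?_
      nlinarith
    have key : ∀ a b : ℝ, a ≤ b → Ioc a b ⊆ Metric.ball x (2 * |y - x|) →
        |μ.real (Iic b) - μ.real (Iic a)| ≤ c * |y - x| := by
      intro a b hab hs
      have : μ.real (Iic b) - μ.real (Iic a) = μ.real (Ioc a b) := by
        rw [← measureReal_sdiff (Iic_subset_Iic.2 hab) measurableSet_Iic, Iic_sdiff_Iic]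
      rw [this, abs_of_nonneg measureReal_nonneg]
      exact (measureReal_mono hs).trans h4
    simp only [smul_zero, sub_zero, Real.norm_eq_abs]
    rcases lt_or_gt_of_ne hyx with hlt | hlt
    · rw [abs_sub_comm]
      refine key y x hlt.le fun t ht => ?_
      rw [Metric.mem_ball, Real.dist_eq, abs_of_nonpos (by linarith [ht.2]),
        abs_of_neg (by linarith)]
      linarith [ht.1]
    · refine key x y hlt.le fun t ht => ?_
      rw [Metric.mem_ball, Real.dist_eq, abs_of_pos (by linarith [ht.1]),
        abs_of_pos (by linarith)]
      linarith [ht.2]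
  refine measure_null_of_locally_null U fun x hx => ?_
  obtain ⟨δ, hδ, hb⟩ := Metric.isOpen_iff.1 hU x hx
  refine ⟨Ioc (x - δ / 2) (x + δ / 2), mem_nhdsWithin_of_mem_nhds
    (Ioc_mem_nhds (by linarith) (by linarith)), ?_⟩
  have hc := IsOpen.is_const_of_deriv_eq_zero (f := fun y => μ.real (Iic y))
    Metric.isOpen_ball (convex_ball x δ).isPreconnected
    (fun y hy => (hderiv y (hb hy)).differentiableAt.differentiableWithinAt)
    (fun y hy => (hderiv y (hb hy)).deriv)
    (x := x - δ / 2) (y := x + δ / 2)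
    (by rw [Metric.mem_ball, Real.dist_eq, abs_lt]; constructor <;> linarith)
    (by rw [Metric.mem_ball, Real.dist_eq, abs_lt]; constructor <;> linarith)
  have : μ.real (Ioc (x - δ / 2) (x + δ / 2)) = 0 := by
    rw [← Iic_sdiff_Iic, measureReal_sdiff (Iic_subset_Iic.2 (by linarith)) measurableSet_Iic]
    exact sub_eq_zero.2 hc.symm
  rwa [measureReal_eq_zero_iff] at this

end Support

/-- `g` is a right inverse of the `F`-transform of `μ` over `Ω`, normalized at infinity. -/
structure IsNormalizedRightInverse (Ω : Set ℂ) (μ : Measure ℝ) (g : ℂ → ℂ) : Prop where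
  isProbabilityMeasure : IsProbabilityMeasure μ
  differentiableOn : DifferentiableOn ℂ g Ω
  im_pos : ∀ w ∈ Ω, 0 < (g w).im
  Ftransform_apply : ∀ w ∈ Ω, Ftransform μ (g w) = w
  tendsto_sub : Tendsto (fun w => g w - w) (Bornology.cobounded ℂ ⊓ 𝓟 upperHalf) (𝓝 0)

namespace IsNormalizedRightInverse

variable {Ω : Set ℂ} {μ : Measure ℝ} {g : ℂ → ℂ} {R : ℝ}

lemma im_le (h : IsNormalizedRightInverse Ω μ g) {w : ℂ} (hw : w ∈ Ω) : (g w).im ≤ w.im := by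
  have := h.isProbabilityMeasure
  have := im_le_im_Ftransform (μ := μ) (h.im_pos w hw)
  rwa [h.Ftransform_apply w hw] at this

lemma cauchyTransform_apply (h : IsNormalizedRightInverse Ω μ g) {w : ℂ} (hw : w ∈ Ω) :
    cauchyTransform μ (g w) = w⁻¹ := by
  rw [← inv_inv (cauchyTransform μ (g w))]
  exact congrArg _ (h.Ftransform_apply w hw)

lemma norm_sub_le (h : IsNormalizedRightInverse Ω μ g) (ho : IsOpen Ω) (hR : 0 < R)
    (hΩR : ∀ w : ℂ, 0 < w.im → R ≤ ‖w‖ → w ∈ Ω) {w : ℂ} (hw : 0 < w.im) (hwR : 2 * R ≤ ‖w‖) :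
    ‖g w - w‖ ≤ 48 * R ^ 2 / ‖w‖ :=
  norm_sub_self_le hR
    (fun w h1 h2 => h.differentiableOn.differentiableAt (ho.mem_nhds (hΩR w h1 h2)))
    (fun w h1 h2 => (h.im_pos w (hΩR w h1 h2)).le) (fun w h1 h2 => h.im_le (hΩR w h1 h2))
    h.tendsto_sub w hw hwR

lemma norm_sub_le_const (h : IsNormalizedRightInverse Ω μ g) (ho : IsOpen Ω) (hR : 0 < R)
    (hΩR : ∀ w : ℂ, 0 < w.im → R ≤ ‖w‖ → w ∈ Ω) {w : ℂ} (hw : 0 < w.im) (hwR : 2 * R ≤ ‖w‖) :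
    ‖g w - w‖ ≤ 24 * R := by
  refine (h.norm_sub_le ho hR hΩR hw hwR).trans ?_
  rw [div_le_iff₀ (by linarith)]
  nlinarith

lemma halfExterior_subset_image (h : IsNormalizedRightInverse Ω μ g) (ho : IsOpen Ω) (hR : 0 < R)
    (hΩR : ∀ w : ℂ, 0 < w.im → R ≤ ‖w‖ → w ∈ Ω) :
    halfExterior (26 * R) ⊆ g '' halfExterior (2 * R) := by
  have hsub : halfExterior (2 * R) ⊆ Ω := fun w hw => hΩR w hw.1 (by linarith [hw.2])
  have hest : ∀ w : ℂ, 0 < w.im → 2 * R ≤ ‖w‖ → ‖g w - w‖ ≤ 24 * R :=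
    fun w => h.norm_sub_le_const ho hR hΩR
  have him : ∀ t : ℝ, 0 < t → ‖(t : ℂ) * Complex.I‖ = t := fun t ht => by
    simp [abs_of_pos ht]
  have hopen : IsOpen (g '' halfExterior (2 * R)) := by
    have han : AnalyticOnNhd ℂ g (halfExterior (2 * R)) :=
      (h.differentiableOn.mono hsub).analyticOnNhd (isOpen_halfExterior _)
    rcases han.is_constant_or_isOpen (isPreconnected_halfExterior (by positivity)) with ⟨c, hc⟩ | hs
    · exfalso
      have e : ∀ t : ℝ, 2 * R < t → (t : ℂ) * Complex.I = Ftransform μ c := by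
        intro t ht
        have hm : (t : ℂ) * Complex.I ∈ halfExterior (2 * R) :=
          ⟨by simp; linarith, by rw [him t (by linarith)]; exact ht⟩
        rw [← hc _ hm, h.Ftransform_apply _ (hsub hm)]
      have := congrArg Complex.im ((e (3 * R) (by linarith)).trans (e (4 * R) (by linarith)).symm)
      simp at this
      linarith
    · exact hs _ subset_rfl (isOpen_halfExterior _)
  refine (isPreconnected_halfExterior (by positivity)).subset_of_closure_inter_subset hopen ?_ ?_
  · have hm : 0 < (((100 * R : ℝ) : ℂ) * Complex.I).im := by simp; linarith
    have hn := him (100 * R) (by linarith)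
    have hm' : ((100 * R : ℝ) : ℂ) * Complex.I ∈ halfExterior (2 * R) :=
      ⟨hm, by rw [hn]; linarith⟩
    refine ⟨g (((100 * R : ℝ) : ℂ) * Complex.I), ⟨h.im_pos _ (hsub hm'), ?_⟩, _, hm', rfl⟩
    have h1 := hest _ hm hm'.2.le
    have h2 := norm_sub_norm_le (((100 * R : ℝ) : ℂ) * Complex.I) (g (((100 * R : ℝ) : ℂ) * Complex.I))
    rw [norm_sub_rev] at h2
    linarith
  · rintro z ⟨hz, hz1, hz2⟩
    obtain ⟨y, hy, hyz⟩ := mem_closure_iff_seq_limit.1 hz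
    choose w hw hwy using hy
    have hyb : Bornology.IsBounded (range y) := Metric.isBounded_range_of_tendsto y hyz
    obtain ⟨B, hB⟩ := hyb.exists_norm_le
    obtain ⟨w₀, -, φ, hφ, hlim⟩ := tendsto_subseq_of_bounded
      (Metric.isBounded_closedBall (x := (0 : ℂ)) (r := B + 24 * R)) (x := w) (fun n => by
        rw [mem_closedBall_zero_iff]
        have h1 := hest _ (hw n).1 (hw n).2.le
        have h2 := norm_sub_norm_le (w n) (g (w n))
        rw [norm_sub_rev, hwy] at h2
        rw [hwy] at h1
        linarith [hB _ (mem_range_self n)])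
    have hyφ := hyz.comp hφ.tendsto_atTop
    have i1 : z.im ≤ w₀.im :=
      le_of_tendsto_of_tendsto' ((Complex.continuous_im.tendsto _).comp hyφ)
        ((Complex.continuous_im.tendsto _).comp hlim) (fun n => by
          simp only [Function.comp]
          rw [← hwy]
          exact h.im_le (hsub (hw _)))
    have i2 : 2 * R ≤ ‖w₀‖ := ge_of_tendsto' hlim.norm fun n => (hw _).2.le
    have i3 : 0 < w₀.im := hz1.trans_le i1
    have hcont : ContinuousAt g w₀ :=
      (h.differentiableOn.differentiableAt (ho.mem_nhds (hΩR w₀ i3 (by linarith)))).continuousAt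
    have hgz : g w₀ = z := by
      refine tendsto_nhds_unique (hcont.tendsto.comp hlim) ?_
      exact hyφ.congr fun n => (hwy _).symm
    refine ⟨w₀, ⟨i3, lt_of_le_of_ne i2 fun heq => ?_⟩, hgz⟩
    have h1 := hest _ i3 i2
    have h2 := norm_sub_norm_le (g w₀) w₀
    rw [hgz] at h1 h2
    linarith

lemma ae_abs_le (h : IsNormalizedRightInverse Ω μ g) (ho : IsOpen Ω) (hR : 0 < R)
    (hΩR : ∀ w : ℂ, 0 < w.im → R ≤ ‖w‖ → w ∈ Ω) : ∀ᵐ x ∂μ, |x| ≤ 26 * R := by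
  have := h.isProbabilityMeasure
  have hsub : halfExterior (2 * R) ⊆ Ω := fun w hw => hΩR w hw.1 (by linarith [hw.2])
  suffices H : μ {x | 26 * R < |x|} = 0 by
    rw [ae_iff]; simpa only [not_le] using H
  refine measure_eq_zero_of_tendsto_im_cauchyTransform
    (isOpen_lt continuous_const continuous_abs) fun x hx => ?_
  have hzx : Tendsto (fun ε : ℝ => (x : ℂ) + ε * Complex.I) (𝓝[>] 0) (𝓝 (x : ℂ)) := by
    refine Tendsto.mono_left ?_ nhdsWithin_le_nhds
    have : Continuous fun ε : ℝ => (x : ℂ) + ε * Complex.I := by fun_prop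
    simpa using this.tendsto 0
  refine tendsto_of_subseq_tendsto fun ε hε => ?_
  have hz := hzx.comp hε
  have hmem : ∀ᶠ n in atTop, (x : ℂ) + ε n * Complex.I ∈ halfExterior (26 * R) := by
    have e1 : ∀ᶠ n in atTop, 0 < ε n := (tendsto_nhdsWithin_iff.1 hε).2
    have e2 : ∀ᶠ n in atTop, 26 * R < ‖(x : ℂ) + ε n * Complex.I‖ :=
      hz.norm.eventually (lt_mem_nhds (by simpa using hx))
    filter_upwards [e1, e2] with n h1 h2
    exact ⟨by simpa using h1, h2⟩
  obtain ⟨N, hN⟩ := eventually_atTop.1 hmem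
  have hex : ∀ n, ∃ w ∈ halfExterior (2 * R), g w = (x : ℂ) + ε (n + N) * Complex.I :=
    fun n => h.halfExterior_subset_image ho hR hΩR (hN (n + N) (by omega))
  choose w hw hgw using hex
  have hz' : Tendsto (fun n => g (w n)) atTop (𝓝 (x : ℂ)) := by
    simp only [hgw]
    exact hz.comp (tendsto_add_atTop_nat N)
  obtain ⟨B, hB⟩ := (Metric.isBounded_range_of_tendsto _ hz').exists_norm_le
  obtain ⟨w₀, -, φ, hφ, hlim⟩ := tendsto_subseq_of_bounded
    (Metric.isBounded_closedBall (x := (0 : ℂ)) (r := B + 24 * R)) (x := w) (fun n => by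
      rw [mem_closedBall_zero_iff]
      have h1 := h.norm_sub_le_const ho hR hΩR (hw n).1 (hw n).2.le
      have h2 := norm_sub_norm_le (w n) (g (w n))
      rw [norm_sub_rev] at h2
      linarith [hB _ (mem_range_self n)])
  have i1 : 0 ≤ w₀.im := ge_of_tendsto' ((Complex.continuous_im.tendsto _).comp hlim)
    fun n => (hw _).1.le
  have i2 : 2 * R ≤ ‖w₀‖ := ge_of_tendsto' hlim.norm fun n => (hw _).2.le
  have i3 : w₀.im = 0 := by
    by_contra hne
    have i4 : 0 < w₀.im := lt_of_le_of_ne i1 (Ne.symm hne)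
    have hwΩ := hΩR w₀ i4 (by linarith)
    have hcont : ContinuousAt g w₀ :=
      (h.differentiableOn.differentiableAt (ho.mem_nhds hwΩ)).continuousAt
    have := tendsto_nhds_unique (hcont.tendsto.comp hlim) (hz'.comp hφ.tendsto_atTop)
    have h0 := h.im_pos w₀ hwΩ
    rw [this] at h0
    simp at h0
  have hw0 : w₀ ≠ 0 := by
    rintro rfl
    simp at i2
    linarith
  refine ⟨fun n => φ n + N, ?_⟩
  have hG : ∀ n, cauchyTransform μ ((x : ℂ) + ε (φ n + N) * Complex.I) = (w (φ n))⁻¹ := by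
    intro n
    rw [← hgw, h.cauchyTransform_apply (hsub (hw _))]
  simp only [hG]
  have h0 : (w₀⁻¹).im = 0 := by simp [Complex.inv_im, i3]
  rw [← h0]
  exact (Complex.continuous_im.tendsto _).comp (hlim.inv₀ hw0)

lemma norm_le (h : IsNormalizedRightInverse Ω μ g) (ho : IsOpen Ω) (hR : 0 < R)
    (hΩR : ∀ w : ℂ, 0 < w.im → R ≤ ‖w‖ → w ∈ Ω) (h0 : Ω ⊆ upperHalf) {w : ℂ} (hw : w ∈ Ω) :
    ‖g w‖ ≤ ‖w‖ + 26 * R := by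
  have := h.isProbabilityMeasure
  by_contra! hlt
  have hpos : 0 < ‖g w‖ - 26 * R := by linarith [norm_nonneg w]
  have hae := ae_sub_le_norm_sub (h.ae_abs_le ho hR hΩR) (g w)
  have hG : ‖cauchyTransform μ (g w)‖ ≤ (‖g w‖ - 26 * R)⁻¹ := by
    have := norm_integral_le_of_norm_le_const (μ := μ)
      (f := fun x : ℝ => (g w - (x : ℂ))⁻¹) (C := (‖g w‖ - 26 * R)⁻¹)
      (by filter_upwards [hae] with x hx
          rw [norm_inv]
          exact inv_anti₀ hpos hx)
    simpa [cauchyTransform] using this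
  have hw0 : w ≠ 0 := by
    rintro rfl
    have := h0 hw
    simp [upperHalf] at this
  rw [h.cauchyTransform_apply hw, norm_inv, inv_le_inv₀ (norm_pos_iff.2 hw0) hpos] at hG
  linarith

lemma integral_eq_zero (h : IsNormalizedRightInverse Ω μ g) (ho : IsOpen Ω) (hR : 0 < R)
    (hΩR : ∀ w : ℂ, 0 < w.im → R ≤ ‖w‖ → w ∈ Ω) : ∫ x, x ∂μ = 0 := by
  have := h.isProbabilityMeasure
  have hF := tendsto_Ftransform_sub_self (h.ae_abs_le ho hR hΩR)
  have hw : Tendsto (fun t : ℝ => (t : ℂ) * Complex.I) atTop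
      (Bornology.cobounded ℂ ⊓ 𝓟 upperHalf) := by
    refine tendsto_inf.2 ⟨?_, ?_⟩
    · rw [← tendsto_norm_atTop_iff_cobounded]
      refine tendsto_id.congr' ?_
      filter_upwards [eventually_ge_atTop 0] with t ht
      simp [abs_of_nonneg ht]
    · rw [tendsto_principal]
      filter_upwards [eventually_gt_atTop 0] with t ht
      simpa [upperHalf] using ht
  have hg := h.tendsto_sub.comp hw
  have hginf : Tendsto (fun t : ℝ => g ((t : ℂ) * Complex.I)) atTop (Bornology.cobounded ℂ) := by
    rw [← tendsto_norm_atTop_iff_cobounded]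
    refine tendsto_atTop_mono' _ ?_ (tendsto_atTop_add_const_right atTop (-1) tendsto_id)
    filter_upwards [hg.norm.eventually_le_const (u := 1) (by simp), eventually_ge_atTop 0]
      with t ht h0
    have h2 := norm_sub_norm_le ((t : ℂ) * Complex.I) (g ((t : ℂ) * Complex.I))
    rw [norm_sub_rev] at h2
    have h3 : ‖(t : ℂ) * Complex.I‖ = t := by simp [abs_of_nonneg h0]
    simp only [Function.comp] at ht
    simp only [id]
    linarith
  have h1 := (hF.comp hginf).add hg
  have h2 : Tendsto (fun _ : ℝ => (0 : ℂ)) atTop (𝓝 (-((∫ x, x ∂μ : ℝ) : ℂ) + 0)) := by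
    refine h1.congr' ?_
    filter_upwards [eventually_ge_atTop R, eventually_gt_atTop 0] with t ht h0
    have := h.Ftransform_apply ((t : ℂ) * Complex.I)
      (hΩR _ (by simpa using h0) (by simpa [abs_of_pos h0] using ht))
    simp only [Function.comp, this]
    ring
  have h3 := tendsto_nhds_unique tendsto_const_nhds h2
  rw [add_zero, eq_comm, neg_eq_zero] at h3
  exact_mod_cast h3

end IsNormalizedRightInverse

lemma tendstoLocallyUniformlyOn_of_im_mem_Icc {ι : Type*} {l : Filter ι} [l.NeBot] {U : Set ℂ}
    {F : ι → ℂ → ℂ} {f : ℂ → ℂ} (ho : IsOpen U) (hd : ∀ n, DifferentiableOn ℂ (F n) U)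
    (him : ∀ n, ∀ w ∈ U, (F n w).im ∈ Icc 0 w.im)
    (hlim : ∀ w ∈ U, Tendsto (fun n => F n w) l (𝓝 (f w))) :
    TendstoLocallyUniformlyOn F f l U := by
  rw [Metric.tendstoLocallyUniformlyOn_iff]
  intro ε hε x hx
  obtain ⟨ρ, hρ, hb⟩ := Metric.isOpen_iff.1 ho x hx
  set r := ρ / 2 with hr
  have hr0 : 0 < r := by positivity
  set M := |x.im| + ρ with hM
  have hM0 : 0 < M := by positivity
  set L := 4 * M / r with hL
  have hL0 : 0 < L := by positivity
  have hlip : ∀ n, ∀ y ∈ Metric.ball x r, ‖F n y - F n x‖ ≤ L * ‖y - x‖ := by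
    intro n y hy
    have hsub : ∀ z ∈ Metric.ball x r, Metric.ball z r ⊆ Metric.ball x ρ := fun z hz =>
      Metric.ball_subset_ball' (by rw [Metric.mem_ball] at hz; linarith)
    refine Convex.norm_image_sub_le_of_norm_deriv_le (s := Metric.ball x r) (fun z hz => ?_)
      (fun z hz => ?_) (convex_ball x r) (Metric.mem_ball_self hr0) hy
    · exact (hd n).differentiableAt (ho.mem_nhds (hb (hsub z hz (Metric.mem_ball_self hr0))))
    · refine norm_deriv_le_of_im_mem_Icc hr0 hM0 ((hd n).mono ((hsub z hz).trans hb)) ?_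
      intro t ht
      have ht' := hsub z hz ht
      refine ⟨(him n t (hb ht')).1, (him n t (hb ht')).2.trans ?_⟩
      rw [Metric.mem_ball, dist_eq_norm] at ht'
      have h1 := Complex.abs_im_le_norm (t - x)
      rw [Complex.sub_im] at h1
      linarith [le_abs_self (t.im - x.im), le_abs_self x.im]
  have hlipf : ∀ y ∈ Metric.ball x r, ‖f y - f x‖ ≤ L * ‖y - x‖ := by
    intro y hy
    have hyU : y ∈ U := hb (Metric.ball_subset_ball (by linarith) hy)
    exact le_of_tendsto' ((hlim y hyU).sub (hlim x hx)).norm fun n => hlip n y hy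
  refine ⟨Metric.ball x (min r (ε / (4 * L))),
    mem_nhdsWithin_of_mem_nhds (Metric.ball_mem_nhds _ (by positivity)), ?_⟩
  filter_upwards [(Metric.tendsto_nhds.1 (hlim x hx)) (ε / 4) (by positivity)] with n hn y hy
  rw [Metric.mem_ball, dist_eq_norm, lt_min_iff] at hy
  have hy2 := (lt_div_iff₀ (by positivity)).1 hy.2
  have hyb : y ∈ Metric.ball x r := by rw [Metric.mem_ball, dist_eq_norm]; exact hy.1
  have h1 := hlip n y hyb
  have h2 := hlipf y hyb
  rw [dist_eq_norm] at hn ⊢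
  have h3 : f y - F n y = (f y - f x) - (F n x - f x) - (F n y - F n x) := by ring
  rw [h3]
  have h4 := norm_sub_le ((f y - f x) - (F n x - f x)) (F n y - F n x)
  have h5 := norm_sub_le (f y - f x) (F n x - f x)
  nlinarith

lemma norm_cauchyTransform_sub_le {μ : Measure ℝ} [IsProbabilityMeasure μ] {z w : ℂ}
    (hz : 0 < z.im) (hw : 0 < w.im) :
    ‖cauchyTransform μ z - cauchyTransform μ w‖ ≤ ‖z - w‖ / (z.im * w.im) := by
  rw [cauchyTransform, cauchyTransform, ← integral_sub (integrable_resolvent hz (ae_im_le_norm z))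
    (integrable_resolvent hw (ae_im_le_norm w))]
  have := norm_integral_le_of_norm_le_const (μ := μ)
    (f := fun x : ℝ => (z - (x : ℂ))⁻¹ - (w - (x : ℂ))⁻¹) (C := ‖z - w‖ / (z.im * w.im)) (by
      filter_upwards [ae_im_le_norm (μ := μ) z, ae_im_le_norm (μ := μ) w] with x h1 h2
      have e1 : z - x ≠ 0 := norm_pos_iff.1 (hz.trans_le h1)
      have e2 : w - x ≠ 0 := norm_pos_iff.1 (hw.trans_le h2)
      rw [inv_sub_inv e1 e2, norm_div, norm_mul]
      have : w - x - (z - x) = -(z - w) := by ring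
      rw [this, norm_neg]
      gcongr)
  simpa using this

lemma tendsto_cauchyTransform {ι : Type*} {l : Filter ι} {P : ι → ProbabilityMeasure ℝ}
    {Q : ProbabilityMeasure ℝ} (h : Tendsto P l (𝓝 Q)) {z : ℂ} (hz : 0 < z.im) :
    Tendsto (fun n => cauchyTransform (P n) z) l (𝓝 (cauchyTransform Q z)) := by
  have hne : ∀ x : ℝ, z - x ≠ 0 := fun x => norm_pos_iff.1
    (hz.trans_le ((le_abs_self _).trans (abs_im_le_norm_sub_ofReal z x)))
  have hc : Continuous fun x : ℝ => (z - (x : ℂ))⁻¹ :=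
    Continuous.inv₀ (by fun_prop) hne
  exact (ProbabilityMeasure.tendsto_iff_forall_integral_rclike_tendsto ℂ).1 h
    (BoundedContinuousFunction.ofNormedAddCommGroup _ hc (z.im)⁻¹ fun x => by
      rw [norm_inv]
      exact inv_anti₀ hz ((le_abs_self _).trans (abs_im_le_norm_sub_ofReal z x)))

lemma exists_tendsto_ultrafilter_of_ae_abs_le {ι : Type*} (l : Ultrafilter ι) {C : ℝ}
    (P : ι → ProbabilityMeasure ℝ) (h : ∀ n, ∀ᵐ x ∂(P n : Measure ℝ), |x| ≤ C) :
    ∃ Q, Tendsto P l (𝓝 Q) := by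
  have hcomp : IsCompact (closure (range P)) := by
    refine isCompact_closure_of_isTightMeasureSet ?_
    rw [isTightMeasureSet_iff_exists_isCompact_measure_compl_le]
    intro ε hε
    refine ⟨Icc (-C) C, isCompact_Icc, ?_⟩
    rintro _ ⟨_, ⟨n, rfl⟩, rfl⟩
    have := h n
    rw [ae_iff] at this
    refine (le_of_eq (Eq.trans ?_ this)).trans hε.le
    congr 1
    ext x
    simp [abs_le]
  obtain ⟨Q, -, hQ⟩ := hcomp.ultrafilter_le_nhds' (l.map P)
    (l.mem_map.2 (Filter.univ_mem' fun n => subset_closure (mem_range_self n)))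
  exact ⟨Q, hQ⟩

namespace IsNormalizedRightInverse

variable {Ω : Set ℂ} {R : ℝ}

lemma exists_limit {μ : ℕ → Measure ℝ} {g : ℕ → ℂ → ℂ}
    (h : ∀ n, IsNormalizedRightInverse Ω (μ n) (g n)) (ho : IsOpen Ω) (hc : IsPreconnected Ω)
    (h0 : Ω ⊆ upperHalf) (hR : 0 < R) (hΩR : ∀ w : ℂ, 0 < w.im → R ≤ ‖w‖ → w ∈ Ω)
    (l : Ultrafilter ℕ) :
    ∃ ν k, IsNormalizedRightInverse Ω ν k ∧
      ∀ w ∈ Ω, Tendsto (fun n => g n w) l (𝓝 (k w)) := by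
  have hex : ∀ w ∈ Ω, ∃ y, Tendsto (fun n => g n w) l (𝓝 y) := by
    intro w hw
    obtain ⟨y, -, hy⟩ := (isCompact_closedBall (0 : ℂ) (‖w‖ + 26 * R)).ultrafilter_le_nhds'
      (l.map fun n => g n w) (l.mem_map.2 (Filter.univ_mem' fun n => by
        simpa using (h n).norm_le ho hR hΩR h0 hw))
    exact ⟨y, hy⟩
  choose! k hk using hex
  let P : ℕ → ProbabilityMeasure ℝ := fun n => ⟨μ n, (h n).isProbabilityMeasure⟩
  obtain ⟨Q, hQ⟩ := exists_tendsto_ultrafilter_of_ae_abs_le l P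
    (fun n => (h n).ae_abs_le ho hR hΩR)
  have hdiff : DifferentiableOn ℂ k Ω :=
    (tendstoLocallyUniformlyOn_of_im_mem_Icc ho (fun n => (h n).differentiableOn)
      (fun n w hw => ⟨((h n).im_pos w hw).le, (h n).im_le hw⟩) hk).differentiableOn
      (Eventually.of_forall fun n => (h n).differentiableOn) ho
  have him0 : ∀ w ∈ Ω, 0 ≤ (k w).im := fun w hw =>
    ge_of_tendsto' ((Complex.continuous_im.tendsto _).comp (hk w hw))
      fun n => ((h n).im_pos w hw).le
  have hest : ∀ w : ℂ, 0 < w.im → 2 * R ≤ ‖w‖ → ‖k w - w‖ ≤ 48 * R ^ 2 / ‖w‖ := by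
    intro w h1 h2
    exact le_of_tendsto' ((hk w (hΩR w h1 (by linarith))).sub_const w).norm
      fun n => (h n).norm_sub_le ho hR hΩR h1 h2
  have hn100 : ‖((100 * R : ℝ) : ℂ) * Complex.I‖ = 100 * R := by
    rw [norm_mul, Complex.norm_real, Complex.norm_I, Real.norm_of_nonneg (by positivity), mul_one]
  have hi100 : (((100 * R : ℝ) : ℂ) * Complex.I).im = 100 * R := by simp
  have hpos : ∀ w ∈ Ω, 0 < (k w).im := by
    refine im_pos_of_im_nonneg hc ho hdiff him0
      (hΩR (((100 * R : ℝ) : ℂ) * Complex.I) (by rw [hi100]; positivity)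
        (by rw [hn100]; linarith)) ?_
    have h1 := hest (((100 * R : ℝ) : ℂ) * Complex.I) (by rw [hi100]; positivity)
      (by rw [hn100]; linarith)
    rw [hn100] at h1
    have h2 : 48 * R ^ 2 / (100 * R) ≤ R := by
      rw [div_le_iff₀ (by positivity)]; nlinarith
    have h3 := (abs_le.1 (Complex.abs_im_le_norm
      (k (((100 * R : ℝ) : ℂ) * Complex.I) - ((100 * R : ℝ) : ℂ) * Complex.I))).1
    rw [Complex.sub_im, hi100] at h3
    linarith
  refine ⟨Q, k, ⟨inferInstance, hdiff, hpos, fun w hw => ?_, ?_⟩, hk⟩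
  · have hG : Tendsto (fun n => cauchyTransform (P n) (g n w)) l
        (𝓝 (cauchyTransform Q (k w))) := by
      have e1 := tendsto_cauchyTransform hQ (hpos w hw)
      have e2 : Tendsto (fun n => cauchyTransform (P n) (g n w) - cauchyTransform (P n) (k w)) l
          (𝓝 0) := by
        refine squeeze_zero_norm (fun n => norm_cauchyTransform_sub_le ((h n).im_pos w hw)
          (hpos w hw)) ?_
        have e3 : Tendsto (fun n => (g n w).im) l (𝓝 (k w).im) :=
          (Complex.continuous_im.tendsto _).comp (hk w hw)
        have e4 := ((hk w hw).sub_const (k w)).norm.div (e3.mul_const (k w).im)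
          (mul_pos (hpos w hw) (hpos w hw)).ne'
        simp only [sub_self, norm_zero, zero_div] at e4
        exact e4
      simpa using e2.add e1
    have hG' : ∀ n, cauchyTransform (P n) (g n w) = w⁻¹ :=
      fun n => (h n).cauchyTransform_apply hw
    simp only [hG'] at hG
    rw [Ftransform, ← tendsto_nhds_unique tendsto_const_nhds hG, inv_inv]
  · have hlim : Tendsto (fun w : ℂ => 48 * R ^ 2 / ‖w‖) (Bornology.cobounded ℂ ⊓ 𝓟 upperHalf)
        (𝓝 0) :=
      (tendsto_const_nhds.div_atTop tendsto_norm_cobounded_atTop).mono_left inf_le_left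
    refine squeeze_zero_norm' ?_ hlim
    have e1 : ∀ᶠ w : ℂ in Bornology.cobounded ℂ ⊓ 𝓟 upperHalf, 2 * R ≤ ‖w‖ :=
      (tendsto_norm_cobounded_atTop.eventually_ge_atTop (2 * R)).filter_mono inf_le_left
    have e2 : ∀ᶠ w : ℂ in Bornology.cobounded ℂ ⊓ 𝓟 upperHalf, 0 < w.im :=
      (eventually_principal.2 fun w hw => hw).filter_mono inf_le_right
    filter_upwards [e1, e2] with w h1 h2
    exact hest w h2 h1

lemma exists_minimizer {μ : Measure ℝ} {g : ℂ → ℂ} (h : IsNormalizedRightInverse Ω μ g)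
    (ho : IsOpen Ω) (hc : IsPreconnected Ω)
    (h0 : Ω ⊆ upperHalf) (hR : 0 < R) (hΩR : ∀ w : ℂ, 0 < w.im → R ≤ ‖w‖ → w ∈ Ω)
    {a : ℂ} (ha : a ∈ Ω) :
    ∃ ν k, IsNormalizedRightInverse Ω ν k ∧
      ∀ ν' k', IsNormalizedRightInverse Ω ν' k' → (k a).im ≤ (k' a).im := by
  let S : Set ℝ := {t | ∃ ν k, IsNormalizedRightInverse Ω ν k ∧ (k a).im = t}
  have hbdd : BddBelow S := ⟨0, by rintro _ ⟨ν, k, hk, rfl⟩; exact (hk.im_pos a ha).le⟩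
  obtain ⟨u, -, hu, huS⟩ := exists_seq_tendsto_sInf (S := S) ⟨_, μ, g, h, rfl⟩ hbdd
  choose ν k hk hku using huS
  obtain ⟨ν', k', hk', hlim⟩ := exists_limit hk ho hc h0 hR hΩR (hyperfilter ℕ)
  refine ⟨ν', k', hk', fun ν'' k'' hk'' => ?_⟩
  have e1 : Tendsto (fun n => (k n a).im) (hyperfilter ℕ : Filter ℕ) (𝓝 (k' a).im) :=
    (Complex.continuous_im.tendsto _).comp (hlim a ha)
  simp only [hku] at e1
  rw [tendsto_nhds_unique e1 (hu.mono_left Nat.hyperfilter_le_atTop)]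
  exact csInf_le hbdd ⟨ν'', k'', hk'', rfl⟩

end IsNormalizedRightInverse

lemma inv_sub_eq_partialFractions {u t σ Δ : ℂ} (hΔ : Δ ^ 2 = t ^ 2 + σ ^ 2) (hu : u ≠ 0)
    (hΔ0 : Δ ≠ 0) (h1 : u - (t + Δ) ≠ 0) (h2 : u - (t - Δ) ≠ 0) :
    (u - σ ^ 2 / u - 2 * t)⁻¹ =
      (t + Δ) / (2 * Δ) * (u - (t + Δ))⁻¹ + (Δ - t) / (2 * Δ) * (u - (t - Δ))⁻¹ := by
  have e : u - σ ^ 2 / u - 2 * t = (u - (t + Δ)) * (u - (t - Δ)) / u := by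
    field_simp
    linear_combination hΔ
  rw [e]
  field_simp
  ring

/-- The monotone convolution of `μ` with a two-point measure, in terms of Cauchy transforms. -/
lemma exists_cauchyTransform_comp (μ : Measure ℝ) [IsProbabilityMeasure μ] (d : ℝ) {σ : ℝ}
    (hσ : 0 < σ) :
    ∃ ν : Measure ℝ, IsProbabilityMeasure ν ∧ ∀ z : ℂ, 0 < z.im →
      cauchyTransform ν z = cauchyTransform μ (z - σ ^ 2 / (z - d)) := by
  let t : ℝ → ℝ := fun x => (x - d) / 2
  let Δ : ℝ → ℝ := fun x => √(t x ^ 2 + σ ^ 2)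
  have hΔsq : ∀ x, Δ x ^ 2 = t x ^ 2 + σ ^ 2 := fun x => Real.sq_sqrt (by positivity)
  have hΔ0 : ∀ x, 0 < Δ x := fun x => Real.sqrt_pos.2 (by positivity)
  have habs : ∀ x, |t x| ≤ Δ x := fun x =>
    abs_le_of_sq_le_sq (by rw [hΔsq]; nlinarith) (hΔ0 x).le
  have hp : ∀ x, 0 ≤ (t x + Δ x) / (2 * Δ x) := fun x =>
    div_nonneg (by linarith [(abs_le.1 (habs x)).1]) (by linarith [hΔ0 x])
  have hq : ∀ x, 0 ≤ (Δ x - t x) / (2 * Δ x) := fun x =>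
    div_nonneg (by linarith [(abs_le.1 (habs x)).2]) (by linarith [hΔ0 x])
  let p : ℝ → NNReal := fun x => ⟨(t x + Δ x) / (2 * Δ x), hp x⟩
  let q : ℝ → NNReal := fun x => ⟨(Δ x - t x) / (2 * Δ x), hq x⟩
  have hpc : ∀ x, ((p x : NNReal) : ℝ) = (t x + Δ x) / (2 * Δ x) := fun x => rfl
  have hqc : ∀ x, ((q x : NNReal) : ℝ) = (Δ x - t x) / (2 * Δ x) := fun x => rfl
  have hpq : ∀ x, p x + q x = 1 := fun x => by
    apply NNReal.eq
    have := (hΔ0 x).ne'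
    rw [NNReal.coe_add, hpc, hqc, NNReal.coe_one]
    field_simp
    ring
  have htm : Measurable t := by fun_prop
  have hΔm : Measurable Δ := by fun_prop
  have hpm : Measurable p := Measurable.subtype_mk (by fun_prop)
  have hqm : Measurable q := Measurable.subtype_mk (by fun_prop)
  let a : ℝ → ℝ := fun x => d + (t x + Δ x)
  let b : ℝ → ℝ := fun x => d + (t x - Δ x)
  have ham : Measurable a := by fun_prop
  have hbm : Measurable b := by fun_prop
  let ν₁ : Measure ℝ := (μ.withDensity fun x => (p x : ENNReal)).map a
  let ν₂ : Measure ℝ := (μ.withDensity fun x => (q x : ENNReal)).map b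
  have hprob : IsProbabilityMeasure (ν₁ + ν₂) := by
    constructor
    rw [Measure.add_apply, Measure.map_apply ham MeasurableSet.univ,
      Measure.map_apply hbm MeasurableSet.univ, preimage_univ, preimage_univ,
      withDensity_apply _ MeasurableSet.univ, withDensity_apply _ MeasurableSet.univ,
      Measure.restrict_univ, ← lintegral_add_left (by fun_prop)]
    have : ∀ x, (p x : ENNReal) + q x = 1 := fun x => by
      rw [← ENNReal.coe_add, hpq, ENNReal.coe_one]
    simp [this]
  refine ⟨ν₁ + ν₂, hprob, fun z hz => ?_⟩
  have hint := integrable_resolvent (μ := ν₁ + ν₂) hz (ae_im_le_norm z)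
  have h1 : ∫ x, (z - (x : ℂ))⁻¹ ∂ν₁ = ∫ x, p x • (z - (a x : ℂ))⁻¹ ∂μ := by
    rw [integral_map ham.aemeasurable (measurable_resolvent z).aestronglyMeasurable,
      integral_withDensity_eq_integral_smul hpm]
  have h2 : ∫ x, (z - (x : ℂ))⁻¹ ∂ν₂ = ∫ x, q x • (z - (b x : ℂ))⁻¹ ∂μ := by
    rw [integral_map hbm.aemeasurable (measurable_resolvent z).aestronglyMeasurable,
      integral_withDensity_eq_integral_smul hqm]
  have hi : ∀ (r : ℝ → NNReal) (c : ℝ → ℝ), Measurable r → Measurable c → (∀ x, r x ≤ 1) →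
      Integrable (fun x => r x • (z - (c x : ℂ))⁻¹) μ := by
    intro r c hr hc hle
    refine Integrable.of_bound (C := (z.im)⁻¹) ?_ (Eventually.of_forall fun x => ?_)
    · exact (hr.smul ((measurable_resolvent z).comp hc)).aestronglyMeasurable
    · rw [NNReal.smul_def, norm_smul, norm_inv]
      have e1 : ‖((r x : NNReal) : ℝ)‖ ≤ 1 := by
        rw [Real.norm_of_nonneg (NNReal.coe_nonneg _)]; exact_mod_cast hle x
      have e2 : ‖z - (c x : ℂ)‖⁻¹ ≤ (z.im)⁻¹ :=
        inv_anti₀ hz ((le_abs_self _).trans (abs_im_le_norm_sub_ofReal z (c x)))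
      calc _ ≤ 1 * (z.im)⁻¹ := by gcongr
        _ = _ := one_mul _
  have hple : ∀ x, p x ≤ 1 := fun x => by rw [← hpq x]; exact le_self_add
  have hqle : ∀ x, q x ≤ 1 := fun x => by rw [← hpq x]; exact le_add_self
  rw [cauchyTransform, integral_add_measure (integrable_add_measure.1 hint).1
    (integrable_add_measure.1 hint).2, h1, h2, ← integral_add (hi p a hpm ham hple)
    (hi q b hqm hbm hqle), cauchyTransform]
  refine integral_congr_ae (Eventually.of_forall fun x => ?_)
  have hne : ∀ c : ℝ, z - c ≠ 0 := fun c => norm_pos_iff.1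
    (hz.trans_le ((le_abs_self _).trans (abs_im_le_norm_sub_ofReal z c)))
  have hΔC : (Δ x : ℂ) ≠ 0 := by exact_mod_cast (hΔ0 x).ne'
  have hΔsqC : (Δ x : ℂ) ^ 2 = (t x : ℂ) ^ 2 + (σ : ℂ) ^ 2 := by exact_mod_cast hΔsq x
  have n1 : z - d - (t x + Δ x) ≠ 0 := by
    have := hne (a x); simp only [a] at this; push_cast at this; rwa [sub_add_eq_sub_sub] at this
  have n2 : z - d - (t x - Δ x) ≠ 0 := by
    have := hne (b x); simp only [b] at this; push_cast at this; rwa [sub_add_eq_sub_sub] at this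
  have key := inv_sub_eq_partialFractions hΔsqC (hne d) hΔC n1 n2
  have e1 : z - σ ^ 2 / (z - d) - x = z - d - σ ^ 2 / (z - d) - 2 * (t x : ℂ) := by
    simp only [t]; push_cast; ring
  have e2 : z - (a x : ℂ) = z - d - (t x + Δ x) := by simp only [a]; push_cast; ring
  have e3 : z - (b x : ℂ) = z - d - (t x - Δ x) := by simp only [b]; push_cast; ring
  change p x • (z - (a x : ℂ))⁻¹ + q x • (z - (b x : ℂ))⁻¹ = (z - σ ^ 2 / (z - d) - x)⁻¹
  rw [e1, key, NNReal.smul_def, NNReal.smul_def, hpc, hqc, e2, e3, Complex.real_smul,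
    Complex.real_smul]
  push_cast
  rfl

lemma differentiableAt_of_sq_eq {s h : ℂ → ℂ} {w : ℂ} (hs : ContinuousAt s w)
    (hh : DifferentiableAt ℂ h w) (hsq : ∀ x, s x ^ 2 = h x) (h0 : s w ≠ 0) :
    DifferentiableAt ℂ s w := by
  have h1 := hasDerivAt_iff_tendsto_slope.1 hh.hasDerivAt
  have hsum : Tendsto (fun x => s x + s w) (𝓝[≠] w) (𝓝 (s w + s w)) :=
    (hs.tendsto.mono_left nhdsWithin_le_nhds).add_const _
  have hne : s w + s w ≠ 0 := by rw [← two_mul]; exact mul_ne_zero two_ne_zero h0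
  have h2 := h1.div hsum hne
  refine (hasDerivAt_iff_tendsto_slope.2 (h2.congr' ?_)).differentiableAt
  filter_upwards [hsum.eventually_ne hne] with x hx
  simp only [slope_def_field, Pi.div_apply, ← hsq]
  field_simp
  ring

namespace IsNormalizedRightInverse

variable {Ω : Set ℂ} {μ : Measure ℝ} {g : ℂ → ℂ} {R : ℝ}

/-- Choice of the branch of `√(u² + 4σ²)` asymptotic to `u` at infinity. -/
lemma exists_sqrt (h : IsNormalizedRightInverse Ω μ g) (ho : IsOpen Ω)
    (hsc : SimplyConnectedSpace Ω) (hR : 0 < R)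
    (hΩR : ∀ w : ℂ, 0 < w.im → R ≤ ‖w‖ → w ∈ Ω) {d σ : ℝ} (hσ : 0 < σ)
    (hmem : ∀ w ∈ Ω, g w ≠ d + 2 * σ * Complex.I) :
    ∃ s : ℂ → ℂ, DifferentiableOn ℂ s Ω ∧ (∀ w, s w ^ 2 = (g w - d) ^ 2 + 4 * σ ^ 2) ∧
      ∃ ρ : ℝ, ∀ w ∈ halfExterior ρ, 4 * σ < ‖g w - d‖ ∧ 0 < (s w / (g w - d)).re := by
  have hne : ∀ w ∈ Ω, (g w - d) ^ 2 + 4 * (σ : ℂ) ^ 2 ≠ 0 := by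
    intro w hw h0
    have e : (g w - d - 2 * σ * Complex.I) * (g w - d + 2 * σ * Complex.I) = 0 := by
      linear_combination h0 - 4 * (σ : ℂ) ^ 2 * Complex.I_sq
    rcases mul_eq_zero.1 e with e | e
    · exact hmem w hw (by linear_combination e)
    · have e1 := congrArg Complex.im e
      have := h.im_pos w hw
      simp at e1
      linarith
  have hdg : DifferentiableOn ℂ (fun w => (g w - d) ^ 2 + 4 * (σ : ℂ) ^ 2) Ω :=
    ((h.differentiableOn.sub_const _).pow 2).add_const _
  obtain ⟨s, hs, hsq⟩ := Complex.exists_continuousOn_pow_eq (U := Ω) hsc ho hdg.continuousOn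
    (by rintro ⟨w, hw, h0⟩; exact hne w hw h0) (n := 2) two_ne_zero
  have hsd : DifferentiableOn ℂ s Ω := fun w hw =>
    (differentiableAt_of_sq_eq (hs.continuousAt (ho.mem_nhds hw))
      (hdg.differentiableAt (ho.mem_nhds hw)) hsq
      (fun h0 => hne w hw (by rw [← hsq w, h0]; simp))).differentiableWithinAt
  set ρ : ℝ := 26 * R + |d| + 4 * σ with hρ
  have hρ0 : 0 < ρ := by positivity
  have hρR : ∀ w ∈ halfExterior ρ, 2 * R ≤ ‖w‖ ∧ w ∈ Ω := fun w hw => by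
    have : 2 * R ≤ ‖w‖ := by linarith [hw.2, abs_nonneg d]
    exact ⟨this, hΩR w hw.1 (by linarith)⟩
  have hu : ∀ w ∈ halfExterior ρ, 4 * σ < ‖g w - d‖ := by
    intro w hw
    have h1 := h.norm_sub_le_const ho hR hΩR hw.1 (hρR w hw).1
    have h2 : ‖w‖ ≤ ‖g w - d‖ + ‖(d : ℂ)‖ + ‖g w - w‖ := by
      have : w = (g w - d) + d - (g w - w) := by ring
      calc ‖w‖ = ‖(g w - d) + d - (g w - w)‖ := by rw [← this]
        _ ≤ _ := (_root_.norm_sub_le _ _).trans (by gcongr; exact norm_add_le _ _)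
    rw [Complex.norm_real, Real.norm_eq_abs] at h2
    linarith [hw.2]
  have hu0 : ∀ w ∈ halfExterior ρ, g w - d ≠ 0 := fun w hw =>
    norm_pos_iff.1 (by linarith [hu w hw])
  have hre : ∀ w ∈ halfExterior ρ, (s w / (g w - d)).re ≠ 0 := by
    intro w hw h0
    set c := s w / (g w - d) with hc
    have e1 : c ^ 2 = 1 + 4 * σ ^ 2 / (g w - d) ^ 2 := by
      have := hu0 w hw
      rw [hc, div_pow, hsq]
      field_simp
    have e2 : (c ^ 2).re ≤ 0 := by
      rw [sq, Complex.mul_re, h0]; nlinarith [sq_nonneg c.im]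
    have e3 : ‖4 * (σ : ℂ) ^ 2 / (g w - d) ^ 2‖ < 1 := by
      rw [norm_div, norm_mul, norm_pow, norm_pow, Complex.norm_real, Real.norm_of_nonneg hσ.le,
        div_lt_one (pow_pos (by linarith [hu w hw]) 2)]
      simp only [Complex.norm_ofNat]
      nlinarith [hu w hw]
    have e4 := (abs_lt.1 ((Complex.abs_re_le_norm _).trans_lt e3)).1
    rw [e1, Complex.add_re, Complex.one_re] at e2
    linarith
  have hcont : ContinuousOn (fun w => (s w / (g w - d)).re) (halfExterior ρ) :=
    Complex.continuous_re.comp_continuousOn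
      ((hs.mono fun w hw => (hρR w hw).2).div
        ((h.differentiableOn.continuousOn.mono fun w hw => (hρR w hw).2).sub continuousOn_const)
        hu0)
  have hsign : (∀ w ∈ halfExterior ρ, 0 < (s w / (g w - d)).re) ∨
      ∀ w ∈ halfExterior ρ, (s w / (g w - d)).re < 0 := by
    by_contra! hcon
    obtain ⟨⟨w₁, hw₁, hle⟩, w₂, hw₂, hge⟩ := hcon
    obtain ⟨w, hw, h0⟩ := (isPreconnected_halfExterior hρ0).intermediate_value hw₁ hw₂ hcont
      ⟨hle, hge⟩
    exact hre w hw h0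
  rcases hsign with hpos | hneg
  · exact ⟨s, hsd, hsq, ρ, fun w hw => ⟨hu w hw, hpos w hw⟩⟩
  · refine ⟨fun w => -s w, hsd.neg, fun w => by rw [neg_sq, hsq], ρ, fun w hw => ⟨hu w hw, ?_⟩⟩
    rw [neg_div, Complex.neg_re]
    linarith [hneg w hw]

lemma tendsto_norm_sub_ofReal (h : IsNormalizedRightInverse Ω μ g) (d : ℝ) :
    Tendsto (fun w => ‖g w - d‖) (Bornology.cobounded ℂ ⊓ 𝓟 upperHalf) atTop := by
  have e1 : ∀ᶠ w in Bornology.cobounded ℂ ⊓ 𝓟 upperHalf, ‖g w - w‖ ≤ 1 :=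
    h.tendsto_sub.norm.eventually_le_const (u := 1) (by simp)
  have e2 : Tendsto (fun w : ℂ => ‖w‖ + (-1 - |d|)) (Bornology.cobounded ℂ ⊓ 𝓟 upperHalf) atTop :=
    tendsto_atTop_add_const_right _ _ (tendsto_norm_cobounded_atTop.mono_left inf_le_left)
  refine tendsto_atTop_mono' _ ?_ e2
  filter_upwards [e1] with w hw
  have h2 : ‖w‖ ≤ ‖g w - d‖ + ‖(d : ℂ)‖ + ‖g w - w‖ := by
    have : w = (g w - d) + d - (g w - w) := by ring
    calc ‖w‖ = ‖(g w - d) + d - (g w - w)‖ := by rw [← this]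
      _ ≤ _ := (_root_.norm_sub_le _ _).trans (by gcongr; exact norm_add_le _ _)
  rw [Complex.norm_real, Real.norm_eq_abs] at h2
  linarith

/-- If `g` omits a point of the upper half-plane, then its imaginary part can be decreased. -/
lemma exists_im_lt (h : IsNormalizedRightInverse Ω μ g) (ho : IsOpen Ω)
    (hsc : SimplyConnectedSpace Ω) (hR : 0 < R)
    (hΩR : ∀ w : ℂ, 0 < w.im → R ≤ ‖w‖ → w ∈ Ω) {c : ℂ} (hc : 0 < c.im)
    (hmem : c ∉ g '' Ω) :
    ∃ ν k, IsNormalizedRightInverse Ω ν k ∧ ∀ w ∈ Ω, (k w).im < (g w).im := by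
  have := h.isProbabilityMeasure
  set d : ℝ := c.re with hd
  set σ : ℝ := c.im / 2 with hσd
  have hσ : 0 < σ := by positivity
  obtain ⟨s, hsd, hsq, ρ, hρ⟩ := h.exists_sqrt ho hsc hR hΩR (d := d) hσ (fun w hw heq => by
    refine hmem ⟨w, hw, heq.trans ?_⟩
    apply Complex.ext <;> simp [hd, hσd, mul_div_cancel₀])
  obtain ⟨ν, hν, hG⟩ := exists_cauchyTransform_comp μ d hσ
  have hσC : (σ : ℂ) ≠ 0 := by exact_mod_cast hσ.ne'
  let y : ℂ → ℂ := fun w => (g w - d + s w) / 2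
  have hy0 : ∀ w, y w ≠ 0 := by
    intro w h0
    have : y w * (g w - d - s w) = -2 * (σ : ℂ) ^ 2 := by
      simp only [y]; linear_combination -(1 / 2 : ℂ) * hsq w
    rw [h0, zero_mul] at this
    have h2 : (σ : ℂ) ^ 2 ≠ 0 := pow_ne_zero 2 hσC
    exact h2 (by linear_combination (1 / 2 : ℂ) * this)
  have hyu : ∀ w, y w - σ ^ 2 / y w = g w - d := by
    intro w
    have := hy0 w
    field_simp
    simp only [y]
    linear_combination (1 / 4 : ℂ) * hsq w
  have him : ∀ w, (y w).im * (1 + σ ^ 2 / Complex.normSq (y w)) = (g w).im := by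
    intro w
    have h1 := congrArg Complex.im (hyu w)
    have h2 : ((σ : ℂ) ^ 2 / y w).im = -(σ ^ 2 * (y w).im / Complex.normSq (y w)) := by
      rw [← Complex.ofReal_pow, div_eq_mul_inv, Complex.im_ofReal_mul, Complex.inv_im]
      ring
    rw [Complex.sub_im, h2, Complex.sub_im, Complex.ofReal_im] at h1
    linear_combination h1
  have hfac : ∀ w, 0 < σ ^ 2 / Complex.normSq (y w) := fun w =>
    div_pos (by positivity) (Complex.normSq_pos.2 (hy0 w))
  have hypos : ∀ w ∈ Ω, 0 < (y w).im := by
    intro w hw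
    have h1 := h.im_pos w hw
    rw [← him w] at h1
    exact pos_of_mul_pos_left h1 (by linarith [hfac w])
  refine ⟨ν, fun w => d + y w, ⟨hν, ?_, ?_, ?_, ?_⟩, ?_⟩
  · exact (((h.differentiableOn.sub_const _).add hsd).div_const 2).const_add _
  · intro w hw
    simpa using hypos w hw
  · intro w hw
    have h1 : 0 < ((d : ℂ) + y w).im := by simpa using hypos w hw
    have h2 : (d : ℂ) + y w - σ ^ 2 / (d + y w - d) = g w := by
      rw [add_sub_cancel_left]; linear_combination hyu w
    rw [Ftransform, hG _ h1, h2]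
    exact h.Ftransform_apply w hw
  · have hlim : Tendsto (fun w => 2 * σ ^ 2 / ‖g w - d‖) (Bornology.cobounded ℂ ⊓ 𝓟 upperHalf)
        (𝓝 0) := tendsto_const_nhds.div_atTop (h.tendsto_norm_sub_ofReal d)
    have hyg : Tendsto (fun w => d + y w - g w) (Bornology.cobounded ℂ ⊓ 𝓟 upperHalf) (𝓝 0) := by
      refine squeeze_zero_norm' ?_ hlim
      have e1 : ∀ᶠ w : ℂ in Bornology.cobounded ℂ ⊓ 𝓟 upperHalf, ρ < ‖w‖ :=
        (tendsto_norm_cobounded_atTop.eventually_gt_atTop ρ).filter_mono inf_le_left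
      have e2 : ∀ᶠ w : ℂ in Bornology.cobounded ℂ ⊓ 𝓟 upperHalf, 0 < w.im :=
        (eventually_principal.2 fun w hw => hw).filter_mono inf_le_right
      filter_upwards [e1, e2] with w h1 h2
      obtain ⟨i1, i2⟩ := hρ w ⟨h2, h1⟩
      have hu0 : g w - d ≠ 0 := norm_pos_iff.1 (by linarith)
      have i3 : d + y w - g w = 2 * σ ^ 2 / (2 * y w) := by
        have := hy0 w
        have := hyu w
        rw [mul_div_mul_left _ _ two_ne_zero]
        linear_combination this
      have i4 : ‖g w - d‖ ≤ ‖2 * y w‖ := by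
        have : 2 * y w = (g w - d) * (1 + s w / (g w - d)) := by
          simp only [y]; field_simp
        rw [this, norm_mul]
        refine le_mul_of_one_le_right (norm_nonneg _) ?_
        refine le_trans ?_ (Complex.re_le_norm _)
        rw [Complex.add_re, Complex.one_re]
        linarith
      rw [i3, norm_div]
      have i5 : ‖2 * (σ : ℂ) ^ 2‖ = 2 * σ ^ 2 := by
        rw [norm_mul, norm_pow, Complex.norm_real, Real.norm_of_nonneg hσ.le]; simp
      rw [i5]
      have : 0 < ‖g w - d‖ := norm_pos_iff.2 hu0
      gcongr
    have := hyg.add h.tendsto_sub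
    rw [add_zero] at this
    refine this.congr fun w => by ring
  · intro w hw
    have h1 : ((d : ℂ) + y w).im = (y w).im := by simp
    simp only [h1]
    rw [← him w]
    nlinarith [mul_pos (hypos w hw) (hfac w)]

end IsNormalizedRightInverse

section Moments

variable {μ : Measure ℝ} [IsProbabilityMeasure μ] {C : ℝ}

lemma integrable_ofReal_pow (hμ : ∀ᵐ x ∂μ, |x| ≤ C) (n : ℕ) :
    Integrable (fun x : ℝ => (x : ℂ) ^ n) μ := by
  refine Integrable.of_bound (C := C ^ n) (by fun_prop) ?_
  filter_upwards [hμ] with x hx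
  rw [norm_pow, Complex.norm_real, Real.norm_eq_abs]
  gcongr

lemma integrable_pow_mul_resolvent (hμ : ∀ᵐ x ∂μ, |x| ≤ C) (n : ℕ) {z : ℂ} (hz : 0 < z.im) :
    Integrable (fun x : ℝ => (x : ℂ) ^ n * (z - x)⁻¹) μ := by
  refine (integrable_resolvent hz (ae_im_le_norm z)).bdd_mul (c := C ^ n) (by fun_prop) ?_
  filter_upwards [hμ] with x hx
  rw [norm_pow, Complex.norm_real, Real.norm_eq_abs]
  gcongr

lemma integral_pow_succ_mul_resolvent (hμ : ∀ᵐ x ∂μ, |x| ≤ C) (n : ℕ) {z : ℂ} (hz : 0 < z.im) :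
    ∫ x : ℝ, (x : ℂ) ^ (n + 1) * (z - x)⁻¹ ∂μ =
      z * ∫ x : ℝ, (x : ℂ) ^ n * (z - x)⁻¹ ∂μ - ∫ x : ℝ, (x : ℂ) ^ n ∂μ := by
  rw [← integral_const_mul, ← integral_sub ((integrable_pow_mul_resolvent hμ n hz).const_mul z)
    (integrable_ofReal_pow hμ n)]
  refine integral_congr_ae (Eventually.of_forall fun x => ?_)
  have : z - x ≠ 0 := norm_pos_iff.1
    (hz.trans_le ((le_abs_self _).trans (abs_im_le_norm_sub_ofReal z x)))
  simp only
  field_simp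
  ring

lemma tendsto_mul_integral_pow_mul_resolvent (hμ : ∀ᵐ x ∂μ, |x| ≤ C) (n : ℕ) :
    Tendsto (fun y : ℝ => ((y : ℂ) * Complex.I) *
      ∫ x : ℝ, (x : ℂ) ^ n * ((y : ℂ) * Complex.I - x)⁻¹ ∂μ) atTop
      (𝓝 (∫ x : ℝ, (x : ℂ) ^ n ∂μ)) := by
  simp_rw [← integral_const_mul]
  refine tendsto_integral_filter_of_dominated_convergence (fun _ => C ^ n)
    (Eventually.of_forall fun y => Measurable.aestronglyMeasurable (by fun_prop)) ?_
    (integrable_const _) (Eventually.of_forall fun x => ?_)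
  · filter_upwards [eventually_gt_atTop 0] with y hy
    filter_upwards [hμ] with x hx
    have h1 : ‖(y : ℂ) * Complex.I‖ = y := by simp [abs_of_pos hy]
    have h2 : y ≤ ‖(y : ℂ) * Complex.I - x‖ := by
      have := (le_abs_self _).trans (abs_im_le_norm_sub_ofReal ((y : ℂ) * Complex.I) x)
      simpa using this
    have h3 : ‖(y : ℂ) * Complex.I‖ * ‖(y : ℂ) * Complex.I - x‖⁻¹ ≤ 1 := by
      rw [h1, ← div_eq_mul_inv]
      exact div_le_one_of_le₀ h2 (norm_nonneg _)
    have h4 : |x| ^ n ≤ C ^ n := by gcongr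
    rw [norm_mul, norm_mul ((x : ℂ) ^ n), norm_pow, Complex.norm_real, Real.norm_eq_abs, norm_inv,
      mul_left_comm]
    calc |x| ^ n * (‖(y : ℂ) * Complex.I‖ * ‖(y : ℂ) * Complex.I - x‖⁻¹) ≤ |x| ^ n * 1 := by gcongr
      _ ≤ C ^ n := by rw [mul_one]; exact h4
  · have h1 : Tendsto (fun y : ℝ => (x : ℂ) ^ n * (1 - (x : ℂ) * ((y : ℂ) * Complex.I)⁻¹)⁻¹) atTop
        (𝓝 ((x : ℂ) ^ n * (1 - (x : ℂ) * 0)⁻¹)) := by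
      have h2 : Tendsto (fun y : ℝ => ((y : ℂ) * Complex.I)⁻¹) atTop (𝓝 0) := by
        rw [tendsto_zero_iff_norm_tendsto_zero]
        refine tendsto_inv_atTop_zero.congr' ?_
        filter_upwards [eventually_gt_atTop 0] with y hy
        simp [abs_of_pos hy]
      refine Tendsto.const_mul _ (Tendsto.inv₀ (tendsto_const_nhds.sub (h2.const_mul _)) (by simp))
    simp only [mul_zero, sub_zero, inv_one, mul_one] at h1
    refine h1.congr' ?_
    filter_upwards [eventually_gt_atTop 0] with y hy
    have hy0 : (y : ℂ) * Complex.I ≠ 0 :=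
      mul_ne_zero (by exact_mod_cast hy.ne') Complex.I_ne_zero
    have e : 1 - (x : ℂ) * ((y : ℂ) * Complex.I)⁻¹ =
        ((y : ℂ) * Complex.I - x) * ((y : ℂ) * Complex.I)⁻¹ := by
      rw [sub_mul, mul_inv_cancel₀ hy0]
    rw [e, mul_inv, inv_inv]
    ring

lemma hasSum_charFun (hμ : ∀ᵐ x ∂μ, |x| ≤ C) (t : ℝ) :
    HasSum (fun n : ℕ => ((t : ℂ) * Complex.I) ^ n / (n.factorial : ℂ) * ∫ x : ℝ, (x : ℂ) ^ n ∂μ)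
      (charFun μ t) := by
  have hint : ∀ n : ℕ, Integrable
      (fun x : ℝ => ((t : ℂ) * Complex.I) ^ n / (n.factorial : ℂ) * (x : ℂ) ^ n) μ :=
    fun n => (integrable_ofReal_pow hμ n).const_mul _
  have hsum : Summable fun n : ℕ =>
      ∫ x : ℝ, ‖((t : ℂ) * Complex.I) ^ n / (n.factorial : ℂ) * (x : ℂ) ^ n‖ ∂μ := by
    refine Summable.of_nonneg_of_le (fun n => integral_nonneg fun x => norm_nonneg _) (fun n => ?_)
      (Real.summable_pow_div_factorial (|t| * C))
    have : ∫ x : ℝ, ‖((t : ℂ) * Complex.I) ^ n / (n.factorial : ℂ) * (x : ℂ) ^ n‖ ∂μ ≤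
        ∫ x : ℝ, (|t| * C) ^ n / n.factorial ∂μ := by
      refine integral_mono_ae (hint n).norm (integrable_const _) ?_
      filter_upwards [hμ] with x hx
      simp only [norm_mul, norm_div, norm_pow, Complex.norm_real, Complex.norm_I, mul_one,
        Complex.norm_natCast, Real.norm_eq_abs]
      rw [mul_pow, div_mul_eq_mul_div]
      gcongr
    simpa using this
  have h := hasSum_integral_of_summable_integral_norm hint hsum
  simp only [integral_const_mul] at h
  have e : charFun μ t = ∫ x : ℝ,
      ∑' n : ℕ, ((t : ℂ) * Complex.I) ^ n / (n.factorial : ℂ) * (x : ℂ) ^ n ∂μ := by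
    rw [charFun_apply_real]
    refine integral_congr_ae (Eventually.of_forall fun x => ?_)
    simp only
    rw [Complex.exp_eq_exp_ℂ,
      ← (NormedSpace.expSeries_div_hasSum_exp ((t : ℂ) * x * Complex.I)).tsum_eq]
    refine tsum_congr fun n => ?_
    ring
  rw [e]
  exact h

end Moments

/-- A compactly supported probability measure is determined by its Cauchy transform. -/
lemma measure_ext_of_cauchyTransform {μ ν : Measure ℝ} [IsProbabilityMeasure μ]
    [IsProbabilityMeasure ν] {C D : ℝ} (hμ : ∀ᵐ x ∂μ, |x| ≤ C) (hν : ∀ᵐ x ∂ν, |x| ≤ D)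
    (h : ∀ z : ℂ, 0 < z.im → cauchyTransform μ z = cauchyTransform ν z) : μ = ν := by
  have hlim : ∀ n : ℕ, (∀ z : ℂ, 0 < z.im →
      ∫ x : ℝ, (x : ℂ) ^ n * (z - x)⁻¹ ∂μ = ∫ x : ℝ, (x : ℂ) ^ n * (z - x)⁻¹ ∂ν) →
      ∫ x : ℝ, (x : ℂ) ^ n ∂μ = ∫ x : ℝ, (x : ℂ) ^ n ∂ν := by
    intro n hn
    refine tendsto_nhds_unique ((tendsto_mul_integral_pow_mul_resolvent hμ n).congr' ?_)
      (tendsto_mul_integral_pow_mul_resolvent hν n)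
    filter_upwards [eventually_gt_atTop 0] with y hy
    rw [hn _ (by simpa using hy)]
  have hres : ∀ n : ℕ, ∀ z : ℂ, 0 < z.im →
      ∫ x : ℝ, (x : ℂ) ^ n * (z - x)⁻¹ ∂μ = ∫ x : ℝ, (x : ℂ) ^ n * (z - x)⁻¹ ∂ν := by
    intro n
    induction n with
    | zero => intro z hz; simpa [cauchyTransform] using h z hz
    | succ n ih =>
      intro z hz
      rw [integral_pow_succ_mul_resolvent hμ n hz, integral_pow_succ_mul_resolvent hν n hz,
        ih z hz, hlim n ih]
  refine Measure.ext_of_charFun (funext fun t => ?_)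
  refine (hasSum_charFun hμ t).unique ?_
  simpa only [hlim _ (hres _)] using hasSum_charFun hν t

lemma isNormalizedRightInverse_dirac {Ω : Set ℂ} (h0 : Ω ⊆ upperHalf) :
    IsNormalizedRightInverse Ω (Measure.dirac 0) id where
  isProbabilityMeasure := inferInstance
  differentiableOn := differentiableOn_id
  im_pos w hw := h0 hw
  Ftransform_apply w _ := by simp [Ftransform, cauchyTransform]
  tendsto_sub := by simpa using tendsto_const_nhds

lemma exists_isNormalizedRightInverse_image_eq {Ω : Set ℂ} {R : ℝ} (ho : IsOpen Ω)
    (hc : IsConnected Ω) (hsc : SimplyConnectedSpace Ω) (h0 : Ω ⊆ upperHalf) (hR : 0 < R)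
    (hΩR : ∀ w : ℂ, 0 < w.im → R ≤ ‖w‖ → w ∈ Ω) :
    ∃ μ g, IsNormalizedRightInverse Ω μ g ∧ g '' Ω = upperHalf := by
  obtain ⟨a, ha⟩ := hc.nonempty
  obtain ⟨μ, g, hg, hmin⟩ := (isNormalizedRightInverse_dirac h0).exists_minimizer ho
    hc.isPreconnected h0 hR hΩR ha
  refine ⟨μ, g, hg, Subset.antisymm (image_subset_iff.2 fun w hw => hg.im_pos w hw) ?_⟩
  intro c hc
  by_contra hmem
  obtain ⟨ν, k, hk, hlt⟩ := hg.exists_im_lt ho hsc hR hΩR hc hmem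
  exact (hmin ν k hk).not_gt (hlt a ha)

lemma exists_forall_cobounded {p : ℂ → Prop} (h : ∀ᶠ z in Bornology.cobounded ℂ, p z) :
    ∃ B > 0, ∀ z : ℂ, B ≤ ‖z‖ → p z := by
  rw [← comap_norm_atTop, eventually_comap] at h
  obtain ⟨B, hB⟩ := eventually_atTop.1 h
  exact ⟨max B 1, by positivity, fun z hz => hB ‖z‖ ((le_max_left _ _).trans hz) z rfl⟩

/-- Near infinity, every point of the upper half-plane has an `F`-preimage close to it. -/
lemma exists_Ftransform_eq {ν : Measure ℝ} [IsProbabilityMeasure ν] {C : ℝ}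
    (hν : ∀ᵐ x ∂ν, |x| ≤ C) (hm : ∫ x, x ∂ν = 0) :
    ∃ B > 0, ∀ w : ℂ, 0 < w.im → B ≤ ‖w‖ →
      ∃ z, 0 < z.im ∧ ‖z - w‖ ≤ 4 ∧ Ftransform ν z = w := by
  have hF := tendsto_Ftransform_sub_self hν
  rw [hm, Complex.ofReal_zero, neg_zero] at hF
  obtain ⟨B, hB0, hB⟩ := exists_forall_cobounded
    ((hF.norm.eventually_le_const (u := 1 / 4) (by simp)).and
      (eventually_differentiableAt_Ftransform hν))
  refine ⟨B + |C| + 10, by positivity, fun w hw hwB => ?_⟩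
  have hball : ∀ z ∈ Metric.ball w 5, B ≤ ‖z‖ ∧ |C| + 1 ≤ ‖z‖ := by
    intro z hz
    rw [mem_ball_iff_norm, norm_sub_rev] at hz
    have := norm_sub_norm_le w z
    constructor <;> linarith [abs_nonneg C]
  have hd : DifferentiableOn ℂ (Ftransform ν) (Metric.ball w 5) := fun z hz =>
    (hB z (hball z hz).1).2.differentiableWithinAt
  have hcl : Metric.closedBall w 4 ⊆ Metric.ball w 5 :=
    Metric.closedBall_subset_ball (by norm_num)
  have hw5 : w ∈ Metric.ball w 5 := Metric.mem_ball_self (by norm_num)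
  have hsph : ∀ z ∈ Metric.sphere w 4, (7 / 2 : ℝ) ≤ ‖Ftransform ν z - Ftransform ν w‖ := by
    intro z hz
    have h1 := (hB z (hball z (hcl (Metric.sphere_subset_closedBall hz))).1).1
    have h2 := (hB w (hball w hw5).1).1
    rw [mem_sphere_iff_norm] at hz
    have h3 : z - w = (Ftransform ν z - Ftransform ν w) - (Ftransform ν z - z)
        + (Ftransform ν w - w) := by ring
    have h4 : ‖z - w‖ ≤ ‖Ftransform ν z - Ftransform ν w‖ + ‖Ftransform ν z - z‖
        + ‖Ftransform ν w - w‖ := by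
      calc ‖z - w‖ = _ := congrArg _ h3
        _ ≤ _ := (norm_add_le _ _).trans (by gcongr; exact norm_sub_le _ _)
    linarith
  have hfreq : ∃ᶠ z in 𝓝 w, Ftransform ν z ≠ Ftransform ν w := by
    intro hcon
    simp only [not_not] at hcon
    have heq := (hd.analyticOnNhd Metric.isOpen_ball).eqOn_of_preconnected_of_eventuallyEq
      (g := fun _ => Ftransform ν w) analyticOnNhd_const
      (convex_ball w 5).isPreconnected hw5 hcon
    have hmem : w + 4 ∈ Metric.sphere w 4 := by simp
    have := hsph _ hmem
    rw [heq (hcl (Metric.sphere_subset_closedBall hmem))] at this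
    norm_num at this
  have hdc : DiffContOnCl ℂ (Ftransform ν) (Metric.ball w 4) := by
    refine DifferentiableOn.diffContOnCl ?_
    rw [closure_ball w (by norm_num)]
    exact hd.mono hcl
  obtain ⟨z, hz, hzw⟩ := hdc.ball_subset_image_closedBall (by norm_num) hsph hfreq
    (show w ∈ Metric.ball (Ftransform ν w) (7 / 2 / 2) by
      rw [mem_ball_iff_norm, norm_sub_rev]
      linarith [(hB w (hball w hw5).1).1])
  refine ⟨z, ?_, by simpa [dist_eq_norm] using hz, hzw⟩
  by_contra! hneg
  have h1 : (Ftransform ν z).im ≤ 0 := by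
    refine im_Ftransform_nonpos (r := 1) one_pos ?_ hneg
    filter_upwards [ae_sub_le_norm_sub hν z] with x hx
    linarith [(hball z (hcl hz)).2, le_abs_self C]
  rw [hzw] at h1
  linarith

lemma isCompact_setOf_im_ge_norm_le (ε B : ℝ) : IsCompact {z : ℂ | ε ≤ z.im ∧ ‖z‖ ≤ B} := by
  refine Metric.isCompact_of_isClosed_isBounded
    ((isClosed_le continuous_const Complex.continuous_im).inter
      (isClosed_le continuous_norm continuous_const)) ?_
  exact Metric.isBounded_closedBall (x := (0 : ℂ)) (r := B) |>.subset fun z hz => by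
    simpa using hz.2

lemma isPreconnected_upperHalf : IsPreconnected upperHalf :=
  (convex_halfSpace_im_gt 0).isPreconnected

/-- A conformal automorphism of the upper half-plane asymptotic to the identity is the identity. -/
lemma eqOn_id_of_tendsto_sub {φ : ℂ → ℂ} (hd : DifferentiableOn ℂ φ upperHalf)
    (hinj : InjOn φ upperHalf) (himg : φ '' upperHalf = upperHalf)
    (hlim : Tendsto (fun z => φ z - z) (Bornology.cobounded ℂ ⊓ 𝓟 upperHalf) (𝓝 0))
    (hbdd : ∀ B : ℝ, ∃ B', ∀ z ∈ upperHalf, ‖z‖ ≤ B → ‖φ z‖ ≤ B') : EqOn φ id upperHalf := by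
  have hpos : ∀ z ∈ upperHalf, 0 < (φ z).im := fun z hz =>
    (himg ▸ mem_image_of_mem φ hz : φ z ∈ upperHalf)
  have hfar : ∀ ε > 0, ∃ B, ∀ z ∈ upperHalf, B ≤ ‖z‖ → ‖φ z - z‖ < ε := by
    intro ε hε
    have h1 := (Metric.tendsto_nhds.1 hlim) ε hε
    rw [eventually_inf_principal] at h1
    obtain ⟨B, -, hB⟩ := exists_forall_cobounded h1
    exact ⟨B, fun z hz hzB => by simpa using hB z hzB hz⟩
  have hopen : ∀ s ⊆ upperHalf, IsOpen s → IsOpen (φ '' s) := by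
    rcases (hd.analyticOnNhd isOpen_upperHalf).is_constant_or_isOpen isPreconnected_upperHalf with
      ⟨c, hc⟩ | h
    · exfalso
      have h1 : Complex.I ∈ upperHalf := by simp
      have h2 : 2 * Complex.I ∈ upperHalf := by simp
      have := congrArg Complex.im (hinj h1 h2 ((hc _ h1).trans (hc _ h2).symm))
      norm_num at this
    · exact h
  let ψ := Function.invFunOn φ upperHalf
  have hψmem : ∀ y ∈ upperHalf, ψ y ∈ upperHalf ∧ φ (ψ y) = y := by
    intro y hy
    rw [← himg] at hy
    exact ⟨Function.invFunOn_mem hy, Function.invFunOn_eq hy⟩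
  have hψφ : ∀ z ∈ upperHalf, ψ (φ z) = z := fun z hz =>
    hinj (hψmem _ (hpos z hz)).1 hz (hψmem _ (hpos z hz)).2
  have hψc : ContinuousOn ψ upperHalf := by
    rw [continuousOn_open_iff isOpen_upperHalf]
    intro t ht
    have : upperHalf ∩ ψ ⁻¹' t = φ '' (upperHalf ∩ t) := by
      ext y
      constructor
      · rintro ⟨hy, hyt⟩
        exact ⟨ψ y, ⟨(hψmem y hy).1, hyt⟩, (hψmem y hy).2⟩
      · rintro ⟨z, ⟨hz, hzt⟩, rfl⟩
        exact ⟨hpos z hz, by rw [mem_preimage, hψφ z hz]; exact hzt⟩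
    rw [this]
    exact hopen _ inter_subset_left (isOpen_upperHalf.inter ht)
  have hcompact : ∀ (f : ℂ → ℂ) (ε : ℝ) (K : Set ℂ), ContinuousOn f upperHalf → IsCompact K →
      K ⊆ upperHalf → {z ∈ upperHalf | ε ≤ (f z).im} ⊆ K →
      IsCompact {z ∈ upperHalf | ε ≤ (f z).im} := by
    intro f ε K hf hK hKU hsub
    have : {z ∈ upperHalf | ε ≤ (f z).im} = K ∩ f ⁻¹' {z | ε ≤ z.im} := by
      ext z
      exact ⟨fun hz => ⟨hsub hz, hz.2⟩, fun hz => ⟨hKU hz.1, hz.2⟩⟩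
    rw [this]
    exact hK.of_isClosed_subset ((hf.mono hKU).preimage_isClosed_of_isClosed hK.isClosed
      (isClosed_le continuous_const Complex.continuous_im)) inter_subset_left
  have hle : ∀ z ∈ upperHalf, (z - φ z).im ≤ 0 := by
    refine im_nonpos_of_isCompact_superlevel isPreconnected_upperHalf isOpen_upperHalf
      (differentiableOn_id.sub hd) fun ε hε => ?_
    obtain ⟨B, hB⟩ := hfar ε hε
    refine hcompact _ ε _ (continuousOn_id.sub hd.continuousOn)
      (isCompact_setOf_im_ge_norm_le ε B) (fun z hz => hε.trans_le hz.1) ?_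
    rintro z ⟨hz, hzε⟩
    have h1 := hpos z hz
    rw [Complex.sub_im] at hzε
    refine ⟨by linarith, ?_⟩
    by_contra! hlt
    have h2 := hB z hz hlt.le
    have h3 := (abs_le.1 (Complex.abs_im_le_norm (φ z - z))).1
    rw [Complex.sub_im] at h3
    linarith
  have hge : ∀ z ∈ upperHalf, (φ z - z).im ≤ 0 := by
    refine im_nonpos_of_isCompact_superlevel isPreconnected_upperHalf isOpen_upperHalf
      (hd.sub differentiableOn_id) fun ε hε => ?_
    obtain ⟨B, hB⟩ := hfar ε hε
    obtain ⟨B', hB'⟩ := hbdd B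
    have hKU : {y : ℂ | ε ≤ y.im ∧ ‖y‖ ≤ B'} ⊆ upperHalf := fun y hy => hε.trans_le hy.1
    refine hcompact _ ε (ψ '' {y : ℂ | ε ≤ y.im ∧ ‖y‖ ≤ B'}) (hd.continuousOn.sub continuousOn_id)
      ((isCompact_setOf_im_ge_norm_le ε B').image_of_continuousOn (hψc.mono hKU)) ?_ ?_
    · rintro _ ⟨y, hy, rfl⟩
      exact (hψmem y (hKU hy)).1
    rintro z ⟨hz, hzε⟩
    have hz0 : 0 < z.im := hz
    rw [Complex.sub_im] at hzε
    refine ⟨φ z, ⟨by linarith, hB' z hz ?_⟩, hψφ z hz⟩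
    by_contra! hlt
    have h2 := hB z hz hlt.le
    have h3 := (abs_le.1 (Complex.abs_im_le_norm (φ z - z))).2
    rw [Complex.sub_im] at h3
    linarith
  have him : ∀ z ∈ upperHalf, (φ z - z).im = 0 := fun z hz => by
    have h1 := hle z hz
    have h2 := hge z hz
    rw [Complex.sub_im] at *
    linarith
  have hconst : ∃ c, ∀ z ∈ upperHalf, φ z - z = c := by
    rcases ((hd.sub differentiableOn_id).analyticOnNhd isOpen_upperHalf).is_constant_or_isOpen
      isPreconnected_upperHalf with h | h
    · exact h
    · exfalso
      have ho := h _ subset_rfl isOpen_upperHalf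
      have hI : Complex.I ∈ upperHalf := by simp
      obtain ⟨δ, hδ, hb⟩ := Metric.isOpen_iff.1 ho _ (mem_image_of_mem _ hI)
      have hmem : φ Complex.I - Complex.I + (δ / 2 : ℝ) * Complex.I ∈
          Metric.ball (φ Complex.I - Complex.I) δ := by
        rw [mem_ball_iff_norm, add_sub_cancel_left, norm_mul, Complex.norm_real, Complex.norm_I,
          Real.norm_of_nonneg (by positivity)]
        linarith
      obtain ⟨z, hz, hzeq⟩ := hb hmem
      have e1 := him z hz
      have e2 := him _ hI
      have e3 := congrArg Complex.im hzeq
      simp only [Pi.sub_apply, id] at e3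
      rw [e1, Complex.add_im, e2] at e3
      simp at e3
      linarith
  obtain ⟨c, hc⟩ := hconst
  have hc0 : c = 0 := by
    by_contra hne
    obtain ⟨B, hB⟩ := hfar ‖c‖ (norm_pos_iff.2 hne)
    have h1 : (((|B| + 1 : ℝ) : ℂ) * Complex.I) ∈ upperHalf := by
      change 0 < (((|B| + 1 : ℝ) : ℂ) * Complex.I).im
      rw [Complex.im_ofReal_mul, Complex.I_im, mul_one]
      positivity
    have h2 := hB _ h1 (by
      rw [norm_mul, Complex.norm_real, Complex.norm_I, Real.norm_of_nonneg (by positivity)]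
      linarith [le_abs_self B])
    rw [hc _ h1] at h2
    exact lt_irrefl _ h2
  intro z hz
  have := hc z hz
  rw [hc0, sub_eq_zero] at this
  exact this

lemma ae_abs_le_of_isCompact {μ : Measure ℝ} {K : Set ℝ} (hK : IsCompact K) (hμ : μ Kᶜ = 0) :
    ∃ C, ∀ᵐ x ∂μ, |x| ≤ C := by
  obtain ⟨C, hC⟩ := hK.isBounded.exists_norm_le
  exact ⟨C, measure_mono_null (fun x hx hxK => hx (hC x hxK)) hμ⟩

lemma IsNormalizedRightInverse.Ftransform_eqOn {Ω : Set ℂ} {μ ν : Measure ℝ} {g : ℂ → ℂ} {R C : ℝ}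
    [IsProbabilityMeasure ν] (hg : IsNormalizedRightInverse Ω μ g) (himg : g '' Ω = upperHalf)
    (ho : IsOpen Ω) (h0 : Ω ⊆ upperHalf) (hR : 0 < R)
    (hΩR : ∀ w : ℂ, 0 < w.im → R ≤ ‖w‖ → w ∈ Ω) (hν : ∀ᵐ x ∂ν, |x| ≤ C) (hm : ∫ x, x ∂ν = 0)
    (hinj : InjOn (Ftransform ν) upperHalf) (hFν : Ftransform ν '' upperHalf = Ω) :
    EqOn (Ftransform ν) (Ftransform μ) upperHalf := by
  have hmaps : MapsTo (Ftransform ν) upperHalf Ω := hFν ▸ mapsTo_image _ _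
  have hginj : InjOn g Ω := LeftInvOn.injOn (f₁' := Ftransform μ) hg.Ftransform_apply
  have hd : DifferentiableOn ℂ (Ftransform ν) upperHalf := fun z hz =>
    (differentiableAt_Ftransform hz).differentiableWithinAt
  have hF := tendsto_Ftransform_sub_self hν
  rw [hm, Complex.ofReal_zero, neg_zero] at hF
  have hF' := hF.mono_left (inf_le_left : Bornology.cobounded ℂ ⊓ 𝓟 upperHalf ≤ _)
  have hFinf : Tendsto (Ftransform ν) (Bornology.cobounded ℂ ⊓ 𝓟 upperHalf)
      (Bornology.cobounded ℂ ⊓ 𝓟 upperHalf) := by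
    refine tendsto_inf.2 ⟨?_, tendsto_principal.2 ?_⟩
    · refine Tendsto.mono_left ?_ inf_le_left
      rw [← tendsto_norm_atTop_iff_cobounded]
      refine tendsto_atTop_mono' _ ?_
        (tendsto_atTop_add_const_right _ (-1) (tendsto_norm_cobounded_atTop (E := ℂ)))
      filter_upwards [hF.norm.eventually_le_const (u := 1) (by simp)] with z hz
      have := norm_sub_norm_le z (Ftransform ν z)
      rw [norm_sub_rev] at this
      linarith
    · exact eventually_inf_principal.2 (Eventually.of_forall fun z hz => h0 (hmaps hz))
  have hid : EqOn (g ∘ Ftransform ν) id upperHalf := by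
    refine eqOn_id_of_tendsto_sub (hg.differentiableOn.comp hd hmaps) (hginj.comp hinj hmaps)
      (by rw [image_comp, hFν, himg]) ?_ fun B₀ => ?_
    · have := (hg.tendsto_sub.comp hFinf).add hF'
      simpa using this
    · obtain ⟨B, -, hB⟩ := exists_Ftransform_eq hν hm
      refine ⟨max B (B₀ + 4) + 26 * R, fun z hz hzB => ?_⟩
      refine (hg.norm_le ho hR hΩR h0 (hmaps hz)).trans ?_
      gcongr
      rcases le_total B ‖Ftransform ν z‖ with h | h
      · obtain ⟨z', hz', hle, he⟩ := hB _ (h0 (hmaps hz)) h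
        rw [hinj hz' hz he] at hle
        have := norm_sub_norm_le (Ftransform ν z) z
        rw [norm_sub_rev] at this
        exact le_max_of_le_right (by linarith)
      · exact le_max_of_le_left h
  intro z hz
  rw [← hg.Ftransform_apply _ (hmaps hz)]
  exact congrArg _ (hid hz)

/-- For every simply connected domain Ω ⊆ ℍ whose complement ℍ∖Ω is bounded, there is a
unique compactly supported probability measure with mean 0 whose F-transform maps ℍ
conformally (injectively) onto Ω. -/
theorem univalent_Ftransform_onto_hull_complement
    (Ω : Set ℂ) (hΩsub : Ω ⊆ {z : ℂ | 0 < z.im})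
    (hopen : IsOpen Ω) (hconn : IsConnected Ω)
    (hsc : SimplyConnectedSpace Ω)
    (hbdd : Bornology.IsBounded ({z : ℂ | 0 < z.im} \ Ω)) :
    ∃! μ : Measure ℝ, IsProbabilityMeasure μ ∧
      (∃ K : Set ℝ, IsCompact K ∧ μ Kᶜ = 0) ∧
      (∫ x, x ∂μ) = 0 ∧
      Set.InjOn (Ftransform μ) {z : ℂ | 0 < z.im} ∧
      Ftransform μ '' {z : ℂ | 0 < z.im} = Ω := by
  obtain ⟨R, hR, hsub⟩ := hbdd.subset_ball_lt 0 0
  have hΩR : ∀ w : ℂ, 0 < w.im → R ≤ ‖w‖ → w ∈ Ω := by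
    intro w hw hwR
    by_contra hmem
    exact hwR.not_gt (by simpa using hsub ⟨hw, hmem⟩)
  obtain ⟨μ, g, hg, himg⟩ :=
    exists_isNormalizedRightInverse_image_eq hopen hconn hsc hΩsub hR hΩR
  have hprob := hg.isProbabilityMeasure
  have hμ := hg.ae_abs_le hopen hR hΩR
  refine ⟨μ, ⟨hprob, ⟨Icc (-(26 * R)) (26 * R), isCompact_Icc, ?_⟩,
    hg.integral_eq_zero hopen hR hΩR, ?_, ?_⟩, ?_⟩
  · filter_upwards [hμ] with x hx using abs_le.1 hx
  · change InjOn _ upperHalf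
    rw [← himg]
    rintro _ ⟨w, hw, rfl⟩ _ ⟨w', hw', rfl⟩ h
    rw [hg.Ftransform_apply w hw, hg.Ftransform_apply w' hw'] at h
    rw [h]
  · change _ '' upperHalf = _
    rw [← himg, image_image, image_congr hg.Ftransform_apply, image_id']
  · rintro ν ⟨hνp, ⟨K, hK, hνK⟩, hm, hinj, hFν⟩
    obtain ⟨C, hC⟩ := ae_abs_le_of_isCompact hK hνK
    exact measure_ext_of_cauchyTransform hC hμ fun z hz => inv_injective
      (hg.Ftransform_eqOn himg hopen hΩsub hR hΩR hC hm hinj hFν hz)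
end
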